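/- Let n ≥ 3, let p be an odd prime, and let f ∈ Out(F_n) have order p. Then N(f) = SOut(F_n) if det(ρ̄(f)) = 1, and N(f) = Out(F_n) if det(ρ̄(f)) = −1. -/

import Mathlib

open Matrix

namespace NormalClosurePaper

/-- The automorphism group of the free group on `n` generators. -/
abbrev FrAut (n : ℕ) := MulAut (FreeGroup (Fin n))

/-- Exponent sum of the generator `x_i` in a word of the free group. -/
def expSum {n : ℕ} (i : Fin n) : FreeGroup (Fin n) →* Multiplicative ℤ :=
  FreeGroup.lift fun j => Multiplicative.ofAdd (if j = i then (1 : ℤ) else 0)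

/-- The abelianized matrix of an automorphism of the free group:
the `(i, j)` entry is the exponent sum of `x_i` in `f x_j`. -/
def mat {n : ℕ} (f : FrAut n) : Matrix (Fin n) (Fin n) ℤ :=
  Matrix.of fun i j => (expSum i (f (FreeGroup.of j))).toAdd

lemma expSum_apply {n : ℕ} (f : FrAut n) (i : Fin n) (w : FreeGroup (Fin n)) :
    (expSum i (f w)).toAdd = ∑ k, mat f i k * (expSum k w).toAdd := by
  induction w using FreeGroup.induction_on with
  | C1 => simp
  | of j =>
      have h : (expSum i (f (FreeGroup.of j))).toAdd = mat f i j := rfl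
      rw [h]
      simp [expSum, mul_ite, Finset.sum_ite_eq]
  | inv_of j ih =>
      simp only [_root_.map_inv, toAdd_inv, mul_neg, Finset.sum_neg_distrib, ih]
  | mul x y ihx ihy =>
      simp only [_root_.map_mul, toAdd_mul, mul_add, Finset.sum_add_distrib, ihx, ihy]

lemma mat_one {n : ℕ} : mat (1 : FrAut n) = 1 := by
  ext i j
  simp [mat, expSum, Matrix.one_apply, eq_comm]

lemma mat_mul {n : ℕ} (f g : FrAut n) : mat (f * g) = mat f * mat g := by
  ext i j
  rw [Matrix.mul_apply]
  show (expSum i ((f * g) (FreeGroup.of j))).toAdd = _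
  rw [show (f * g) (FreeGroup.of j) = f (g (FreeGroup.of j)) from rfl, expSum_apply]
  rfl

/-- The matrix of the induced map on the abelianization, as a monoid homomorphism. -/
def matHom (n : ℕ) : FrAut n →* Matrix (Fin n) (Fin n) ℤ where
  toFun := mat
  map_one' := mat_one
  map_mul' := mat_mul

/-- The homomorphism `Aut(F_n) → GL_n(ℤ)` induced by abelianization. -/
def ρ (n : ℕ) : FrAut n →* GL (Fin n) ℤ := (matHom n).toHomUnits

/-- The composition of `ρ` with the determinant. -/
def detρ (n : ℕ) : FrAut n →* ℤˣ := (Matrix.GeneralLinearGroup.det).comp (ρ n)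

/-- The special automorphism group `SAut(F_n)`: automorphisms whose induced matrix
has determinant `1`. -/
def SAut (n : ℕ) : Subgroup (FrAut n) := (detρ n).ker

/-- The Torelli subgroup `IA_n`, the kernel of `ρ`. -/
def IA (n : ℕ) : Subgroup (FrAut n) := (ρ n).ker

/-- The group of inner automorphisms of the free group. -/
def Inn (n : ℕ) : Subgroup (FrAut n) := (MulAut.conj (G := FreeGroup (Fin n))).range

instance Inn_normal (n : ℕ) : (Inn n).Normal := by
  constructor
  rintro - ⟨a, rfl⟩ g
  refine ⟨g a, ?_⟩
  ext y
  simp [MulAut.conj_apply, MulAut.mul_apply, _root_.map_mul, _root_.map_inv]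

/-- The outer automorphism group `Out(F_n)`. -/
abbrev OutF (n : ℕ) := FrAut n ⧸ Inn n

/-- The projection `Aut(F_n) → Out(F_n)`. -/
def toOut (n : ℕ) : FrAut n →* OutF n := QuotientGroup.mk' (Inn n)

lemma mat_conj {n : ℕ} (g : FreeGroup (Fin n)) : mat (MulAut.conj g) = 1 := by
  rw [← mat_one (n := n)]
  ext i j
  simp only [mat, Matrix.of_apply, MulAut.conj_apply, MulAut.one_apply, _root_.map_mul,
    _root_.map_inv, toAdd_mul, toAdd_inv]
  omega

lemma ρ_conj {n : ℕ} (g : FreeGroup (Fin n)) : ρ n (MulAut.conj g) = 1 :=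
  Units.ext (mat_conj g)

/-- The homomorphism `Out(F_n) → GL_n(ℤ)` induced by abelianization. -/
def ρOut (n : ℕ) : OutF n →* GL (Fin n) ℤ :=
  QuotientGroup.lift (Inn n) (ρ n) (by rintro - ⟨g, rfl⟩; exact ρ_conj g)

/-- The composition of `ρOut` with the determinant. -/
def detρOut (n : ℕ) : OutF n →* ℤˣ := (Matrix.GeneralLinearGroup.det).comp (ρOut n)

/-- The special outer automorphism group `SOut(F_n)`. -/
def SOut (n : ℕ) : Subgroup (OutF n) := (detρOut n).ker

/-- Entrywise reduction `GL_n(ℤ) → GL_n(ℤ/ℓℤ)`. -/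
def redGL (n ℓ : ℕ) : GL (Fin n) ℤ →* GL (Fin n) (ZMod ℓ) :=
  Units.map (RingHom.mapMatrix (Int.castRingHom (ZMod ℓ))).toMonoidHom

/-- The subgroup `GΓ_n(ℓ)` of `GL_n(ℤ)` of matrices congruent to the identity mod `ℓ`. -/
def GGamma (n ℓ : ℕ) : Subgroup (GL (Fin n) ℤ) := (redGL n ℓ).ker

/-- The level `ℓ` congruence subgroup `Γ_n(ℓ)` (viewed inside `GL_n(ℤ)`): matrices with
determinant `1` that are congruent to the identity mod `ℓ`. -/
def GammaGL (n ℓ : ℕ) : Subgroup (GL (Fin n) ℤ) :=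
  GGamma n ℓ ⊓ (Matrix.GeneralLinearGroup.det).ker

/-- Reduction `SL_n(ℤ) → SL_n(ℤ/ℓℤ)`. -/
def redSL (n ℓ : ℕ) : Matrix.SpecialLinearGroup (Fin n) ℤ →*
    Matrix.SpecialLinearGroup (Fin n) (ZMod ℓ) :=
  Matrix.SpecialLinearGroup.map (Int.castRingHom (ZMod ℓ))

/-- Projection `SL_n(ℤ/ℓℤ) → PSL_n(ℤ/ℓℤ)`. -/
def projPSL (n ℓ : ℕ) : Matrix.SpecialLinearGroup (Fin n) (ZMod ℓ) →*
    Matrix.ProjectiveSpecialLinearGroup (Fin n) (ZMod ℓ) :=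
  QuotientGroup.mk' _

section

open scoped Pointwise

section Cuts

variable {E : Type*} [Group E]

/-- The directed boundary edges, with labels in `S`, leaving the subset `U` of the Cayley graph. -/
def bdry (S : Set E) (U : Set E) : Set (E × E) := {e | e.2 ∈ S ∧ e.1 ∈ U ∧ e.1 * e.2 ∉ U}

/-- Two subsets cross if all four corners are nonempty. -/
def Crosses {Ω : Type*} (A B : Set Ω) : Prop :=
  (A ∩ B).Nonempty ∧ (A ∩ Bᶜ).Nonempty ∧ (Aᶜ ∩ B).Nonempty ∧ (Aᶜ ∩ Bᶜ).Nonempty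

/-- A cut: a subset which, together with its complement, is infinite, and has finite boundary. -/
structure IsCut (S U : Set E) : Prop where
  fin : (bdry S U).Finite
  inf : U.Infinite
  inf_compl : Uᶜ.Infinite

/-- A cut whose boundary has the minimal number of edges among all cuts. -/
def IsMinCut (S U : Set E) : Prop :=
  IsCut S U ∧ ∀ V, IsCut S V → (bdry S U).ncard ≤ (bdry S V).ncard

lemma Crosses.symm {Ω : Type*} {A B : Set Ω} (h : Crosses A B) : Crosses B A := by
  obtain ⟨h1, h2, h3, h4⟩ := h
  refine ⟨?_, ?_, ?_, ?_⟩ <;> rw [Set.inter_comm] <;> assumption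

lemma Crosses.compl_right {Ω : Type*} {A B : Set Ω} (h : Crosses A B) : Crosses A Bᶜ := by
  obtain ⟨h1, h2, h3, h4⟩ := h
  exact ⟨h2, by simpa using h1, h4, by simpa using h3⟩

variable {S : Set E}

lemma bdry_compl (hS : ∀ s ∈ S, s⁻¹ ∈ S) (U : Set E) :
    bdry S Uᶜ = (fun e : E × E => (e.1 * e.2, e.2⁻¹)) '' bdry S U := by
  ext ⟨x, s⟩
  simp only [bdry, Set.mem_ofPred_eq, Set.mem_image, Prod.mk.injEq, Prod.exists, Set.mem_compl_iff,
    not_not]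
  constructor
  · rintro ⟨h1, h2, h3⟩
    exact ⟨x * s, s⁻¹, ⟨hS _ h1, h3, by simpa using h2⟩, by simp, by simp⟩
  · rintro ⟨y, t, ⟨h1, h2, h3⟩, rfl, rfl⟩
    exact ⟨hS _ h1, h3, by simpa using h2⟩

lemma ncard_bdry_compl (hS : ∀ s ∈ S, s⁻¹ ∈ S) (U : Set E) :
    (bdry S Uᶜ).ncard = (bdry S U).ncard := by
  rw [bdry_compl hS]
  apply Set.ncard_image_of_injective
  rintro ⟨x, s⟩ ⟨y, t⟩ h
  simp only [Prod.mk.injEq, _root_.inv_inj] at h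
  obtain ⟨h1, rfl⟩ := h
  simpa using h1

lemma IsCut.compl (hS : ∀ s ∈ S, s⁻¹ ∈ S) {U : Set E} (h : IsCut S U) : IsCut S Uᶜ :=
  ⟨by rw [bdry_compl hS]; exact h.fin.image _, h.inf_compl, by simpa using h.inf⟩

lemma IsMinCut.compl (hS : ∀ s ∈ S, s⁻¹ ∈ S) {U : Set E} (h : IsMinCut S U) : IsMinCut S Uᶜ :=
  ⟨h.1.compl hS, fun V hV => by rw [ncard_bdry_compl hS]; exact h.2 V hV⟩

lemma bdry_smul (g : E) (U : Set E) :
    bdry S (g • U) = (fun e : E × E => (g * e.1, e.2)) '' bdry S U := by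
  ext ⟨x, s⟩
  simp only [bdry, Set.mem_ofPred_eq, Set.mem_image, Prod.mk.injEq, Prod.exists,
    Set.mem_smul_set_iff_inv_smul_mem, smul_eq_mul]
  constructor
  · rintro ⟨h1, h2, h3⟩
    exact ⟨g⁻¹ * x, s, ⟨h1, h2, by rwa [mul_assoc]⟩, by simp, rfl⟩
  · rintro ⟨y, t, ⟨h1, h2, h3⟩, rfl, rfl⟩
    exact ⟨h1, by simpa using h2, by simpa [mul_assoc] using h3⟩

lemma IsCut.smul (g : E) {U : Set E} (h : IsCut S U) : IsCut S (g • U) :=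
  ⟨by rw [bdry_smul]; exact h.fin.image _, h.inf.smul_set,
    by rw [← Set.smul_set_compl]; exact h.inf_compl.smul_set⟩

lemma ncard_bdry_smul (g : E) (U : Set E) : (bdry S (g • U)).ncard = (bdry S U).ncard := by
  rw [bdry_smul]
  apply Set.ncard_image_of_injective
  rintro ⟨x, s⟩ ⟨y, t⟩ h
  simpa using h

lemma IsMinCut.smul (g : E) {U : Set E} (h : IsMinCut S U) : IsMinCut S (g • U) :=
  ⟨h.1.smul g, fun V hV => by rw [ncard_bdry_smul]; exact h.2 V hV⟩

lemma ncard_bdry_inter_add_union {U V : Set E} (hU : (bdry S U).Finite) (hV : (bdry S V).Finite) :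
    (bdry S (U ∩ V)).Finite ∧ (bdry S (U ∪ V)).Finite ∧
    (bdry S (U ∩ V)).ncard + (bdry S (U ∪ V)).ncard ≤ (bdry S U).ncard + (bdry S V).ncard := by
  have h1 : bdry S (U ∩ V) ∪ bdry S (U ∪ V) ⊆ bdry S U ∪ bdry S V := by
    rintro ⟨x, s⟩
    simp only [bdry, Set.mem_union, Set.mem_ofPred_eq, Set.mem_inter_iff]
    tauto
  have h2 : bdry S (U ∩ V) ∩ bdry S (U ∪ V) ⊆ bdry S U ∩ bdry S V := by
    rintro ⟨x, s⟩
    simp only [bdry, Set.mem_union, Set.mem_ofPred_eq, Set.mem_inter_iff]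
    tauto
  have hf := (hU.union hV).subset h1
  have f1 := hf.subset Set.subset_union_left
  have f2 := hf.subset Set.subset_union_right
  refine ⟨f1, f2, ?_⟩
  rw [← Set.ncard_union_add_ncard_inter _ _ f1 f2, ← Set.ncard_union_add_ncard_inter _ _ hU hV]
  exact Nat.add_le_add (Set.ncard_le_ncard h1 (hU.union hV))
    (Set.ncard_le_ncard h2 (hU.subset Set.inter_subset_left))

/-- The Cayley graph of a generating set is connected. -/
lemma eq_univ_of_forall_mul_mem (hS : ∀ s ∈ S, s⁻¹ ∈ S) (hgen : Subgroup.closure S = ⊤)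
    {W : Set E} {x : E} (hx : x ∈ W) (hW : ∀ z ∈ W, ∀ s ∈ S, z * s ∈ W) : W = Set.univ := by
  have key : ∀ w ∈ Subgroup.closure S, ∀ z ∈ W, z * w ∈ W := by
    intro w hw
    induction hw using Subgroup.closure_induction'' with
    | mem s hs => exact fun z hz => hW z hz s hs
    | inv_mem s hs => exact fun z hz => hW z hz _ (hS s hs)
    | one => simp
    | mul a b _ _ ha hb => intro z hz; rw [← mul_assoc]; exact hb _ (ha _ hz)
  refine Set.eq_univ_of_forall fun y => ?_
  have := key (x⁻¹ * y) (by rw [hgen]; trivial) x hx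
  simpa using this

lemma eq_of_bdry_eq (hS : ∀ s ∈ S, s⁻¹ ∈ S) (hgen : Subgroup.closure S = ⊤)
    {A B : Set E} (h : bdry S A = bdry S B) {x : E} (hA : x ∈ A) (hB : x ∈ B) : A = B := by
  have := eq_univ_of_forall_mul_mem hS hgen (W := {z | z ∈ A ↔ z ∈ B}) (x := x) (by simp [hA, hB])
    (by
      intro z hz s hs
      simp only [Set.mem_ofPred_eq] at hz ⊢
      have h1 := Set.ext_iff.1 h (z, s)
      have h2 := Set.ext_iff.1 h (z * s, s⁻¹)
      simp only [bdry, Set.mem_ofPred_eq, hs, hS s hs, mul_inv_cancel_right, true_and] at h1 h2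
      tauto)
  ext z
  exact (Set.ext_iff.1 this z).2 trivial

/-- A minimal cut is connected. -/
lemma IsMinCut.connected (hS : ∀ s ∈ S, s⁻¹ ∈ S) (hgen : Subgroup.closure S = ⊤)
    {A B : Set E} (hA : IsMinCut S A) (hBA : B ⊆ A) (hB : B.Nonempty)
    (hno : ∀ z ∈ B, ∀ s ∈ S, z * s ∈ A → z * s ∈ B) : B = A := by
  have hno' : ∀ z ∈ A \ B, ∀ s ∈ S, z * s ∈ A → z * s ∈ A \ B := by
    rintro z ⟨hzA, hzB⟩ s hs hzs
    refine ⟨hzs, fun h => hzB ?_⟩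
    simpa using hno _ h _ (hS s hs) (by simpa using hzA)
  have sub1 : bdry S B ⊆ bdry S A := by
    rintro ⟨x, s⟩ ⟨h1, h2, h3⟩
    exact ⟨h1, hBA h2, fun h => h3 (hno _ h2 _ h1 h)⟩
  have sub2 : bdry S (A \ B) ⊆ bdry S A := by
    rintro ⟨x, s⟩ ⟨h1, h2, h3⟩
    exact ⟨h1, h2.1, fun h => h3 (hno' _ h2 _ h1 h)⟩
  have disj : Disjoint (bdry S B) (bdry S (A \ B)) := by
    rw [Set.disjoint_left]
    rintro ⟨x, s⟩ ⟨_, h2, _⟩ ⟨_, h2', _⟩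
    exact h2'.2 h2
  have empt : ∀ W : Set E, W ⊆ A → bdry S W = ∅ → W = ∅ := by
    intro W hWA hW
    by_contra hne
    obtain ⟨x, hx⟩ := Set.nonempty_iff_ne_empty.2 hne
    have := eq_univ_of_forall_mul_mem hS hgen hx (by
      intro z hz s hs
      by_contra hzs
      have : (z, s) ∈ bdry S W := ⟨hs, hz, hzs⟩
      simp [hW] at this)
    obtain ⟨y, hy⟩ := hA.1.inf_compl.nonempty
    exact hy (hWA (this ▸ Set.mem_univ y))
  have full : ∀ W : Set E, W ⊆ A → W.Infinite → bdry S W ⊆ bdry S A → bdry S W = bdry S A := by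
    intro W hWA hW hsub
    refine Set.eq_of_subset_of_ncard_le hsub ?_ hA.1.fin
    exact hA.2 W ⟨hA.1.fin.subset hsub, hW, hA.1.inf_compl.mono (Set.compl_subset_compl.2 hWA)⟩
  by_cases hBi : B.Infinite
  · have h1 := full B hBA hBi sub1
    have h2 : bdry S (A \ B) = ∅ := by
      rw [Set.eq_empty_iff_forall_notMem]
      intro e he
      exact Set.disjoint_left.1 disj (h1 ▸ sub2 he) he
    have := empt _ Set.sdiff_subset h2
    exact hBA.antisymm (Set.sdiff_eq_empty.1 this)
  · have hi : (A \ B).Infinite := hA.1.inf.sdiff (Set.not_infinite.1 hBi)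
    have h1 := full _ Set.sdiff_subset hi sub2
    have h2 : bdry S B = ∅ := by
      rw [Set.eq_empty_iff_forall_notMem]
      intro e he
      exact Set.disjoint_left.1 disj he (h1 ▸ sub1 he)
    exact absurd (empt _ hBA h2) hB.ne_empty

open Filter in
/-- Only finitely many minimal cuts contain a given edge in their boundary. -/
lemma finite_minCut_edge (hS : ∀ s ∈ S, s⁻¹ ∈ S) (hSf : S.Finite)
    (hgen : Subgroup.closure S = ⊤) (e : E × E) :
    {B : Set E | IsMinCut S B ∧ e ∈ bdry S B}.Finite := by
  by_contra hinf
  set M := {B : Set E | IsMinCut S B ∧ e ∈ bdry S B} with hM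
  have : Infinite M := Set.infinite_coe_iff.2 hinf
  let 𝒰 : Ultrafilter M := hyperfilter M
  set L : Set E := {z | ∀ᶠ B : M in 𝒰, z ∈ (B : Set E)} with hL
  have memL : ∀ z, ∀ᶠ B : M in 𝒰, (z ∈ (B : Set E) ↔ z ∈ L) := by
    intro z
    by_cases hz : z ∈ L
    · filter_upwards [hz] with B hB
      simp [hB, hz]
    · have : ∀ᶠ B : M in 𝒰, z ∉ (B : Set E) := Ultrafilter.eventually_not.2 hz
      filter_upwards [this] with B hB
      simp [hB, hz]
  have memLf : ∀ K : Set E, K.Finite → ∀ᶠ B : M in 𝒰, ∀ z ∈ K, (z ∈ (B : Set E) ↔ z ∈ L) := by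
    intro K hK
    exact (Filter.eventually_all_finite hK).2 fun z _ => memL z
  obtain ⟨B₀, hB₀⟩ := Set.Infinite.nonempty hinf
  have edgeL : ∀ T : Set (E × E), T.Finite → T ⊆ bdry S L → ∀ᶠ B : M in 𝒰, T ⊆ bdry S B := by
    intro T hT hTL
    filter_upwards [memLf _ ((hT.image Prod.fst).union (hT.image fun e => e.1 * e.2))] with B hB
    rintro ⟨x, s⟩ hxs
    obtain ⟨h1, h2, h3⟩ := hTL hxs
    refine ⟨h1, (hB x (Or.inl ⟨_, hxs, rfl⟩)).2 h2, fun h => h3 ?_⟩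
    exact (hB _ (Or.inr ⟨_, hxs, rfl⟩)).1 h
  have card_le : ∀ B : M, (bdry S (B : Set E)).ncard ≤ (bdry S B₀).ncard := fun B =>
    B.2.1.2 _ hB₀.1.1
  have finL : (bdry S L).Finite := by
    by_contra hi
    obtain ⟨T, hTL, hTc⟩ := Set.Infinite.exists_subset_card_eq hi ((bdry S B₀).ncard + 1)
    obtain ⟨B, hB⟩ := (edgeL T T.finite_toSet hTL).exists
    have := Set.ncard_le_ncard hB B.2.1.1.fin
    rw [Set.ncard_coe_finset, hTc] at this
    have := card_le B
    omega
  have heL : e.1 ∈ L ∧ e.1 * e.2 ∉ L := by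
    constructor
    · exact Filter.Eventually.of_forall fun B => B.2.2.2.1
    · rw [hL, Set.mem_ofPred_eq, ← Ultrafilter.eventually_not]
      exact Filter.Eventually.of_forall fun B => B.2.2.2.2
  have infL : L.Infinite := by
    intro hf
    have hK : (L ∪ L * S).Finite := hf.union (hf.mul hSf)
    obtain ⟨B, hB⟩ := (memLf _ hK).exists
    have : L = B := B.2.1.connected hS hgen (fun z hz => (hB z (Or.inl hz)).2 hz) ⟨_, heL.1⟩
      (fun z hz s hs h => (hB _ (Or.inr ⟨z, hz, s, hs, rfl⟩)).1 h)
    exact B.2.1.1.inf (this ▸ hf)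
  have infLc : Lᶜ.Infinite := by
    intro hf
    have hK : (Lᶜ ∪ Lᶜ * S).Finite := hf.union (hf.mul hSf)
    obtain ⟨B, hB⟩ := (memLf _ hK).exists
    have : Lᶜ = (B : Set E)ᶜ := (B.2.1.compl hS).connected hS hgen
      (fun z hz => fun h => hz ((hB z (Or.inl hz)).1 h)) ⟨_, heL.2⟩
      (fun z hz s hs h => fun h' => h ((hB _ (Or.inr ⟨z, hz, s, hs, rfl⟩)).2 h'))
    exact B.2.1.1.inf_compl (this ▸ hf)
  have ev : ∀ᶠ B : M in 𝒰, (B : Set E) = L := by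
    filter_upwards [edgeL _ finL subset_rfl] with B hB
    have : bdry S L = bdry S (B : Set E) :=
      Set.eq_of_subset_of_ncard_le hB (B.2.1.2 L ⟨finL, infL, infLc⟩) B.2.1.1.fin
    exact eq_of_bdry_eq hS hgen this.symm B.2.2.2.1 heL.1
  obtain ⟨B, hB⟩ := ev.exists
  have : ∀ᶠ B' : M in 𝒰, B' = B := by
    filter_upwards [ev] with B' hB'
    exact Subtype.ext (hB'.trans hB.symm)
  have h2 : ({B} : Set M) ∈ hyperfilter M := this
  exact (Set.finite_singleton B).notMem_hyperfilter h2

lemma finite_minCut_sep (hS : ∀ s ∈ S, s⁻¹ ∈ S) (hSf : S.Finite)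
    (hgen : Subgroup.closure S = ⊤) (x y : E) :
    {B : Set E | IsMinCut S B ∧ x ∈ B ∧ y ∉ B}.Finite := by
  have key : ∀ w ∈ Subgroup.closure S, ∀ x, {B : Set E | IsMinCut S B ∧ x ∈ B ∧ x * w ∉ B}.Finite
      := by
    have hs' : ∀ s ∈ S, ∀ x, {B : Set E | IsMinCut S B ∧ x ∈ B ∧ x * s ∉ B}.Finite := by
      intro s hs x
      refine (finite_minCut_edge hS hSf hgen (x, s)).subset ?_
      rintro B ⟨h1, h2, h3⟩
      exact ⟨h1, hs, h2, h3⟩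
    intro w hw
    induction hw using Subgroup.closure_induction'' with
    | mem s hs => exact hs' s hs
    | inv_mem s hs => exact hs' _ (hS s hs)
    | one => intro x; convert Set.finite_empty; ext B; simp
    | mul a b _ _ ha hb =>
      intro x
      refine ((ha x).union (hb (x * a))).subset ?_
      rintro B ⟨h1, h2, h3⟩
      rw [← mul_assoc] at h3
      by_cases h : x * a ∈ B
      · exact Or.inr ⟨h1, h, h3⟩
      · exact Or.inl ⟨h1, h2, h⟩
  simpa using key (x⁻¹ * y) (by rw [hgen]; trivial) x

lemma finite_minCut_crosses (hS : ∀ s ∈ S, s⁻¹ ∈ S) (hSf : S.Finite)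
    (hgen : Subgroup.closure S = ⊤) {A : Set E} (hA : IsMinCut S A) :
    {B : Set E | IsMinCut S B ∧ Crosses A B}.Finite := by
  set K : Set E := Prod.fst '' bdry S A ∪ (fun e : E × E => e.1 * e.2) '' bdry S A with hK
  have hKf : K.Finite := (hA.1.fin.image _).union (hA.1.fin.image _)
  refine Set.Finite.subset (hKf.biUnion fun x _ => hKf.biUnion fun y _ =>
    finite_minCut_sep hS hSf hgen x y) ?_
  rintro B ⟨hB, h1, h2, h3, h4⟩
  simp only [Set.mem_iUnion, Set.mem_ofPred_eq, exists_prop]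
  by_contra hcon
  push Not at hcon
  have key : ∀ C : Set E, IsMinCut S C → (A ∩ C).Nonempty → (Aᶜ ∩ C).Nonempty →
      ∃ x ∈ K, x ∈ C := by
    intro C hC hne hne'
    by_contra hno
    push Not at hno
    have : A ∩ C = C := hC.connected hS hgen Set.inter_subset_right hne (by
      rintro z ⟨hzA, hzC⟩ s hs hzs
      refine ⟨?_, hzs⟩
      by_contra hzA'
      exact hno z (Or.inl ⟨(z, s), ⟨hs, hzA, hzA'⟩, rfl⟩) hzC)
    obtain ⟨y, hy1, hy2⟩ := hne'
    rw [← this] at hy2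
    exact hy1 hy2.1
  obtain ⟨x, hxK, hxB⟩ := key B hB h1 h3
  obtain ⟨y, hyK, hyB⟩ := key _ (hB.compl hS) h2 h4
  exact hyB (hcon x hxK y hyK hB hxB)

/-- If opposite corners of two minimal cuts are infinite, these corners are minimal cuts. -/
lemma IsMinCut.inter_union {A B : Set E} (hA : IsMinCut S A) (hB : IsMinCut S B)
    (h1 : (A ∩ B).Infinite) (h2 : (Aᶜ ∩ Bᶜ).Infinite) :
    IsMinCut S (A ∩ B) ∧ IsMinCut S (A ∪ B) := by
  obtain ⟨f1, f2, hle⟩ := ncard_bdry_inter_add_union hA.1.fin hB.1.fin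
  have c1 : IsCut S (A ∩ B) := ⟨f1, h1, h2.mono (by
    rintro x ⟨hx, _⟩ h; exact hx h.1)⟩
  have c2 : IsCut S (A ∪ B) := ⟨f2, h1.mono (fun x hx => Or.inl hx.1), by
    rw [Set.compl_union]; exact h2⟩
  have a1 := hA.2 _ c1
  have a2 := hA.2 _ c2
  have b1 := hB.2 _ c1
  have b2 := hB.2 _ c2
  exact ⟨⟨c1, fun V hV => by have := hA.2 V hV; omega⟩,
    ⟨c2, fun V hV => by have := hA.2 V hV; omega⟩⟩

lemma not_crosses_iff {Ω : Type*} {A B : Set Ω} :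
    ¬ Crosses A B ↔ A ⊆ Bᶜ ∨ A ⊆ B ∨ B ⊆ A ∨ Aᶜ ⊆ B := by
  simp only [Crosses, not_and_or, Set.not_nonempty_iff_eq_empty, ← Set.disjoint_iff_inter_eq_empty,
    ← Set.subset_compl_iff_disjoint_right, compl_compl, Set.compl_subset_compl]

lemma crosses_of_crosses_inter {Ω : Type*} {A B C : Set Ω} (h : Crosses (A ∩ B) C)
    (hne : (Aᶜ ∩ Bᶜ).Nonempty) : Crosses A C ∨ Crosses B C := by
  by_contra hcon
  rw [not_or, not_crosses_iff, not_crosses_iff] at hcon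
  obtain ⟨⟨x1, h1⟩, ⟨x2, h2⟩, ⟨x3, h3⟩, ⟨x4, h4⟩⟩ := h
  obtain ⟨y, hy⟩ := hne
  obtain ⟨hA, hB⟩ := hcon
  simp only [Set.subset_def, Set.mem_compl_iff, Set.mem_inter_iff] at *
  have a1 : ∀ x ∈ C, x ∈ A := by
    rcases hA with h | h | h | h
    · exact absurd h1.2 (h _ h1.1.1)
    · exact absurd (h _ h2.1.1) h2.2
    · exact h
    · by_contra hno
      push Not at hno
      have := h y hy.1
      rcases hB with h' | h' | h' | h'
      · exact absurd h1.2 (h' _ h1.1.2)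
      · exact absurd (h' _ h2.1.2) h2.2
      · exact hy.2 (h' _ this)
      · by_cases h4A : x4 ∈ A
        · by_cases h4B : x4 ∈ B
          · exact h4.1 ⟨h4A, h4B⟩
          · exact h4.2 (h' _ h4B)
        · exact h4.2 (h _ h4A)
  have a2 : ∀ x ∈ C, x ∈ B := by
    rcases hB with h | h | h | h
    · exact absurd h1.2 (h _ h1.1.2)
    · exact absurd (h _ h2.1.2) h2.2
    · exact h
    · exact absurd (a1 _ (h y hy.2)) hy.1
  exact h3.1 ⟨a1 _ h3.2, a2 _ h3.2⟩

lemma Crosses.compl_left {Ω : Type*} {A B : Set Ω} (h : Crosses A B) : Crosses Aᶜ B :=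
  h.symm.compl_right.symm

lemma crosses_compl_left {Ω : Type*} {A B : Set Ω} : Crosses Aᶜ B ↔ Crosses A B :=
  ⟨fun h => by simpa using h.compl_left, Crosses.compl_left⟩

lemma crosses_of_crosses_union {Ω : Type*} {A B C : Set Ω} (h : Crosses (A ∪ B) C)
    (hne : (A ∩ B).Nonempty) : Crosses A C ∨ Crosses B C := by
  have := crosses_of_crosses_inter (A := Aᶜ) (B := Bᶜ) (C := C)
    (by rw [← Set.compl_union]; exact h.compl_left) (by simpa using hne)
  simpa only [crosses_compl_left] using this

lemma crosses_of_crosses_inter_of_crosses_union {Ω : Type*} {A B C : Set Ω}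
    (h : Crosses (A ∩ B) C) (h' : Crosses (A ∪ B) C) : Crosses A C ∧ Crosses B C := by
  obtain ⟨⟨x1, h1⟩, ⟨x2, h2⟩, -, -⟩ := h
  obtain ⟨-, -, ⟨x3, h3⟩, ⟨x4, h4⟩⟩ := h'
  simp only [Set.mem_compl_iff, Set.mem_inter_iff, Set.mem_union, not_or] at *
  exact ⟨⟨⟨x1, h1.1.1, h1.2⟩, ⟨x2, h2.1.1, h2.2⟩, ⟨x3, h3.1.1, h3.2⟩, ⟨x4, h4.1.1, h4.2⟩⟩,
    ⟨⟨x1, h1.1.2, h1.2⟩, ⟨x2, h2.1.2, h2.2⟩, ⟨x3, h3.1.2, h3.2⟩, ⟨x4, h4.1.2, h4.2⟩⟩⟩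

/-- The number of minimal cuts crossing a given subset. -/
noncomputable def crossNum (S A : Set E) : ℕ := {B : Set E | IsMinCut S B ∧ Crosses A B}.ncard

lemma crossNum_compl (A : Set E) : crossNum S Aᶜ = crossNum S A := by
  simp only [crossNum, crosses_compl_left]

lemma Crosses.smul {g : E} {A B : Set E} (h : Crosses A B) : Crosses (g • A) (g • B) := by
  obtain ⟨h1, h2, h3, h4⟩ := h
  refine ⟨?_, ?_, ?_, ?_⟩ <;> simp only [← Set.smul_set_compl, ← Set.smul_set_inter] <;>
    exact Set.Nonempty.smul_set (by assumption)

lemma crossNum_smul (g : E) (A : Set E) : crossNum S (g • A) = crossNum S A := by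
  have : {B : Set E | IsMinCut S B ∧ Crosses (g • A) B} =
      (fun B => g • B) '' {B : Set E | IsMinCut S B ∧ Crosses A B} := by
    ext B
    simp only [Set.mem_image, Set.mem_ofPred_eq]
    constructor
    · rintro ⟨h1, h2⟩
      exact ⟨g⁻¹ • B, ⟨h1.smul _, by simpa using h2.smul (g := g⁻¹)⟩, by simp⟩
    · rintro ⟨C, ⟨h1, h2⟩, rfl⟩
      exact ⟨h1.smul _, h2.smul⟩
  rw [crossNum, this]
  exact Set.ncard_image_of_injective _ (MulAction.injective g)

lemma crossNum_inter_add_union_lt (hS : ∀ s ∈ S, s⁻¹ ∈ S) (hSf : S.Finite)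
    (hgen : Subgroup.closure S = ⊤) {A B : Set E} (hA : IsMinCut S A) (hB : IsMinCut S B)
    (h : Crosses A B) (hi : IsMinCut S (A ∩ B)) (hu : IsMinCut S (A ∪ B)) :
    crossNum S (A ∩ B) + crossNum S (A ∪ B) < crossNum S A + crossNum S B := by
  have fin := fun {A : Set E} (hA : IsMinCut S A) => finite_minCut_crosses hS hSf hgen hA
  have h1 : {C : Set E | IsMinCut S C ∧ Crosses (A ∩ B) C} ∪
      {C : Set E | IsMinCut S C ∧ Crosses (A ∪ B) C} ⊆
      ({C : Set E | IsMinCut S C ∧ Crosses A C} ∪ {C : Set E | IsMinCut S C ∧ Crosses B C}) \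
        {B} := by
    rintro C (⟨hC, hC'⟩ | ⟨hC, hC'⟩)
    · refine ⟨?_, ?_⟩
      · rcases crosses_of_crosses_inter hC' h.2.2.2 with h | h
        exacts [Or.inl ⟨hC, h⟩, Or.inr ⟨hC, h⟩]
      · rintro rfl
        obtain ⟨-, ⟨x, hx⟩, -, -⟩ := hC'
        exact hx.2 hx.1.2
    · refine ⟨?_, ?_⟩
      · rcases crosses_of_crosses_union hC' h.1 with h | h
        exacts [Or.inl ⟨hC, h⟩, Or.inr ⟨hC, h⟩]
      · rintro rfl
        obtain ⟨-, -, ⟨x, hx⟩, -⟩ := hC'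
        exact hx.1 (Or.inr hx.2)
  have h2 : {C : Set E | IsMinCut S C ∧ Crosses (A ∩ B) C} ∩
      {C : Set E | IsMinCut S C ∧ Crosses (A ∪ B) C} ⊆
      {C : Set E | IsMinCut S C ∧ Crosses A C} ∩ {C : Set E | IsMinCut S C ∧ Crosses B C} := by
    rintro C ⟨⟨hC, h1⟩, ⟨-, h2⟩⟩
    obtain ⟨h3, h4⟩ := crosses_of_crosses_inter_of_crosses_union h1 h2
    exact ⟨⟨hC, h3⟩, ⟨hC, h4⟩⟩
  have h3 : B ∈ {C : Set E | IsMinCut S C ∧ Crosses A C} ∪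
      {C : Set E | IsMinCut S C ∧ Crosses B C} := Or.inl ⟨hB, h⟩
  have f12 := (fin hA).union (fin hB)
  simp only [crossNum]
  rw [← Set.ncard_union_add_ncard_inter _ _ (fin hi) (fin hu),
    ← Set.ncard_union_add_ncard_inter _ _ (fin hA) (fin hB)]
  have e1 := Set.ncard_le_ncard h1 f12.sdiff
  have e2 := Set.ncard_le_ncard h2 ((fin hA).subset Set.inter_subset_left)
  have e3 := Set.ncard_sdiff_singleton_lt_of_mem h3 f12
  omega

/-- Existence of a cut all of whose translates are nested. -/
theorem exists_nested_minCut (hS : ∀ s ∈ S, s⁻¹ ∈ S) (hSf : S.Finite)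
    (hgen : Subgroup.closure S = ⊤) {U₀ : Set E} (h₀ : IsCut S U₀) :
    ∃ U, IsCut S U ∧ ∀ g : E, ¬ Crosses U (g • U) := by
  classical
  obtain ⟨A₀, hA₀⟩ : ∃ A, IsMinCut S A := by
    have hex : ∃ k, ∃ A, IsCut S A ∧ (bdry S A).ncard = k := ⟨_, U₀, h₀, rfl⟩
    obtain ⟨A, hA, hk⟩ := Nat.find_spec hex
    exact ⟨A, hA, fun V hV => hk ▸ Nat.find_min' hex ⟨V, hV, rfl⟩⟩
  obtain ⟨A, hA, hmin⟩ : ∃ A, IsMinCut S A ∧ ∀ B, IsMinCut S B → crossNum S A ≤ crossNum S B := by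
    have hex : ∃ k, ∃ A, IsMinCut S A ∧ crossNum S A = k := ⟨_, A₀, hA₀, rfl⟩
    obtain ⟨A, hA, hk⟩ := Nat.find_spec hex
    exact ⟨A, hA, fun V hV => hk ▸ Nat.find_min' hex ⟨V, hV, rfl⟩⟩
  have key : ∀ B, IsMinCut S B → crossNum S B = crossNum S A → Crosses A B →
      (A ∩ B).Infinite → (Aᶜ ∩ Bᶜ).Infinite → False := by
    intro B hB hBA hc h1 h2
    obtain ⟨hi, hu⟩ := hA.inter_union hB h1 h2
    have := crossNum_inter_add_union_lt hS hSf hgen hA hB hc hi hu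
    have := hmin _ hi
    have := hmin _ hu
    omega
  refine ⟨A, hA.1, fun g hc => ?_⟩
  have hB : IsMinCut S (g • A) := hA.smul g
  have hBA : crossNum S (g • A) = crossNum S A := crossNum_smul g A
  generalize g • A = B at *
  have split : ∀ X Y : Set E, X.Infinite → ¬ (X ∩ Y).Infinite → (X ∩ Yᶜ).Infinite := by
    intro X Y hX hXY
    have := hX.sdiff (Set.not_infinite.1 hXY)
    refine this.mono ?_
    rintro x ⟨h1, h2⟩
    exact ⟨h1, fun h => h2 ⟨h1, h⟩⟩
  by_cases h : (A ∩ B).Infinite ∧ (Aᶜ ∩ Bᶜ).Infinite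
  · exact key B hB hBA hc h.1 h.2
  · refine key Bᶜ (hB.compl hS) ((crossNum_compl B).trans hBA) hc.compl_right ?_ ?_
    · rcases not_and_or.1 h with h | h
      · exact split _ _ hA.1.inf h
      · have := split Bᶜ Aᶜ hB.1.inf_compl (by rwa [Set.inter_comm])
        rwa [compl_compl, Set.inter_comm] at this
    · rw [compl_compl]
      rcases not_and_or.1 h with h | h
      · have := split B A hB.1.inf (by rwa [Set.inter_comm])
        rwa [Set.inter_comm] at this
      · simpa using split _ _ hA.1.inf_compl h

end Cuts

end

section

section Pocset

/-- A discrete nested system of half-spaces `H` with complementation `c`, on which a group `G`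
acts freely and without inversions, with a single orbit of complementary pairs. -/
structure IsPocset {G H : Type*} [Group G] [PartialOrder H] [MulAction G H]
    (c : H → H) (U : H) : Prop where
  cc : ∀ X : H, c (c X) = X
  c_le : ∀ X Y : H, X ≤ Y → c Y ≤ c X
  smul_c : ∀ (g : G) (X : H), g • c X = c (g • X)
  smul_le : ∀ (g : G) (X Y : H), X ≤ Y → g • X ≤ g • Y
  nested : ∀ X Y : H, X ≤ Y ∨ Y ≤ X ∨ X ≤ c Y ∨ c X ≤ Y
  proper : ∀ X Y : H, X ≤ Y → X ≤ c Y → False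
  fin : ∀ X Y : H, (Set.Icc X Y).Finite
  free : ∀ g : G, g • U = U → g = 1
  noinv : ∀ g : G, g • U ≠ c U
  orbit : ∀ X : H, ∃ g : G, X = g • U ∨ X = g • c U

/-- Two half-spaces are adjacent if they bound the same vertex. -/
def Adj {H : Type*} [PartialOrder H] (c : H → H) (X Y : H) : Prop := X = Y ∨ c X ⋖ Y

namespace IsPocset

variable {G H : Type*} [Group G] [PartialOrder H] [MulAction G H] {c : H → H} {U : H}

lemma c_le_c (h : IsPocset (G := G) c U) {X Y : H} : c X ≤ c Y ↔ Y ≤ X :=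
  ⟨fun h' => by simpa [h.cc] using h.c_le _ _ h', h.c_le _ _⟩

lemma c_lt_c (h : IsPocset (G := G) c U) {X Y : H} : c X < c Y ↔ Y < X := by
  rw [lt_iff_le_not_ge, lt_iff_le_not_ge, h.c_le_c, h.c_le_c]

lemma lt_c_comm (h : IsPocset (G := G) c U) {X Y : H} : X < c Y ↔ Y < c X := by
  rw [← h.c_lt_c, h.cc]

lemma c_inj (h : IsPocset (G := G) c U) {X Y : H} : c X = c Y ↔ X = Y :=
  ⟨fun h' => by rw [← h.cc X, h', h.cc], fun h' => by rw [h']⟩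

lemma smul_le_iff (h : IsPocset (G := G) c U) (g : G) {X Y : H} : g • X ≤ g • Y ↔ X ≤ Y :=
  ⟨fun h' => by simpa using h.smul_le g⁻¹ _ _ h', h.smul_le g _ _⟩

lemma smul_lt_iff (h : IsPocset (G := G) c U) (g : G) {X Y : H} : g • X < g • Y ↔ X < Y := by
  rw [lt_iff_le_not_ge, lt_iff_le_not_ge, h.smul_le_iff, h.smul_le_iff]

/-- The same system, with the complementary base half-space. -/
lemma symm (h : IsPocset (G := G) c U) : IsPocset (G := G) c (c U) where
  __ := h
  free g hg := h.free g (by rwa [h.smul_c, h.c_inj] at hg)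
  noinv g hg := h.noinv g (by rwa [h.smul_c, h.c_inj] at hg)
  orbit X := by
    obtain ⟨g, hg⟩ := h.orbit X
    exact ⟨g, by rw [h.cc]; exact hg.symm⟩

lemma free' (h : IsPocset (G := G) c U) {g : G} {X : H} (hg : g • X = X) : g = 1 := by
  obtain ⟨a, rfl | rfl⟩ := h.orbit X
  · have := h.free (a⁻¹ * g * a) (by simp [mul_smul, hg])
    simpa [mul_assoc, inv_mul_eq_one, eq_comm] using this
  · have := h.symm.free (a⁻¹ * g * a) (by simp [mul_smul, hg])
    simpa [mul_assoc, inv_mul_eq_one, eq_comm] using this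

lemma noinv' (h : IsPocset (G := G) c U) (g : G) {X : H} : g • X ≠ c X := by
  intro hg
  obtain ⟨a, rfl | rfl⟩ := h.orbit X
  · exact h.noinv (a⁻¹ * g * a) (by simp [mul_smul, hg, ← h.smul_c])
  · exact h.symm.noinv (a⁻¹ * g * a) (by simp [mul_smul, hg, ← h.smul_c])

lemma not_lt_of_c_lt (h : IsPocset (G := G) c U) {X Y : H} (h1 : c X < Y) : ¬ X < Y := by
  intro h2
  rw [← h.c_lt_c] at h1 h2
  rw [h.cc] at h1
  exact h.proper _ _ h1.le h2.le

lemma proper' (h : IsPocset (G := G) c U) {X Y : H} (h1 : X < Y) (h2 : X < c Y) : False :=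
  h.proper _ _ h1.le h2.le

lemma c_ne (h : IsPocset (G := G) c U) (X : H) : c X ≠ X := by
  intro hX
  exact h.noinv' (1 : G) (X := X) (by rw [one_smul, hX])

lemma adj_refl (X : H) : Adj c X X := Or.inl rfl

lemma covBy_c (h : IsPocset (G := G) c U) {X Y : H} (hXY : X ⋖ Y) : c Y ⋖ c X := by
  refine ⟨h.c_lt_c.2 hXY.1, fun Z hZ hZ' => hXY.2 (c := c Z) ?_ ?_⟩
  · rw [← h.c_lt_c, h.cc]; exact hZ'
  · rw [← h.c_lt_c, h.cc]; exact hZ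

lemma adj_symm (h : IsPocset (G := G) c U) {X Y : H} (hXY : Adj c X Y) : Adj c Y X := by
  rcases hXY with rfl | hXY
  · exact adj_refl _
  · right
    simpa [h.cc] using h.covBy_c hXY

lemma adj_trans (h : IsPocset (G := G) c U) {X Y Z : H} (hXY : Adj c X Y) (hYZ : Adj c Y Z) :
    Adj c X Z := by
  rcases hXY with rfl | h1
  · exact hYZ
  rcases hYZ with rfl | h2
  · exact Or.inr h1
  have h3 : c Z ⋖ Y := by simpa [h.cc] using h.covBy_c h2
  rcases h.nested X Z with hn | hn | hn | hn
  · left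
    rcases hn.eq_or_lt with hn | hn
    · exact hn
    · exact absurd h1.1 (h3.2 (h.c_lt_c.2 hn))
  · left
    rcases hn.eq_or_lt with hn | hn
    · exact hn.symm
    · exact absurd h3.1 (h1.2 (h.c_lt_c.2 hn))
  · exact absurd (hn.trans_lt h3.1) (h.not_lt_of_c_lt h1.1)
  · right
    rcases hn.eq_or_lt with hn | hn
    · exact absurd (hn ▸ h1.1) (h.not_lt_of_c_lt h3.1)
    refine ⟨hn, fun W hW hW' => ?_⟩
    rcases h.nested W Y with hn | hn | hn | hn
    · rcases hn.eq_or_lt with rfl | hn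
      · exact h.not_lt_of_c_lt h2.1 hW'
      · exact h1.2 hW hn
    · exact h.not_lt_of_c_lt h2.1 (hn.trans_lt hW')
    · exact h.proper' h1.1 (hW.trans_le hn)
    · have hn' : c Y ≤ W := by rw [← h.c_le_c, h.cc]; exact hn
      rcases hn'.eq_or_lt with rfl | hn'
      · exact h.proper' h1.1 hW
      · exact h2.2 hn' hW'

lemma adj_smul (h : IsPocset (G := G) c U) (g : G) {X Y : H} (hXY : Adj c X Y) :
    Adj c (g • X) (g • Y) := by
  rcases hXY with rfl | hXY
  · exact adj_refl _
  · right
    rw [← h.smul_c]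
    refine ⟨(h.smul_lt_iff g).2 hXY.1, fun Z hZ hZ' => hXY.2 (c := g⁻¹ • Z) ?_ ?_⟩
    · rw [← h.smul_lt_iff g]; simpa using hZ
    · rw [← h.smul_lt_iff g]; simpa using hZ'

/-- The stabilizer of the vertex bounded by the base half-space. -/
def stab (h : IsPocset (G := G) c U) : Subgroup G where
  carrier := {g | Adj c (g • U) U}
  one_mem' := by simpa using adj_refl U
  mul_mem' {a b} ha hb := by
    rw [Set.mem_ofPred_eq, mul_smul]
    exact h.adj_trans (h.adj_smul a hb) ha
  inv_mem' {a} ha := by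
    have := h.adj_smul a⁻¹ ha
    rw [inv_smul_smul] at this
    exact h.adj_symm this

lemma mem_stab (h : IsPocset (G := G) c U) {g : G} : g ∈ h.stab ↔ Adj c (g • U) U := Iff.rfl

lemma lt_of_adj {X Y : H} (hXY : Adj c X Y) (hne : X ≠ Y) :
    c X < Y := (hXY.resolve_left hne).1

/-- The elements carrying the complement of the base half-space to its vertex. -/
def swaps (G : Type*) [Group G] [MulAction G H] (c : H → H) (U : H) : Set G :=
  {t : G | Adj c (t • c U) U}

lemma mem_swaps {t : G} : t ∈ swaps G c U ↔ Adj c (t • c U) U := Iff.rfl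

lemma mem_stab_of_mem_swaps (h : IsPocset (G := G) c U) {t s : G} (ht : t ∈ swaps G c U)
    (hs : s ∈ swaps G c U) : t * s⁻¹ ∈ h.stab := by
  rw [h.mem_stab, mul_smul]
  have h1 := h.adj_smul s⁻¹ (mem_swaps.1 hs)
  rw [inv_smul_smul] at h1
  exact h.adj_trans (h.adj_smul t (h.adj_symm h1)) ht

lemma conj_mem_stab (h : IsPocset (G := G) c U) {t g : G} (ht : t ∈ swaps G c U) :
    t * g * t⁻¹ ∈ h.stab ↔ g ∈ h.symm.stab := by
  have ht' := h.adj_smul t⁻¹ (mem_swaps.1 ht)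
  rw [inv_smul_smul] at ht'
  rw [h.mem_stab, h.symm.mem_stab, mul_smul, mul_smul]
  constructor
  · intro h1
    have h2 := h.adj_smul t⁻¹ h1
    rw [inv_smul_smul] at h2
    exact h.adj_trans (h.adj_smul g ht') (h.adj_trans h2 (h.adj_symm ht'))
  · intro h1
    have h2 := h.adj_smul t h1
    exact h.adj_trans (h.adj_smul t (h.adj_smul g (h.adj_symm ht'))) (h.adj_trans h2 ht)

lemma mul_mem_swaps (h : IsPocset (G := G) c U) {t g : G} (hg : g ∈ h.stab)
    (ht : t ∈ swaps G c U) : g * t ∈ swaps G c U := by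
  rw [mem_swaps, mul_smul]
  exact h.adj_trans (h.adj_smul g ht) hg

lemma exists_covBy (h : IsPocset (G := G) c U) {X Y : H} (hXY : X < Y) :
    ∃ Z, X ⋖ Z ∧ Z ≤ Y := by
  obtain ⟨Z, ⟨hZ1, hZ2⟩, hmin⟩ := Set.Finite.exists_minimal
    ((h.fin X Y).subset Set.Ioc_subset_Icc_self) (⟨Y, hXY, le_rfl⟩ : (Set.Ioc X Y).Nonempty)
  exact ⟨Z, ⟨hZ1, fun W hW hW' => (hmin ⟨hW, hW'.le.trans hZ2⟩ hW'.le).not_gt hW'⟩, hZ2⟩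

/-- Induction along chains of covers. -/
lemma lt_induction (h : IsPocset (G := G) c U) {r : H → H → Prop}
    (hcov : ∀ X Y, X ⋖ Y → r X Y) (htrans : ∀ X Y Z, r X Y → r Y Z → r X Z)
    {X Y : H} (hXY : X < Y) : r X Y := by
  induction hn : (Set.Icc X Y).ncard using Nat.strong_induction_on generalizing X with
  | _ n ih =>
    obtain ⟨Z, hZ, hZY⟩ := h.exists_covBy hXY
    rcases hZY.eq_or_lt with rfl | hZY
    · exact hcov _ _ hZ
    · refine htrans _ _ _ (hcov _ _ hZ) (ih _ ?_ hZY rfl)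
      rw [← hn]
      refine Set.ncard_lt_ncard ⟨Set.Icc_subset_Icc_left hZ.1.le, fun hsub => ?_⟩ (h.fin _ _)
      exact (hsub ⟨le_rfl, hXY.le⟩).1.not_gt hZ.1

/-- The vertex stabilizers together with the swaps generate. -/
lemma closure_eq_top (h : IsPocset (G := G) c U) {K : Subgroup G} (hP : h.stab ≤ K)
    (hQ : h.symm.stab ≤ K) (hT : swaps G c U ⊆ K) : K = ⊤ := by
  let e : H → G → Prop := fun X a => X = a • U ∨ X = a • c U
  have hcov : ∀ X Y, X ⋖ Y → ∀ a b, e X a → e Y b → a⁻¹ * b ∈ K := by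
    intro X Y hXY a b ha hb
    have hadj : Adj c (c X) Y := Or.inr (by rwa [h.cc])
    have hadj' := h.adj_smul b⁻¹ hadj
    have hadj2 := h.adj_smul a⁻¹ (h.adj_symm hadj)
    rcases ha with rfl | rfl <;> rcases hb with rfl | rfl
    · rw [inv_smul_smul, ← h.smul_c, ← mul_smul] at hadj'
      have := K.inv_mem (hT (mem_swaps.2 hadj'))
      simpa using this
    · rw [← h.smul_c, inv_smul_smul, ← mul_smul] at hadj2
      exact hQ (h.symm.mem_stab.2 hadj2)
    · rw [← h.smul_c, inv_smul_smul, h.cc, ← mul_smul] at hadj2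
      exact hP (h.mem_stab.2 hadj2)
    · rw [← h.smul_c, inv_smul_smul, h.cc, ← mul_smul] at hadj2
      exact hT (mem_swaps.2 hadj2)
  have hlt : ∀ X Y, X < Y → ∀ a b, e X a → e Y b → a⁻¹ * b ∈ K := by
    intro X Y hXY
    refine h.lt_induction (r := fun X Y => ∀ a b, e X a → e Y b → a⁻¹ * b ∈ K) hcov ?_ hXY
    intro X Y Z h1 h2 a b ha hb
    obtain ⟨d, hd⟩ := h.orbit Y
    simpa [mul_assoc] using K.mul_mem (h1 a d ha hd) (h2 d b hd hb)
  have hle : ∀ X Y, X ≤ Y → ∀ a b, e X a → e Y b → a⁻¹ * b ∈ K := by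
    intro X Y hXY a b ha hb
    rcases hXY.eq_or_lt with rfl | hXY
    · rcases ha with rfl | rfl <;> rcases hb with hb | hb
      · have := h.free (a⁻¹ * b) (by rw [mul_smul, ← hb, inv_smul_smul])
        rw [this]; exact K.one_mem
      · exact absurd (show (b⁻¹ * a) • U = c U by rw [mul_smul, hb, inv_smul_smul]) (h.noinv _)
      · exact absurd (show (a⁻¹ * b) • U = c U by rw [mul_smul, ← hb, inv_smul_smul]) (h.noinv _)
      · have := h.symm.free (a⁻¹ * b) (by rw [mul_smul, ← hb, inv_smul_smul])
        rw [this]; exact K.one_mem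
    · exact hlt _ _ hXY a b ha hb
  rw [eq_top_iff]
  intro g _
  have e1 : e U 1 := Or.inl (by simp)
  have e2 : e (c U) 1 := Or.inr (by simp)
  have e3 : e (g • U) g := Or.inl rfl
  have e4 : e (c (g • U)) g := Or.inr (by rw [h.smul_c])
  rcases h.nested U (g • U) with hn | hn | hn | hn
  · simpa using hle _ _ hn _ _ e1 e3
  · simpa using K.inv_mem (hle _ _ hn _ _ e3 e1)
  · simpa using hle _ _ hn _ _ e1 e4
  · simpa using hle _ _ hn _ _ e2 e3

/-- A periodic symmetry without invariant pairs of half-spaces fixes a vertex. -/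
lemma exists_adj_of_iterate (h : IsPocset (G := G) c U) {σ : H ≃o H}
    (hσ : ∀ X, σ (c X) = c (σ X)) (hfix : ∀ X, σ X ≠ X) (hinv : ∀ X, σ X ≠ c X) {k : ℕ}
    (hk : k ≠ 0) (hit : ∀ X, σ^[k] X = X) : ∃ X : H, Adj c (σ X) X := by
  obtain ⟨m, rfl⟩ := Nat.exists_eq_succ_of_ne_zero hk
  have nlt : ∀ X : H, ¬ X < σ X := by
    intro X hX
    have key : ∀ m : ℕ, X < σ^[m + 1] X := by
      intro m
      induction m with
      | zero => simpa using hX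
      | succ m ih =>
        rw [Function.iterate_succ_apply']
        exact hX.trans (σ.lt_iff_lt.2 ih)
    exact (hit X ▸ key m).false
  have ngt : ∀ X : H, ¬ σ X < X := by
    intro X hX
    have key : ∀ m : ℕ, σ^[m + 1] X < X := by
      intro m
      induction m with
      | zero => simpa using hX
      | succ m ih =>
        rw [Function.iterate_succ_apply']
        exact (σ.lt_iff_lt.2 ih).trans hX
    exact (hit X ▸ key m).false
  have dich : ∀ X : H, c X < σ X ∨ X < c (σ X) := by
    intro X
    rcases h.nested X (σ X) with hn | hn | hn | hn
    · exact absurd (hn.lt_of_ne' (hfix X)) (nlt X)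
    · exact absurd (hn.lt_of_ne (hfix X)) (ngt X)
    · rcases hn.eq_or_lt with hn | hn
      · exact absurd (by rw [← h.cc (σ X), ← hn]) (hinv X)
      · exact Or.inr hn
    · exact Or.inl (hn.lt_of_ne' (hinv X))
  have main : ∀ n : ℕ, ∀ X : H, c X < σ X → (Set.Icc (c X) (σ X)).ncard = n →
      ∃ X : H, Adj c (σ X) X := by
    intro n
    induction n using Nat.strong_induction_on with
    | _ n ih =>
      intro X hX hn
      by_cases hcov : c X ⋖ σ X
      · exact ⟨X, h.adj_symm (Or.inr hcov)⟩
      · obtain ⟨W, hW1, hW2⟩ : ∃ W, c X < W ∧ W < σ X := by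
          by_contra hno
          push Not at hno
          exact hcov ⟨hX, fun W h1 h2 => hno W h1 h2⟩
        rcases dich W with hd | hd
        · refine ih _ ?_ (σ.symm W) ?_ rfl
          · rw [← hn, σ.apply_symm_apply]
            refine Set.ncard_lt_ncard ⟨Set.Icc_subset_Icc ?_ hW2.le, fun hsub => ?_⟩ (h.fin _ _)
            · rw [h.c_le_c, ← σ.le_iff_le, σ.apply_symm_apply]; exact hW2.le
            · exact (hsub ⟨hX.le, le_rfl⟩).2.not_gt hW2
          · rw [σ.apply_symm_apply, ← σ.lt_iff_lt, hσ, σ.apply_symm_apply]; exact hd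
        · refine ih _ ?_ (c W) ?_ rfl
          · rw [← hn, h.cc]
            refine Set.ncard_lt_ncard ⟨Set.Icc_subset_Icc hW1.le ?_, fun hsub => ?_⟩ (h.fin _ _)
            · rw [hσ, ← h.c_le_c, h.cc, ← hσ, σ.le_iff_le]; exact hW1.le
            · exact (hsub ⟨le_rfl, hX.le⟩).1.not_gt hW1
          · rw [h.cc, hσ]; exact hd
  rcases dich U with hd | hd
  · exact main _ U hd rfl
  · exact main _ (c U) (by rwa [h.cc, hσ]) rfl

/-- An element of finite order fixes a vertex. -/
lemma exists_adj_of_pow_eq_one (h : IsPocset (G := G) c U) {a : G} (ha : a ≠ 1) {k : ℕ}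
    (hk : k ≠ 0) (hak : a ^ k = 1) : ∃ X : H, Adj c (a • X) X := by
  refine h.exists_adj_of_iterate (σ := ⟨MulAction.toPerm a, h.smul_le_iff a⟩) (h.smul_c a)
    (fun X hX => ha (h.free' hX)) (fun X => h.noinv' a) hk (fun X => ?_)
  change (a • ·)^[k] X = X
  rw [smul_iterate, hak]
  exact one_smul G X

/-- Elements of finite order are conjugate into a vertex stabilizer. -/
lemma exists_conj_mem_stab (h : IsPocset (G := G) c U) {a : G} {k : ℕ}
    (hk : k ≠ 0) (hak : a ^ k = 1) : ∃ g : G, g * a * g⁻¹ ∈ h.stab ∨ g * a * g⁻¹ ∈ h.symm.stab := by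
  by_cases ha : a = 1
  · exact ⟨1, Or.inl (by simp [ha])⟩
  obtain ⟨X, hX⟩ := h.exists_adj_of_pow_eq_one ha hk hak
  obtain ⟨g, rfl | rfl⟩ := h.orbit X
  · refine ⟨g⁻¹, Or.inl ?_⟩
    have := h.adj_smul g⁻¹ hX
    rw [inv_smul_smul] at this
    simpa [h.mem_stab, mul_smul] using this
  · refine ⟨g⁻¹, Or.inr ?_⟩
    have := h.adj_smul g⁻¹ hX
    rw [inv_smul_smul] at this
    simpa [h.symm.mem_stab, mul_smul] using this

end IsPocset

/-- Ping-pong data for two subgroups generating a group. -/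
structure PingPong {G : Type*} [Group G] (P Q : Subgroup G) (XP XQ : Set G) : Prop where
  gen : P ⊔ Q = ⊤
  disj : Disjoint XP XQ
  one_P : 1 ∉ XP
  one_Q : 1 ∉ XQ
  mem_P : ∀ g ∈ P, g ≠ 1 → g ∈ XP
  mem_Q : ∀ g ∈ Q, g ≠ 1 → g ∈ XQ
  mul_P : ∀ g ∈ P, g ≠ 1 → ∀ x ∈ XQ, g * x ∈ XP
  mul_Q : ∀ g ∈ Q, g ≠ 1 → ∀ x ∈ XP, g * x ∈ XQ

lemma PingPong.symm {G : Type*} [Group G] {P Q : Subgroup G} {XP XQ : Set G}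
    (h : PingPong P Q XP XQ) : PingPong Q P XQ XP :=
  ⟨by rw [sup_comm, h.gen], h.disj.symm, h.one_Q, h.one_P, h.mem_Q, h.mem_P, h.mul_Q, h.mul_P⟩

namespace IsPocset

variable {G H : Type*} [Group G] [PartialOrder H] [MulAction G H] {c : H → H} {U : H}

/-- The translates of the base edge lying strictly inside a half-space. -/
def inside (G : Type*) [Group G] [MulAction G H] (c : H → H) (U X : H) : Set G :=
  {g : G | g • U < X ∨ g • c U < X}

lemma inside_mono {X Y : H} (hXY : X ≤ Y) : inside G c U X ⊆ inside G c U Y := by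
  rintro g (hg | hg)
  exacts [Or.inl (hg.trans_le hXY), Or.inr (hg.trans_le hXY)]

lemma mul_mem_inside (h : IsPocset (G := G) c U) {g x : G} {X : H} (hx : x ∈ inside G c U X) :
    g * x ∈ inside G c U (g • X) := by
  rcases hx with hx | hx
  · left; rw [mul_smul, h.smul_lt_iff]; exact hx
  · right; rw [mul_smul, h.smul_lt_iff]; exact hx

lemma inside_disj (h : IsPocset (G := G) c U) {X : H} {g : G} (h1 : g ∈ inside G c U X)
    (h2 : g ∈ inside G c U (c X)) : False := by
  rcases h1 with h1 | h1 <;> rcases h2 with h2 | h2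
  · exact h.proper' h1 h2
  · rw [h.smul_c, h.c_lt_c] at h2; exact lt_asymm h1 h2
  · rw [h.smul_c] at h1; rw [h.lt_c_comm] at h2; exact lt_asymm h1 h2
  · exact h.proper' h1 h2

lemma one_notMem_inside (h : IsPocset (G := G) c U) : (1 : G) ∉ inside G c U U := by
  rintro (h1 | h1)
  · rw [one_smul] at h1; exact h1.false
  · rw [one_smul] at h1; exact h.proper (c U) U h1.le le_rfl

lemma c_smul_lt (h : IsPocset (G := G) c U) {g : G} (hg : g ∈ h.stab) (hne : g ≠ 1) :
    g • c U < U := by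
  rw [h.smul_c]
  exact lt_of_adj hg fun h' => hne (h.free g h')

theorem pingPong_amalgam (h : IsPocset (G := G) c U) (hT : swaps G c U = ∅) :
    PingPong h.stab h.symm.stab (inside G c U U) (inside G c U (c U)) where
  gen := h.closure_eq_top le_sup_left le_sup_right (by simp [hT])
  disj := Set.disjoint_left.2 fun _ => h.inside_disj
  one_P := h.one_notMem_inside
  one_Q := by
    have := h.symm.one_notMem_inside
    simpa only [inside, h.cc, or_comm] using this
  mem_P g hg hne := Or.inr (h.c_smul_lt hg hne)
  mem_Q g hg hne := Or.inl (by simpa [h.cc] using h.symm.c_smul_lt hg hne)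
  mul_P g hg hne x hx := inside_mono (h.c_smul_lt hg hne).le (h.mul_mem_inside hx)
  mul_Q g hg hne x hx := inside_mono (by simpa [h.cc] using (h.symm.c_smul_lt hg hne).le)
    (h.mul_mem_inside hx)

theorem pingPong_hnn (h : IsPocset (G := G) c U) {t : G} (ht : t ∈ swaps G c U) :
    ∃ XP XQ, PingPong h.stab (Subgroup.zpowers t) XP XQ := by
  let XQ : Set G := inside G c U (c U) ∪ inside G c U (t • U) ∪ {t}
  let XP : Set G := {x | ∃ p ∈ h.stab, p ≠ 1 ∧ (x = p ∨ p⁻¹ * x ∈ XQ)}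
  have tU : t • U < U := by
    have := lt_of_adj (mem_swaps.1 ht) (fun h' => h.noinv t⁻¹ (by
      rw [inv_smul_eq_iff, h']))
    rwa [h.smul_c, h.cc] at this
  -- the two half-spaces at the vertex contain `XP`
  have subXP : ∀ x ∈ XP, x ∈ inside G c U U ∧ x ∈ inside G c U (t • c U) := by
    rintro x ⟨p, hp, hne, hx⟩
    have p1 : p • c U < U := h.c_smul_lt hp hne
    have p2 : p • c U < t • c U := by
      rw [h.smul_c p]
      refine lt_of_adj (h.adj_trans hp (h.adj_symm (mem_swaps.1 ht))) fun h' => ?_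
      exact h.noinv (t⁻¹ * p) (by rw [mul_smul, h', inv_smul_smul])
    have p3 : p • t • U < U := by
      have := lt_of_adj (mem_swaps.1 (h.mul_mem_swaps hp ht)) fun h' => by
        refine h.noinv (p * t)⁻¹ ?_
        rw [inv_smul_eq_iff, h']
      rwa [h.smul_c, h.cc, mul_smul] at this
    have p4 : p • t • U < t • c U := by
      have hadj : Adj c (p • t • c U) (t • c U) :=
        h.adj_trans (h.adj_smul p ht) (h.adj_trans hp (h.adj_symm ht))
      have := lt_of_adj hadj fun h' => hne (h.free' h')
      rwa [← h.smul_c, ← h.smul_c, h.cc] at this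
    rcases hx with rfl | (hx | hx) | hx
    · exact ⟨Or.inr p1, Or.inr p2⟩
    · have := h.mul_mem_inside (g := p) hx
      rw [mul_inv_cancel_left] at this
      exact ⟨inside_mono p1.le this, inside_mono p2.le this⟩
    · have := h.mul_mem_inside (g := p) hx
      rw [mul_inv_cancel_left] at this
      exact ⟨inside_mono p3.le this, inside_mono p4.le this⟩
    · rw [Set.mem_singleton_iff, inv_mul_eq_iff_eq_mul] at hx
      subst hx
      exact ⟨Or.inl (by rwa [mul_smul]), Or.inl (by rwa [mul_smul])⟩
  have powU : ∀ k : ℕ, t ^ (k + 1) • U ≤ t • U := by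
    intro k
    induction k with
    | zero => simp
    | succ k ih =>
      rw [pow_succ', mul_smul]
      rw [h.smul_le_iff]
      exact ih.trans tU.le
  have powV : ∀ k : ℕ, (t⁻¹) ^ k • c U ≤ c U := by
    intro k
    induction k with
    | zero => simp
    | succ k ih =>
      rw [pow_succ', mul_smul]
      refine ((h.smul_le_iff _).2 ih).trans ?_
      rw [h.smul_c, h.c_le_c, ← h.smul_le_iff t, smul_inv_smul]
      exact tU.le
  have tne : t ≠ 1 := by
    rintro rfl
    rw [one_smul] at tU
    exact tU.false
  have tc : U < t⁻¹ • U := by rw [← h.smul_lt_iff t, smul_inv_smul]; exact tU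
  refine ⟨XP, XQ, ?_, ?_, ?_, ?_, ?_, ?_, ?_, ?_⟩
  · refine h.closure_eq_top le_sup_left ?_ ?_
    · intro g hg
      have ht' : t ∈ h.stab ⊔ Subgroup.zpowers t :=
        Subgroup.mem_sup_right (Subgroup.mem_zpowers t)
      have := Subgroup.mem_sup_left (T := Subgroup.zpowers t) ((h.conj_mem_stab ht).2 hg)
      simpa [mul_assoc] using Subgroup.mul_mem _ (Subgroup.mul_mem _ (Subgroup.inv_mem _ ht') this)
        ht'
    · intro s hs
      have := Subgroup.mem_sup_left (T := Subgroup.zpowers t) (h.mem_stab_of_mem_swaps hs ht)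
      simpa using Subgroup.mul_mem _ this (Subgroup.mem_sup_right (Subgroup.mem_zpowers t))
  · rw [Set.disjoint_left]
    intro x hx hx'
    obtain ⟨h1, h2⟩ := subXP x hx
    rcases hx' with (hx' | hx') | rfl
    · exact h.inside_disj h1 hx'
    · rw [h.smul_c] at h2
      exact h.inside_disj hx' h2
    · rcases h2 with h2 | h2
      · rw [h.smul_lt_iff] at h2
        exact h.proper U U le_rfl h2.le
      · exact h2.false
  · intro h1
    exact h.one_notMem_inside (subXP _ h1).1
  · rintro ((h1 | h1) | h1)
    · have := h.symm.one_notMem_inside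
      rw [inside, h.cc] at this
      exact this (Or.symm h1)
    · exact h.one_notMem_inside (inside_mono tU.le h1)
    · exact tne (Set.mem_singleton_iff.1 h1).symm
  · intro g hg hne
    exact ⟨g, hg, hne, Or.inl rfl⟩
  · rintro g ⟨k, rfl⟩ hne
    rcases k with (_ | _ | k) | k
    · simp at hne
    · right; simp
    · left; right; left
      have : t ^ (k + 1 + 1) • U < t • U := by
        rw [pow_succ', mul_smul, h.smul_lt_iff]
        exact (powU k).trans_lt tU
      simpa only [Int.ofNat_eq_natCast, zpow_natCast] using this
    · left; left; right
      simp only [zpow_negSucc, ← inv_pow]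
      rw [pow_succ, mul_smul]
      have : t⁻¹ • c U < c U := by rw [h.smul_c, h.c_lt_c]; exact tc
      exact ((h.smul_lt_iff _).2 this).trans_le (powV k)
  · intro g hg hne x hx
    exact ⟨g, hg, hne, Or.inr (by simpa using hx)⟩
  · rintro g ⟨k, rfl⟩ hne x hx
    obtain ⟨h1, h2⟩ := subXP x hx
    rcases k with (_ | k) | k
    · simp at hne
    · left; right
      have := inside_mono (powU k) (h.mul_mem_inside (g := t ^ (k + 1)) h1)
      simpa only [Int.ofNat_eq_natCast, zpow_natCast] using this
    · left; left
      simp only [zpow_negSucc, ← inv_pow]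
      have := h.mul_mem_inside (g := (t⁻¹) ^ (k + 1)) h2
      rw [pow_succ, mul_smul, inv_smul_smul] at this
      rw [pow_succ]
      exact inside_mono (powV k) this

end IsPocset
end Pocset

end

section

open scoped Pointwise

section HalfSpaces

/-- The translates of a subset and of its complement. -/
def HalfSpace (G : Type*) {Ω : Type*} [Group G] [MulAction G Ω] (U : Set Ω) : Type _ :=
  {X : Set Ω // ∃ g : G, X = g • U ∨ X = g • Uᶜ}

variable {G Ω : Type*} [Group G] [MulAction G Ω] {U : Set Ω}

instance : PartialOrder (HalfSpace G U) := inferInstanceAs (PartialOrder (Subtype _))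

instance : MulAction G (HalfSpace G U) where
  smul g X := ⟨g • X.1, by
    obtain ⟨a, ha | ha⟩ := X.2
    · exact ⟨g * a, Or.inl (by rw [ha, mul_smul])⟩
    · exact ⟨g * a, Or.inr (by rw [ha, mul_smul])⟩⟩
  one_smul X := Subtype.ext (one_smul G X.1)
  mul_smul a b X := Subtype.ext (mul_smul a b X.1)

/-- Complementation of half-spaces. -/
def HalfSpace.compl (X : HalfSpace G U) : HalfSpace G U := ⟨X.1ᶜ, by
  obtain ⟨a, ha | ha⟩ := X.2
  · exact ⟨a, Or.inr (by rw [ha, Set.smul_set_compl])⟩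
  · exact ⟨a, Or.inl (by rw [ha, Set.smul_set_compl, compl_compl])⟩⟩

/-- The base half-space. -/
def HalfSpace.base (G : Type*) {Ω : Type*} [Group G] [MulAction G Ω] (U : Set Ω) :
    HalfSpace G U := ⟨U, 1, Or.inl (by simp)⟩

theorem isPocset_halfSpace (ne : U.Nonempty) (ne' : Uᶜ.Nonempty)
    (nested : ∀ g : G, ¬ Crosses U (g • U)) (free : ∀ g : G, g • U = U → g = 1)
    (noinv : ∀ g : G, g • U ≠ Uᶜ) (fin : ∀ x y : Ω, {g : G | x ∈ g • U ∧ y ∉ g • U}.Finite) :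
    IsPocset (G := G) HalfSpace.compl (HalfSpace.base G U) where
  cc X := Subtype.ext (compl_compl X.1)
  c_le X Y h := Set.compl_subset_compl.2 h
  smul_c g X := Subtype.ext Set.smul_set_compl
  smul_le g X Y h := Set.smul_set_mono h
  nested := by
    have key : ∀ a b : G, ¬ Crosses (a • U) (b • U) := by
      intro a b h
      apply nested (a⁻¹ * b)
      obtain ⟨h1, h2, h3, h4⟩ := h
      have e : ∀ X Y : Set Ω, (a • X ∩ b • Y).Nonempty → (X ∩ (a⁻¹ * b) • Y).Nonempty := by
        rintro X Y ⟨z, hz1, hz2⟩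
        refine ⟨a⁻¹ • z, ?_, ?_⟩
        · rwa [← Set.mem_smul_set_iff_inv_smul_mem]
        · rw [mul_smul]; exact Set.smul_mem_smul_set hz2
      refine ⟨e _ _ h1, ?_, ?_, ?_⟩
      · rw [← Set.smul_set_compl]; exact e _ _ (by rwa [Set.smul_set_compl])
      · exact e _ _ (by rwa [Set.smul_set_compl])
      · rw [← Set.smul_set_compl]; exact e _ _ (by rwa [Set.smul_set_compl, Set.smul_set_compl])
    intro X Y
    suffices ¬ Crosses X.1 Y.1 by
      rcases not_crosses_iff.1 this with h | h | h | h
      exacts [Or.inr (Or.inr (Or.inl h)), Or.inl h, Or.inr (Or.inl h), Or.inr (Or.inr (Or.inr h))]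
    obtain ⟨X, a, rfl | rfl⟩ := X <;> obtain ⟨Y, b, rfl | rfl⟩ := Y <;>
      simp only [Set.smul_set_compl] <;> intro h
    · exact key a b h
    · exact key a b (by simpa using h.compl_right)
    · exact key a b (crosses_compl_left.1 h)
    · exact key a b (by simpa using (crosses_compl_left.1 h).compl_right)
  proper X Y h1 h2 := by
    have hX : X.1.Nonempty := by
      obtain ⟨X, a, rfl | rfl⟩ := X
      exacts [ne.smul_set, ne'.smul_set]
    obtain ⟨x, hx⟩ := hX
    exact h2 hx (h1 hx)
  fin X Y := by
    have hX : X.1.Nonempty := by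
      obtain ⟨X, a, rfl | rfl⟩ := X
      exacts [ne.smul_set, ne'.smul_set]
    have hY : Y.1ᶜ.Nonempty := by
      obtain ⟨X, a, rfl | rfl⟩ := Y
      · rw [← Set.smul_set_compl]; exact ne'.smul_set
      · rw [← Set.smul_set_compl, compl_compl]; exact ne.smul_set
    obtain ⟨x, hx⟩ := hX
    obtain ⟨y, hy⟩ := hY
    refine (((fin x y).image fun g => g • HalfSpace.base G U).union ((fin y x).image fun g =>
      g • (HalfSpace.base G U).compl)).subset ?_
    rintro ⟨Z, a, rfl | rfl⟩ ⟨h1, h2⟩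
    · exact Or.inl ⟨a, ⟨h1 hx, fun h => hy (h2 h)⟩, rfl⟩
    · refine Or.inr ⟨a, ⟨?_, ?_⟩, rfl⟩
      · by_contra h
        rw [← Set.mem_compl_iff, ← Set.smul_set_compl] at h
        exact hy (h2 h)
      · have := h1 hx
        simp only [Set.smul_set_compl] at this
        exact this
  free g h := free g (congrArg Subtype.val h)
  noinv g h := noinv g (congrArg Subtype.val h)
  orbit := by
    rintro ⟨X, a, rfl | rfl⟩
    exacts [⟨a, Or.inl rfl⟩, ⟨a, Or.inr rfl⟩]

end HalfSpaces

section AlmostInvariant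

variable {E : Type*} [Group E]

/-- A subset which is almost invariant under right translations. -/
def AlmostInv (U : Set E) : Prop := ∀ s, {x ∈ U | x * s ∉ U}.Finite

lemma almostInv_of_closure {S : Set E} (hS : ∀ s ∈ S, s⁻¹ ∈ S) (hgen : Subgroup.closure S = ⊤)
    {U : Set E} (h : ∀ s ∈ S, {x ∈ U | x * s ∉ U}.Finite) : AlmostInv U := by
  intro s
  have hs : s ∈ Subgroup.closure S := by rw [hgen]; trivial
  induction hs using Subgroup.closure_induction'' with
  | mem s hs => exact h s hs
  | inv_mem s hs => exact h _ (hS s hs)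
  | one => convert Set.finite_empty; ext B; simp
  | mul a b _ _ ha hb =>
    have hb' : ((fun x => x * a) ⁻¹' {x ∈ U | x * b ∉ U}).Finite :=
      hb.preimage (mul_left_injective a).injOn
    refine (ha.union hb').subset ?_
    rintro x ⟨h1, h2⟩
    by_cases h3 : x * a ∈ U
    · exact Or.inr ⟨h3, by rwa [mul_assoc]⟩
    · exact Or.inl ⟨h1, h3⟩

lemma exists_almostInv_freeGroup {ι : Type*} [Nonempty ι] :
    ∃ W : Set (FreeGroup ι), W.Infinite ∧ Wᶜ.Infinite ∧ AlmostInv W := by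
  classical
  obtain ⟨i⟩ := ‹Nonempty ι›
  let W : Set (FreeGroup ι) := {w | (w⁻¹).toWord.getLast? = some (i, false)}
  have hpow : Function.Injective fun k : ℕ => (FreeGroup.of i) ^ k := by
    intro a b hab
    have := congrArg (FreeGroup.lift fun _ : ι => Multiplicative.ofAdd (1 : ℤ)) hab
    simpa [← ofAdd_nsmul] using this
  refine ⟨W, ?_, ?_, ?_⟩
  · refine Set.infinite_of_injective_forall_mem (f := fun k : ℕ => (FreeGroup.of i) ^ (k + 1))
      (fun a b hab => by simpa using hpow hab) fun k => ?_
    change (((FreeGroup.of i) ^ (k + 1))⁻¹).toWord.getLast? = some (i, false)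
    rw [FreeGroup.toWord_inv, FreeGroup.toWord_of_pow]
    simp [FreeGroup.invRev, List.replicate_succ]
  · refine Set.infinite_of_injective_forall_mem (f := fun k : ℕ => ((FreeGroup.of i) ^ k)⁻¹)
      (fun a b hab => hpow (_root_.inv_injective hab)) fun k => ?_
    change ¬ ((((FreeGroup.of i) ^ k)⁻¹)⁻¹).toWord.getLast? = some (i, false)
    rw [inv_inv, FreeGroup.toWord_of_pow]
    cases k <;> simp [List.replicate_succ', List.getLast?_append]
  · let S : Set (FreeGroup ι) := {s | ∃ x : ι × Bool, s = FreeGroup.mk [x]}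
    refine almostInv_of_closure (S := S) ?_ ?_ ?_
    · rintro s ⟨⟨j, b⟩, rfl⟩
      exact ⟨(j, !b), by simp [FreeGroup.inv_mk, FreeGroup.invRev]⟩
    · rw [eq_top_iff, ← FreeGroup.closure_range_of]
      refine Subgroup.closure_mono ?_
      rintro _ ⟨j, rfl⟩
      exact ⟨(j, true), rfl⟩
    · rintro s ⟨⟨j, b⟩, rfl⟩
      refine (Set.finite_singleton ((FreeGroup.mk [(i, false)])⁻¹ : FreeGroup ι)).subset ?_
      rintro w ⟨h1, h2⟩
      change (w⁻¹).toWord.getLast? = some (i, false) at h1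
      change ¬ ((w * FreeGroup.mk [(j, b)])⁻¹).toWord.getLast? = some (i, false) at h2
      rw [Set.mem_singleton_iff, ← _root_.inv_inj, inv_inv]
      generalize hv : w⁻¹ = v at h1
      rw [_root_.mul_inv_rev, hv, FreeGroup.inv_mk] at h2
      have hred : FreeGroup.mk (FreeGroup.invRev [(j, b)]) * v =
          FreeGroup.mk ((j, !b) :: v.toWord) := by
        conv_lhs => rw [← FreeGroup.mk_toWord (x := v), FreeGroup.mul_mk]
        simp [FreeGroup.invRev]
      rw [hred, FreeGroup.toWord_mk, FreeGroup.reduce.cons, FreeGroup.reduce_toWord] at h2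
      rcases hL : v.toWord with _ | ⟨a, L⟩
      · simp [hL] at h1
      · rw [hL] at h1 h2
        dsimp only at h2
        split_ifs at h2 with hc
        · rcases L with _ | ⟨a', L⟩
          · rw [← FreeGroup.mk_toWord (x := v), hL]
            rw [show a = (i, false) by simpa using h1]
          · rw [List.getLast?_cons_cons] at h1
            exact absurd h1 h2
        · rw [List.getLast?_cons_cons] at h2
          exact absurd h1 h2

lemma exists_nested_of_almostInv {S : Set E} (hSf : S.Finite) (hS : ∀ s ∈ S, s⁻¹ ∈ S)
    (hgen : Subgroup.closure S = ⊤) {U₀ : Set E} (hi : U₀.Infinite) (hi' : U₀ᶜ.Infinite)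
    (h₀ : AlmostInv U₀) :
    ∃ U : Set E, U.Infinite ∧ Uᶜ.Infinite ∧ AlmostInv U ∧ ∀ g : E, ¬ Crosses U (g • U) := by
  have hcut : IsCut S U₀ := by
    refine ⟨?_, hi, hi'⟩
    refine (hSf.biUnion fun s _ => (h₀ s).image fun x => (x, s)).subset ?_
    rintro ⟨x, s⟩ ⟨hs, hx, hxs⟩
    exact Set.mem_biUnion hs ⟨x, ⟨hx, hxs⟩, rfl⟩
  obtain ⟨U, hU, hn⟩ := exists_nested_minCut hS hSf hgen hcut
  refine ⟨U, hU.inf, hU.inf_compl, almostInv_of_closure hS hgen fun s hs => ?_, hn⟩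
  refine (hU.fin.image Prod.fst).subset ?_
  rintro x ⟨hx, hxs⟩
  exact ⟨(x, s), ⟨hs, hx, hxs⟩, rfl⟩

variable {p : ℕ} [NeZero p] {θ : E →* Multiplicative (ZMod p)}

theorem exists_nested_of_freeGroupBasis {ι : Type*} [Finite ι] [Nonempty ι]
    (hθ : Function.Surjective θ) (b : FreeGroupBasis ι θ.ker) :
    ∃ U : Set E, U.Infinite ∧ Uᶜ.Infinite ∧ AlmostInv U ∧ ∀ g : E, ¬ Crosses U (g • U) := by
  obtain ⟨α, hα⟩ := hθ (Multiplicative.ofAdd 1)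
  have hαk : ∀ k : ℕ, θ (α ^ k) = Multiplicative.ofAdd (k : ZMod p) := by
    intro k
    rw [map_pow, hα, ← ofAdd_nsmul]
    simp
  let i : E → ℕ := fun x => (θ x).toAdd.val
  have hmem : ∀ x, x * (α ^ i x)⁻¹ ∈ θ.ker := by
    intro x
    rw [MonoidHom.mem_ker, _root_.map_mul, _root_.map_inv, hαk]
    simp [i]
  let r : E → θ.ker := fun x => ⟨x * (α ^ i x)⁻¹, hmem x⟩
  have hr : ∀ x, (r x : E) * α ^ i x = x := fun x => by simp [r]
  have hrN : ∀ y : θ.ker, r y = y := by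
    intro y
    have : i y = 0 := by simp [i, MonoidHom.mem_ker.1 y.2]
    apply Subtype.ext
    simp [r, this]
  obtain ⟨W', hW1', hW2', hW3'⟩ := exists_almostInv_freeGroup (ι := ι)
  obtain ⟨W, hW1, hW2, hW3⟩ : ∃ W : Set θ.ker, W.Infinite ∧ Wᶜ.Infinite ∧ AlmostInv W := by
    refine ⟨b.repr ⁻¹' W', ?_, ?_, ?_⟩
    · exact hW1'.preimage (fun x _ => b.repr.surjective x)
    · exact hW2'.preimage (fun x _ => b.repr.surjective x)
    · intro s
      refine ((hW3' (b.repr s)).preimage b.repr.injective.injOn).subset ?_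
      rintro x ⟨h1, h2⟩
      exact ⟨h1, by simpa using h2⟩
  -- a finite symmetric generating set
  let S₀ : Set E := insert α (Set.range fun j => (b j : E))
  have hS₀ : S₀.Finite := (Set.finite_range _).insert _
  have hgen₀ : Subgroup.closure S₀ = ⊤ := by
    have hker : θ.ker ≤ Subgroup.closure S₀ := by
      have h1 : Subgroup.closure (Set.range b) = ⊤ := by
        have := FreeGroup.closure_range_of (α := ι)
        have h2 := congrArg (Subgroup.map b.repr.symm.toMonoidHom) this
        rw [MonoidHom.map_closure, ← Set.range_comp] at h2
        rw [Subgroup.map_top_of_surjective _ b.repr.symm.surjective] at h2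
        exact h2
      have h2 := congrArg (Subgroup.map θ.ker.subtype) h1
      rw [MonoidHom.map_closure, ← Set.range_comp, ← MonoidHom.range_eq_map,
        Subgroup.range_subtype] at h2
      rw [← h2]
      exact Subgroup.closure_mono (Set.subset_insert _ _)
    rw [eq_top_iff]
    intro x _
    rw [← hr x]
    exact Subgroup.mul_mem _ (hker (r x).2)
      (Subgroup.pow_mem _ (Subgroup.subset_closure (Set.mem_insert _ _)) _)
  refine exists_nested_of_almostInv (S := S₀ ∪ S₀⁻¹) (U₀ := r ⁻¹' W) (hS₀.union hS₀.inv) ?_ ?_ ?_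
    ?_ ?_
  · rintro s (hs | hs)
    · exact Or.inr (by simpa using hs)
    · exact Or.inl (by simpa using hs)
  · rw [eq_top_iff, ← hgen₀]
    exact Subgroup.closure_mono Set.subset_union_left
  · exact hW1.preimage (fun x _ => ⟨x, hrN x⟩)
  · exact hW2.preimage (fun x _ => ⟨x, hrN x⟩)
  · intro s
    have hfin : (⋃ k ∈ Set.Iio p, ⋃ l ∈ Set.Iio p,
        {x : E | ∃ y : θ.ker, (y : E) = α ^ k * s * (α ^ l)⁻¹ ∧ i x = k ∧ r x ∈ W ∧
          r x * y ∉ W}).Finite := by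
      refine (Set.finite_Iio p).biUnion fun k _ => (Set.finite_Iio p).biUnion fun l _ => ?_
      by_cases hy : α ^ k * s * (α ^ l)⁻¹ ∈ θ.ker
      · refine ((hW3 ⟨_, hy⟩).image fun w : θ.ker => (w : E) * α ^ k).subset ?_
        rintro x ⟨y, hy1, hik, hx1, hx2⟩
        refine ⟨r x, ⟨hx1, ?_⟩, by rw [← hik]; exact hr x⟩
        rwa [show y = ⟨_, hy⟩ from Subtype.ext hy1] at hx2
      · convert Set.finite_empty
        ext x
        simp only [Set.mem_ofPred_eq, Set.mem_empty_iff_false, iff_false]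
        rintro ⟨y, hy1, -⟩
        exact hy (hy1 ▸ y.2)
    refine hfin.subset ?_
    rintro x ⟨hx1, hx2⟩
    simp only [Set.mem_iUnion]
    refine ⟨i x, ZMod.val_lt _, i (x * s), ZMod.val_lt _, (r x)⁻¹ * r (x * s), ?_, rfl, hx1, ?_⟩
    · simp [r, mul_assoc]
    · simpa using hx2

end AlmostInvariant

end

section

open scoped Pointwise

section Dichotomy

variable {E : Type*} [Group E] {U : Set E}

lemma IsPocset.stab_ne_top {G Ω : Type*} [Group G] [MulAction G Ω] {U : Set Ω}
    (h : IsPocset (G := G) HalfSpace.compl (HalfSpace.base G U)) {g : G} (hg : g ≠ 1) {x : Ω}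
    (hx : x ∉ U) (hgx : g • x ∉ U) : h.stab ≠ ⊤ := by
  intro htop
  have := (h.c_smul_lt (g := g) (by rw [htop]; trivial) hg).le
  exact hgx (this (Set.smul_mem_smul_set (a := g) (s := Uᶜ) hx))

lemma IsPocset.symm_stab_ne_top {G Ω : Type*} [Group G] [MulAction G Ω] {U : Set Ω}
    (h : IsPocset (G := G) HalfSpace.compl (HalfSpace.base G U)) {g : G} (hg : g ≠ 1) {x : Ω}
    (hx : x ∈ U) (hgx : g • x ∈ U) : h.symm.stab ≠ ⊤ := by
  intro htop
  have := (h.symm.c_smul_lt (g := g) (by rw [htop]; trivial) hg).le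
  rw [h.cc] at this
  exact this (Set.smul_mem_smul_set (a := g) (s := U) hx) hgx

/-- Two infinite complementary subsets never have trivial splittings. -/
lemma IsPocset.pingPong_nontrivial {G Ω : Type*} [Group G] [MulAction G Ω] {U : Set Ω}
    (h : IsPocset (G := G) HalfSpace.compl (HalfSpace.base G U))
    (h1 : ∃ g : G, g ≠ 1 ∧ ∃ x, x ∉ U ∧ g • x ∉ U) (h2 : ∃ g : G, g ≠ 1 ∧ ∃ x, x ∈ U ∧ g • x ∈ U)
    {XP XQ : Set G} (hpp : PingPong h.stab h.symm.stab XP XQ) :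
    h.stab ≠ ⊥ ∧ h.symm.stab ≠ ⊥ := by
  obtain ⟨g, hg, x, hx, hgx⟩ := h1
  obtain ⟨g', hg', x', hx', hgx'⟩ := h2
  constructor
  · intro hbot
    refine h.symm_stab_ne_top hg' hx' hgx' ?_
    simpa [hbot] using hpp.gen
  · intro hbot
    refine h.stab_ne_top hg hx hgx ?_
    simpa [hbot] using hpp.gen

lemma AlmostInv.finite_sep (hU : AlmostInv U) (x y : E) : {g : E | x ∈ g • U ∧ y ∉ g • U}.Finite :=
    by
  refine ((hU (x⁻¹ * y)).preimage (f := fun g : E => g⁻¹ * x) ?_).subset ?_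
  · intro a _ b _ hab
    simpa using hab
  · rintro g ⟨h1, h2⟩
    rw [Set.mem_smul_set_iff_inv_smul_mem] at h1 h2
    exact ⟨h1, by simpa [mul_assoc] using h2⟩

lemma AlmostInv.isOfFinOrder (hU : AlmostInv U) (ne : U.Nonempty) (ne' : Uᶜ.Nonempty) {g : E}
    (hg : g • U = U) : IsOfFinOrder g := by
  obtain ⟨x, hx⟩ := ne
  obtain ⟨y, hy⟩ := ne'
  by_contra hinf
  have hinj : Function.Injective fun k : ℕ => g ^ k := injective_pow_iff_not_isOfFinOrder.2 hinf
  refine Set.infinite_of_injective_forall_mem hinj (s := {g : E | x ∈ g • U ∧ y ∉ g • U}) ?_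
    (hU.finite_sep x y)
  intro k
  have : g ^ k • U = U := by
    induction k with
    | zero => simp
    | succ k ih => rw [pow_succ, mul_smul, hg, ih]
  exact ⟨by rw [this]; exact hx, by rw [this]; exact hy⟩

variable {p : ℕ} [hp : Fact p.Prime] {θ : E →* Multiplicative (ZMod p)}

lemma pow_mem_ker (g : E) : g ^ p ∈ θ.ker := by
  rw [MonoidHom.mem_ker, map_pow]
  have := pow_card_eq_one' (x := θ g)
  rwa [Nat.card_eq_fintype_card, Fintype.card_multiplicative, ZMod.card] at this

lemma exists_pow_map_eq {g : E} (hg : g ∉ θ.ker) (z : Multiplicative (ZMod p)) :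
    ∃ k : ℕ, θ (g ^ k) = z := by
  have hne : (θ g).toAdd ≠ 0 := fun h => hg (MonoidHom.mem_ker.2 (Multiplicative.toAdd.injective h))
  refine ⟨(z.toAdd * (θ g).toAdd⁻¹).val, ?_⟩
  rw [map_pow]
  apply Multiplicative.toAdd.injective
  rw [toAdd_pow, nsmul_eq_mul]
  simp [hne]

/-- Translation of half-spaces by an element normalizing the acting group and preserving the
base half-space. -/
def HalfSpace.translate {a : E} (ha : a • U = U) (X : HalfSpace θ.ker U) : HalfSpace θ.ker U :=
  ⟨a • X.1, by
    obtain ⟨g, hg⟩ := X.2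
    refine ⟨MulAut.conjNormal a g, ?_⟩
    have hb : ∀ V : Set E, a • V = V → a • g • V = (MulAut.conjNormal a g) • V := by
      intro V hV
      conv_rhs => rw [← hV]
      simp only [Subgroup.smul_def, MulAut.conjNormal_apply, ← mul_smul, inv_mul_cancel_right]
    rcases hg with hg | hg
    · exact Or.inl (by rw [hg]; exact hb U ha)
    · exact Or.inr (by rw [hg]; exact hb _ (by rw [Set.smul_set_compl, ha]))⟩

lemma HalfSpace.adj_translate {a : E} (ha : a • U = U) {X Y : HalfSpace θ.ker U}
    (h : Adj HalfSpace.compl X Y) :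
    Adj HalfSpace.compl (X.translate ha) (Y.translate ha) := by
  have ha' : a⁻¹ • U = U := by rw [inv_smul_eq_iff, ha]
  have hle : ∀ {b : E} (hb : b • U = U) {X Y : HalfSpace θ.ker U}, X ≤ Y →
      X.translate hb ≤ Y.translate hb := fun _ _ _ h => Set.smul_set_mono h
  have hinv : ∀ X : HalfSpace θ.ker U, (X.translate ha').translate ha = X := fun X =>
    Subtype.ext (smul_inv_smul a X.1)
  have hinv' : ∀ X : HalfSpace θ.ker U, (X.translate ha).translate ha' = X := fun X =>
    Subtype.ext (inv_smul_smul a X.1)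
  have hle' : ∀ {X Y : HalfSpace θ.ker U}, X.translate ha ≤ Y.translate ha ↔ X ≤ Y :=
    ⟨fun h => by simpa only [hinv'] using hle ha' h, hle ha⟩
  have hlt : ∀ {X Y : HalfSpace θ.ker U}, X.translate ha < Y.translate ha ↔ X < Y := by
    intro X Y
    rw [lt_iff_le_not_ge, lt_iff_le_not_ge, hle', hle']
  rcases h with rfl | h
  · exact Or.inl rfl
  · right
    have hc : (X.translate ha).compl = X.compl.translate ha := Subtype.ext Set.smul_set_compl.symm
    rw [hc]
    refine ⟨hlt.2 h.1, fun Z h1 h2 => h.2 (c := Z.translate ha') ?_ ?_⟩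
    · rwa [← hlt, hinv]
    · rwa [← hlt, hinv]

lemma HalfSpace.translate_smul {a : E} (ha : a • U = U) (g : θ.ker) {X : HalfSpace θ.ker U} :
    (g • X).translate ha = (MulAut.conjNormal a g) • X.translate ha := by
  apply Subtype.ext
  change a • (g : E) • X.1 = ((MulAut.conjNormal a g : θ.ker) : E) • a • X.1
  simp only [MulAut.conjNormal_apply, ← mul_smul, inv_mul_cancel_right]

/-- Multiplication by an element with the same image as a stabilizing element. -/
def HalfSpace.shift {a α : E} (hα : α • U = U) (ha : θ a = θ α) :
    HalfSpace θ.ker U ≃o HalfSpace θ.ker U where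
  toFun X := ⟨a • X.1, by
    obtain ⟨g, hg⟩ := X.2
    have hα' : α⁻¹ • U = U := by rw [inv_smul_eq_iff, hα]
    refine ⟨⟨a * g * α⁻¹, by
      rw [MonoidHom.mem_ker, _root_.map_mul, _root_.map_mul, _root_.map_inv, ha, g.2]; simp⟩, ?_⟩
    simp only [Subgroup.smul_def, mul_smul, Set.smul_set_compl, hα'] at hg ⊢
    rcases hg with hg | hg
    · exact Or.inl (by rw [hg])
    · exact Or.inr (by rw [hg, Set.smul_set_compl])⟩
  invFun X := ⟨a⁻¹ • X.1, by
    obtain ⟨g, hg⟩ := X.2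
    refine ⟨⟨a⁻¹ * g * α, by
      rw [MonoidHom.mem_ker, _root_.map_mul, _root_.map_mul, _root_.map_inv, ha, g.2]; simp⟩, ?_⟩
    simp only [Subgroup.smul_def, mul_smul, Set.smul_set_compl, hα] at hg ⊢
    rcases hg with hg | hg
    · exact Or.inl (by rw [hg])
    · exact Or.inr (by rw [hg, Set.smul_set_compl])⟩
  left_inv X := Subtype.ext (inv_smul_smul a X.1)
  right_inv X := Subtype.ext (smul_inv_smul a X.1)
  map_rel_iff' := Set.smul_set_subset_smul_set_iff

lemma HalfSpace.shift_val {a α : E} (hα : α • U = U) (ha : θ a = θ α) (X : HalfSpace θ.ker U) :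
    (HalfSpace.shift hα ha X).1 = a • X.1 := rfl

/-- The alternatives for an extension of a cyclic group of odd prime order by a free group. -/
theorem splitting_dichotomy {ι : Type*} [Finite ι] (hodd : Odd p)
    (hθ : Function.Surjective θ) (b : FreeGroupBasis ι θ.ker)
    (hcomm : ∃ x y : θ.ker, x * y ≠ y * x) :
    (∃ (α : E) (_ : θ α = Multiplicative.ofAdd 1) (_ : α ^ p = 1) (P Q : Subgroup θ.ker)
      (XP XQ : Set θ.ker) (_ : PingPong P Q XP XQ),
      (∀ g ∈ P, MulAut.conjNormal α g ∈ P) ∧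
      ((P ≠ ⊥ ∧ Q ≠ ⊥ ∧ (∀ g ∈ Q, MulAut.conjNormal α g ∈ Q) ∧
          ∀ a : E, θ a = Multiplicative.ofAdd 1 → a ^ p = 1 →
            ∃ (g : E) (x : θ.ker), (x ∈ P ∨ x ∈ Q) ∧ g * a * g⁻¹ = x * α) ∨
        (∃ t, Q = Subgroup.zpowers t ∧ t ≠ 1 ∧ MulAut.conjNormal α t * t⁻¹ ∈ P) ∧
          ∀ a : E, θ a = Multiplicative.ofAdd 1 → a ^ p = 1 →
            ∃ (g : E) (x : θ.ker), x ∈ P ∧ g * a * g⁻¹ = x * α)) ∨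
    (∃ (P Q : Subgroup E) (XP XQ : Set E) (_ : PingPong P Q XP XQ), ¬ P ≤ θ.ker ∧ Q ≠ ⊥ ∧
      ((Q ≤ θ.ker ∧ ∀ a : E, a ^ p = 1 → ∃ g, g * a * g⁻¹ ∈ P) ∨
        (¬ Q ≤ θ.ker ∧ ∀ a : E, a ^ p = 1 → ∃ g, g * a * g⁻¹ ∈ P ∨ g * a * g⁻¹ ∈ Q))) := by
  have hιne : Nonempty ι := by
    by_contra hem
    rw [not_nonempty_iff] at hem
    obtain ⟨x, y, hxy⟩ := hcomm
    exact hxy (b.repr.injective (Subsingleton.elim _ _))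
  obtain ⟨U, hi, hi', hai, hn⟩ := exists_nested_of_freeGroupBasis hθ b
  have tf : ∀ g : θ.ker, IsOfFinOrder (g : E) → g = 1 := by
    intro g hg
    have := (MonoidHom.isOfFinOrder b.repr.toMonoidHom (Submonoid.isOfFinOrder_coe.1 hg)).eq_one'
    simpa using this
  have tp : ∀ g : E, IsOfFinOrder g → g ^ p = 1 := by
    intro g hg
    exact congrArg Subtype.val (tf ⟨g ^ p, pow_mem_ker g⟩ hg.pow)
  have fo : ∀ g : E, g • U = U → IsOfFinOrder g := fun g hg =>
    hai.isOfFinOrder hi.nonempty hi'.nonempty hg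
  have noinv : ∀ g : E, g • U ≠ Uᶜ := by
    intro g hg
    have h2 : (g ^ 2) • U = U := by
      rw [pow_two, mul_smul, hg, Set.smul_set_compl, hg, compl_compl]
    have h3 : g ^ p = 1 := tp g (by
      have := fo _ h2
      rwa [isOfFinOrder_pow, or_iff_left (by norm_num)] at this)
    obtain ⟨k, hk⟩ := hodd
    have h4 : (g ^ 2) ^ (k + 1) • U = U := by
      induction (k + 1) with
      | zero => simp
      | succ k ih => rw [pow_succ, mul_smul, h2, ih]
    rw [← pow_mul, show 2 * (k + 1) = p + 1 by omega, pow_succ, h3, one_mul, hg] at h4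
    obtain ⟨x, hx⟩ := hi.nonempty
    have : x ∈ Uᶜ := by rw [h4]; exact hx
    exact this hx
  have same : ∀ V : Set E, V.Infinite → ∃ g : θ.ker, g ≠ 1 ∧ ∃ x, x ∈ V ∧ (g : E) * x ∈ V := by
    intro V hV
    obtain ⟨x, hx, y, hy, hne, hxy⟩ := hV.exists_ne_map_eq_of_mapsTo (f := θ) (t := Set.univ)
      (fun _ _ => trivial) Set.finite_univ
    refine ⟨⟨y * x⁻¹, by rw [MonoidHom.mem_ker, _root_.map_mul, _root_.map_inv, hxy]; simp⟩, ?_,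
      x, hx, by simpa using hy⟩
    intro h
    have := congrArg Subtype.val h
    simp only [OneMemClass.coe_one, mul_inv_eq_one] at this
    exact hne this.symm
  obtain ⟨g1, hg1, x1, hx1, hgx1⟩ := same _ hi'
  obtain ⟨g2, hg2, x2, hx2, hgx2⟩ := same _ hi
  by_cases hC : ∀ g : E, g • U = U → g = 1
  · right
    have h : IsPocset (G := E) HalfSpace.compl (HalfSpace.base E U) :=
      isPocset_halfSpace hi.nonempty hi'.nonempty hn hC noinv hai.finite_sep
    rcases (IsPocset.swaps E HalfSpace.compl (HalfSpace.base E U)).eq_empty_or_nonempty with hT |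
      ⟨t, ht⟩
    · have hpp := h.pingPong_amalgam hT
      obtain ⟨hP, hQ⟩ := h.pingPong_nontrivial ⟨g1, by simpa using hg1, x1, hx1, hgx1⟩
        ⟨g2, by simpa using hg2, x2, hx2, hgx2⟩ hpp
      have tor : ∀ a : E, a ^ p = 1 → ∃ g, g * a * g⁻¹ ∈ h.stab ∨ g * a * g⁻¹ ∈ h.symm.stab :=
        fun a ha => h.exists_conj_mem_stab hp.out.ne_zero ha
      have torker : ∀ {K : Subgroup E}, K ≤ θ.ker → ∀ a : E, a ^ p = 1 → ∀ g, g * a * g⁻¹ ∈ K →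
          a = 1 := by
        intro K hK a ha g hg
        have := tf ⟨a, by
          have := θ.normal_ker.conj_mem _ (hK hg) g⁻¹
          simpa [mul_assoc] using this⟩ (isOfFinOrder_iff_pow_eq_one.2 ⟨p, hp.out.pos, ha⟩)
        exact congrArg Subtype.val this
      by_cases hPk : h.stab ≤ θ.ker
      · have hQk : ¬ h.symm.stab ≤ θ.ker := by
          intro hQk
          have : (⊤ : Subgroup E) ≤ θ.ker := hpp.gen ▸ sup_le hPk hQk
          obtain ⟨x, hx⟩ := hθ (Multiplicative.ofAdd 1)
          have := MonoidHom.mem_ker.1 (this (Subgroup.mem_top x))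
          rw [hx] at this
          exact one_ne_zero (α := ZMod p) (Multiplicative.ofAdd.injective this)
        refine ⟨_, _, _, _, hpp.symm, hQk, hP, Or.inl ⟨hPk, fun a ha => ?_⟩⟩
        obtain ⟨g, hg | hg⟩ := tor a ha
        · exact ⟨1, by rw [torker hPk a ha g hg]; simp⟩
        · exact ⟨g, hg⟩
      · by_cases hQk : h.symm.stab ≤ θ.ker
        · refine ⟨_, _, _, _, hpp, hPk, hQ, Or.inl ⟨hQk, fun a ha => ?_⟩⟩
          obtain ⟨g, hg | hg⟩ := tor a ha
          · exact ⟨g, hg⟩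
          · exact ⟨1, by rw [torker hQk a ha g hg]; simp⟩
        · exact ⟨_, _, _, _, hpp, hPk, hQ, Or.inr ⟨hQk, tor⟩⟩
    · have tor : ∀ a : E, a ^ p = 1 → ∃ g, g * a * g⁻¹ ∈ h.stab := by
        intro a ha
        obtain ⟨g, hg | hg⟩ := h.exists_conj_mem_stab hp.out.ne_zero ha
        · exact ⟨g, hg⟩
        · exact ⟨t * g, by simpa [mul_assoc] using (h.conj_mem_stab ht).2 hg⟩
      have swne : ∀ s ∈ IsPocset.swaps E HalfSpace.compl (HalfSpace.base E U), s ≠ 1 := by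
        rintro s hs rfl
        rw [IsPocset.mem_swaps, one_smul] at hs
        rcases hs with hs | hs
        · exact h.c_ne _ hs
        · rw [h.cc] at hs; exact hs.1.false
      by_cases hPk : h.stab ≤ θ.ker
      · obtain ⟨XP, XQ, hpp⟩ := h.pingPong_hnn ht
        refine ⟨_, _, _, _, hpp.symm, ?_, ?_, Or.inl ⟨hPk, ?_⟩⟩
        · intro hQk
          have : (⊤ : Subgroup E) ≤ θ.ker := hpp.gen ▸ sup_le hPk hQk
          obtain ⟨x, hx⟩ := hθ (Multiplicative.ofAdd 1)
          have := MonoidHom.mem_ker.1 (this (Subgroup.mem_top x))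
          rw [hx] at this
          exact one_ne_zero (α := ZMod p) (Multiplicative.ofAdd.injective this)
        · intro hbot
          have hgen := hpp.gen
          rw [hbot, bot_sup_eq] at hgen
          obtain ⟨x, y, hxy⟩ := hcomm
          obtain ⟨k, hk⟩ : (x : E) ∈ Subgroup.zpowers t := hgen ▸ Subgroup.mem_top _
          obtain ⟨l, hl⟩ : (y : E) ∈ Subgroup.zpowers t := hgen ▸ Subgroup.mem_top _
          apply hxy
          apply Subtype.ext
          simp only [Subgroup.coe_mul, ← hk, ← hl]
          exact zpow_mul_comm t k l
        · intro a ha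
          obtain ⟨g, hg⟩ := tor a ha
          have := tf ⟨a, by
            have := θ.normal_ker.conj_mem _ (hPk hg) g⁻¹
            simpa [mul_assoc] using this⟩ (isOfFinOrder_iff_pow_eq_one.2 ⟨p, hp.out.pos, ha⟩)
          exact ⟨1, by rw [show a = 1 from congrArg Subtype.val this]; simp⟩
      · obtain ⟨q, hqP, hq⟩ := Set.not_subset.1 hPk
        obtain ⟨k, hk⟩ := exists_pow_map_eq hq (θ t)⁻¹
        have ht' := h.mul_mem_swaps (h.stab.pow_mem hqP k) ht
        obtain ⟨XP, XQ, hpp⟩ := h.pingPong_hnn ht'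
        refine ⟨_, _, _, _, hpp, hPk, ?_, Or.inl ⟨?_, tor⟩⟩
        · rw [Ne, Subgroup.zpowers_eq_bot]
          exact swne _ ht'
        · rw [Subgroup.zpowers_le, MonoidHom.mem_ker, _root_.map_mul, hk, inv_mul_cancel]
  · left
    push Not at hC
    obtain ⟨c, hcU, hc1⟩ := hC
    have hck : c ∉ θ.ker := fun hk => hc1 (congrArg Subtype.val (tf ⟨c, hk⟩ (fo c hcU)))
    obtain ⟨k, hk⟩ := exists_pow_map_eq hck (Multiplicative.ofAdd 1)
    have hαU : c ^ k • U = U := by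
      clear hk
      induction k with
      | zero => simp
      | succ k ih => rw [pow_succ, mul_smul, hcU, ih]
    refine ⟨c ^ k, hk, tp _ (fo _ hαU), ?_⟩
    generalize c ^ k = α at *
    have h : IsPocset (G := θ.ker) HalfSpace.compl (HalfSpace.base θ.ker U) := by
      refine isPocset_halfSpace hi.nonempty hi'.nonempty (fun g => hn g)
        (fun g hg => tf g (fo g hg)) (fun g => noinv g) (fun x y => ?_)
      exact (hai.finite_sep x y).preimage Subtype.val_injective.injOn
    have tb : (HalfSpace.base θ.ker U).translate hαU = HalfSpace.base θ.ker U := Subtype.ext hαU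
    have tcb : (HalfSpace.base θ.ker U).compl.translate hαU = (HalfSpace.base θ.ker U).compl :=
      Subtype.ext (by
        change α • Uᶜ = Uᶜ
        rw [Set.smul_set_compl, hαU])
    have invP : ∀ g ∈ h.stab, MulAut.conjNormal α g ∈ h.stab := by
      intro g hg
      have := HalfSpace.adj_translate hαU (h.mem_stab.1 hg)
      rwa [HalfSpace.translate_smul, tb] at this
    have invQ : ∀ g ∈ h.symm.stab, MulAut.conjNormal α g ∈ h.symm.stab := by
      intro g hg
      have := HalfSpace.adj_translate hαU (h.symm.mem_stab.1 hg)
      rwa [HalfSpace.translate_smul, tcb] at this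
    have tor : ∀ a : E, θ a = Multiplicative.ofAdd 1 → a ^ p = 1 →
        ∃ (g x : θ.ker), (x ∈ h.stab ∨ x ∈ h.symm.stab) ∧ (g : E) * a * (g : E)⁻¹ = x * α := by
      intro a ha hap
      have haα : θ a = θ α := by rw [ha, hk]
      have mk : ∀ g : θ.ker, ∃ x : θ.ker, ((g⁻¹ : θ.ker) : E) * a * ((g⁻¹ : θ.ker) : E)⁻¹ = x * α ∧
          x • HalfSpace.base θ.ker U = g⁻¹ • HalfSpace.shift hαU haα (g • HalfSpace.base θ.ker U)
            := by
        intro g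
        refine ⟨⟨(g : E)⁻¹ * a * g * α⁻¹, by
          simp only [MonoidHom.mem_ker, _root_.map_mul, _root_.map_inv, haα,
            MonoidHom.mem_ker.1 g.2]; simp⟩, by simp, Subtype.ext ?_⟩
        change ((g : E)⁻¹ * a * g * α⁻¹) • U = (g : E)⁻¹ • a • (g : E) • U
        have hα' : α⁻¹ • U = U := by rw [inv_smul_eq_iff, hαU]
        simp only [mul_smul, hα']
      have shc : ∀ X : HalfSpace θ.ker U, HalfSpace.shift hαU haα X.compl =
          (HalfSpace.shift hαU haα X).compl := fun X => Subtype.ext Set.smul_set_compl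
      have fromX : ∀ X : HalfSpace θ.ker U, Adj HalfSpace.compl (HalfSpace.shift hαU haα X) X →
          ∃ (g x : θ.ker), (x ∈ h.stab ∨ x ∈ h.symm.stab) ∧ (g : E) * a * (g : E)⁻¹ = x * α := by
        intro X hX
        obtain ⟨g, rfl | rfl⟩ := h.orbit X <;> obtain ⟨x, hx1, hx2⟩ := mk g <;>
          have := h.adj_smul g⁻¹ hX
        · rw [inv_smul_smul, ← hx2] at this
          exact ⟨g⁻¹, x, Or.inl this, hx1⟩
        · rw [inv_smul_smul, h.smul_c, shc, h.smul_c, ← hx2, ← h.smul_c] at this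
          exact ⟨g⁻¹, x, Or.inr this, hx1⟩
      by_cases hfix : ∃ X : HalfSpace θ.ker U, HalfSpace.shift hαU haα X = X
      · obtain ⟨X, hX⟩ := hfix
        exact fromX X (Or.inl hX)
      · push Not at hfix
        have hinv : ∀ X : HalfSpace θ.ker U, HalfSpace.shift hαU haα X ≠ X.compl := by
          have key : ∀ g : θ.ker, a • (g : E) • U ≠ ((g : E) • U)ᶜ := by
            intro g hg
            apply noinv ((g : E)⁻¹ * a * g)
            rw [mul_smul, mul_smul, hg, Set.smul_set_compl, inv_smul_smul]
          intro X hX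
          have hX := congrArg Subtype.val hX
          obtain ⟨g, rfl | rfl⟩ := h.orbit X
          · exact key g hX
          · apply key g
            change a • (g : E) • Uᶜ = ((g : E) • Uᶜ)ᶜ at hX
            rw [Set.smul_set_compl, Set.smul_set_compl] at hX
            exact compl_injective hX
        obtain ⟨X, hX⟩ := h.exists_adj_of_iterate shc hfix hinv hp.out.ne_zero (fun X => by
          have : ∀ m : ℕ, ((HalfSpace.shift hαU haα)^[m] X).1 = a ^ m • X.1 := by
            intro m
            induction m with
            | zero => simp
            | succ m ih =>
              rw [Function.iterate_succ_apply', HalfSpace.shift_val, ih, pow_succ', mul_smul]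
          exact Subtype.ext (by rw [this, hap, one_smul]))
        exact fromX X hX
    rcases (IsPocset.swaps θ.ker HalfSpace.compl
      (HalfSpace.base θ.ker U)).eq_empty_or_nonempty with hT | ⟨t, ht⟩
    · have hpp := h.pingPong_amalgam hT
      obtain ⟨hP, hQ⟩ := h.pingPong_nontrivial ⟨g1, hg1, x1, hx1, hgx1⟩
        ⟨g2, hg2, x2, hx2, hgx2⟩ hpp
      refine ⟨_, _, _, _, hpp, invP, Or.inl ⟨hP, hQ, invQ, fun a ha hap => ?_⟩⟩
      obtain ⟨g, x, hx, e⟩ := tor a ha hap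
      exact ⟨g, x, hx, e⟩
    · obtain ⟨XP, XQ, hpp⟩ := h.pingPong_hnn ht
      have htP : MulAut.conjNormal α t * t⁻¹ ∈ h.stab := by
        refine h.mem_stab_of_mem_swaps ?_ ht
        have := HalfSpace.adj_translate hαU (IsPocset.mem_swaps.1 ht)
        rwa [HalfSpace.translate_smul, tb, tcb] at this
      refine ⟨_, _, _, _, hpp, invP, Or.inr ⟨⟨t, rfl, ?_, htP⟩, fun a ha hap => ?_⟩⟩
      · rintro rfl
        rw [IsPocset.mem_swaps, one_smul] at ht
        rcases ht with hs | hs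
        · exact h.c_ne _ hs
        · rw [h.cc] at hs; exact hs.1.false
      · obtain ⟨g, x, hx | hx, e⟩ := tor a ha hap
        · exact ⟨g, x, hx, e⟩
        · refine ⟨t * g, t * x * t⁻¹ * (MulAut.conjNormal α t * t⁻¹)⁻¹,
            h.stab.mul_mem ((h.conj_mem_stab ht).2 hx) (h.stab.inv_mem htP), ?_⟩
          rw [show (t : E) * g * a * (t * g : E)⁻¹ = t * (g * a * (g : E)⁻¹) * (t : E)⁻¹ by group,
            e]
          simp [MulAut.conjNormal_apply, mul_assoc]

end Dichotomy

end

section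

section FreeProducts

open Monoid

universe u

variable {G ι : Type*} [Group G] {H : ι → Subgroup G} {X : ι → Set G}

/-- The ping-pong lemma for a family of subgroups acting by left multiplication. -/
theorem coprodI_lift_injective (one : ∀ i, 1 ∉ X i) (mem : ∀ i, ∀ h ∈ H i, h ≠ 1 → h ∈ X i)
    (mul : ∀ i j, i ≠ j → ∀ h ∈ H i, h ≠ 1 → ∀ x ∈ X j, h * x ∈ X i) :
    Function.Injective (CoprodI.lift fun i => (H i).subtype) := by
  classical
  have key : ∀ {i j : ι} (w : CoprodI.NeWord (fun i => H i) i j),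
      CoprodI.lift (fun i => (H i).subtype) w.prod ∈ X i ∧
      ∀ k, k ≠ j → ∀ x ∈ X k, CoprodI.lift (fun i => (H i).subtype) w.prod * x ∈ X i := by
    intro i j w
    induction w with
    | @singleton i x hx =>
      have hx' : (x : G) ≠ 1 := by simpa using hx
      simp only [CoprodI.NeWord.prod_singleton, CoprodI.lift_of, Subgroup.subtype_apply]
      exact ⟨mem i x x.2 hx', fun k hk y hy => mul i k hk.symm x x.2 hx' y hy⟩
    | append w₁ hne w₂ ih₁ ih₂ =>
      simp only [CoprodI.NeWord.append_prod, _root_.map_mul]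
      refine ⟨ih₁.2 _ hne.symm _ ih₂.1, fun k hk x hx => ?_⟩
      rw [mul_assoc]
      exact ih₁.2 _ hne.symm _ (ih₂.2 k hk x hx)
  rw [injective_iff_map_eq_one]
  intro x hx
  by_contra hne
  have hw : CoprodI.Word.equiv x ≠ CoprodI.Word.empty := by
    intro h
    apply hne
    rw [← CoprodI.Word.equiv.symm_apply_apply x, h]
    rfl
  obtain ⟨i, j, w, hw'⟩ := CoprodI.NeWord.of_word _ hw
  have := (key w).1
  rw [CoprodI.NeWord.prod, hw'] at this
  have e : (CoprodI.Word.equiv x).prod = x := CoprodI.Word.equiv.symm_apply_apply x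
  rw [e, hx] at this
  exact one i this

theorem exists_basis_of_pingPong (one : ∀ i, 1 ∉ X i) (mem : ∀ i, ∀ h ∈ H i, h ≠ 1 → h ∈ X i)
    (mul : ∀ i j, i ≠ j → ∀ h ∈ H i, h ≠ 1 → ∀ x ∈ X j, h * x ∈ X i)
    (gen : ∀ K : Subgroup G, (∀ i, H i ≤ K) → K = ⊤) {κ : ι → Type*}
    (b : ∀ i, FreeGroupBasis (κ i) (H i)) :
    ∃ B : FreeGroupBasis (Σ i, κ i) G, ∀ i k, B ⟨i, k⟩ = b i k := by
  have hsurj : Function.Surjective (CoprodI.lift fun i => (H i).subtype) := by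
    rw [← MonoidHom.range_eq_top]
    refine gen _ fun i x hx => ⟨CoprodI.of (⟨x, hx⟩ : H i), by simp⟩
  refine ⟨(CoprodI.FreeGroupBasis.coprodI b).map
    (MulEquiv.ofBijective _ ⟨coprodI_lift_injective one mem mul, hsurj⟩), fun i k => ?_⟩
  have : CoprodI.FreeGroupBasis.coprodI b ⟨i, k⟩ = 
      CoprodI.of (M := fun i => H i) (b i k) :=
    FreeGroup.lift_apply_of (f := fun x : Σ i, κ i => CoprodI.of (M := fun i => H i) (b x.1 x.2))
  rw [FreeGroupBasis.map_apply, this]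
  exact CoprodI.lift_of _ _

theorem PingPong.exists_basis {P Q : Subgroup G} {XP XQ : Set G} (h : PingPong P Q XP XQ)
    {κ μ : Type u} (b : FreeGroupBasis κ P) (c : FreeGroupBasis μ Q) :
    ∃ B : FreeGroupBasis (κ ⊕ μ) G, (∀ k, B (.inl k) = b k) ∧ ∀ k, B (.inr k) = c k := by
  obtain ⟨B, hB⟩ := exists_basis_of_pingPong (H := fun i : Bool => cond i Q P)
    (X := fun i => cond i XQ XP) (κ := fun i => cond i μ κ)
    (by rintro (_ | _); exacts [h.one_P, h.one_Q])
    (by rintro (_ | _); exacts [h.mem_P, h.mem_Q])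
    (by
      rintro (_ | _) (_ | _) hij
      exacts [absurd rfl hij, h.mul_P, h.mul_Q, absurd rfl hij])
    (fun K hK => top_le_iff.1 (h.gen ▸ sup_le (hK false) (hK true)))
    (fun i => match i with
      | false => b
      | true => c)
  refine ⟨B.reindex (Equiv.sumEquivSigmaBool κ μ).symm, fun k => ?_, fun k => ?_⟩
  · exact hB false k
  · exact hB true k

end FreeProducts

end

section

section Elementary

variable {G G' κ : Type*} [Group G] [Group G']

lemma closure_range_basis (b : FreeGroupBasis κ G) : Subgroup.closure (Set.range b) = ⊤ := by
  rw [eq_top_iff]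
  intro x _
  have h : ∀ w : FreeGroup κ, b.repr.symm w ∈ Subgroup.closure (Set.range b) := by
    intro w
    induction w using FreeGroup.induction_on with
    | C1 => simp
    | of k => exact Subgroup.subset_closure ⟨k, rfl⟩
    | inv_of k ih => rw [_root_.map_inv]; exact Subgroup.inv_mem _ ih
    | mul x y hx hy => rw [_root_.map_mul]; exact Subgroup.mul_mem _ hx hy
  simpa using h (b.repr x)

lemma mulAut_ext (b : FreeGroupBasis κ G) {g h : MulAut G} (e : ∀ k, g (b k) = h (b k)) :
    g = h := by
  have := b.ext_hom g.toMonoidHom h.toMonoidHom e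
  exact MulEquiv.toMonoidHom_injective this

lemma fixes_closure {s : Set G} {g : MulAut G} (h : ∀ x ∈ s, g x = x) :
    ∀ x ∈ Subgroup.closure s, g x = x := by
  intro x hx
  induction hx using Subgroup.closure_induction with
  | mem x hx => exact h x hx
  | one => simp
  | mul x y _ _ hx hy => rw [_root_.map_mul, hx, hy]
  | inv x _ hx => rw [_root_.map_inv, hx]

lemma closure_basis_subgroup {H : Subgroup G} (b : FreeGroupBasis κ H) :
    Subgroup.closure (Set.range fun k => (b k : G)) = H := by
  have := congrArg (Subgroup.map H.subtype) (closure_range_basis b)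
  rw [MonoidHom.map_closure, ← Set.range_comp, ← MonoidHom.range_eq_map, H.range_subtype] at this
  exact this

/-- The subgroup generated by all basis elements but one. -/
def others (b : FreeGroupBasis κ G) (k : κ) : Subgroup G := Subgroup.closure (b '' {k}ᶜ)

lemma mem_others (b : FreeGroupBasis κ G) {k j : κ} (h : j ≠ k) : b j ∈ others b k :=
  Subgroup.subset_closure ⟨j, h, rfl⟩

lemma fixes_others {b : FreeGroupBasis κ G} {k : κ} {g : MulAut G} (h : ∀ j ≠ k, g (b j) = b j)
    {x : G} (hx : x ∈ others b k) : g x = x := by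
  refine fixes_closure ?_ x hx
  rintro - ⟨j, hj, rfl⟩
  exact h j hj

lemma inv_apply_eq_of {g : MulAut G} {x y : G} (h : g x = y) : g⁻¹ y = x := by
  rw [← h]; exact MulAut.inv_apply_self _ g x

/-- `g` multiplies one basis element by elements of the subgroup generated by the others. -/
structure IsElem (b : FreeGroupBasis κ G) (k : κ) (u v : G) (g : MulAut G) : Prop where
  left_mem : u ∈ others b k
  right_mem : v ∈ others b k
  self : g (b k) = u * b k * v
  other : ∀ x ∈ others b k, g x = x

namespace IsElem

variable {b : FreeGroupBasis κ G} {k : κ} {u v : G} {g : MulAut G}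

lemma inv (h : IsElem b k u v g) : IsElem b k u⁻¹ v⁻¹ g⁻¹ where
  left_mem := inv_mem h.left_mem
  right_mem := inv_mem h.right_mem
  self := by
    apply inv_apply_eq_of
    rw [_root_.map_mul, _root_.map_mul, h.self, h.other _ (inv_mem h.left_mem),
      h.other _ (inv_mem h.right_mem)]
    group
  other x hx := inv_apply_eq_of (h.other x hx)

lemma apply (h : IsElem b k u v g) {j : κ} (hj : j ≠ k) : g (b j) = b j :=
  h.other _ (mem_others b hj)

lemma of_apply (hu : u ∈ others b k) (hv : v ∈ others b k) (hk : g (b k) = u * b k * v)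
    (h : ∀ j ≠ k, g (b j) = b j) : IsElem b k u v g :=
  ⟨hu, hv, hk, fun _ => fixes_others h⟩

end IsElem

theorem exists_isElem (b : FreeGroupBasis κ G) {k : κ} {u v : G} (hu : u ∈ others b k)
    (hv : v ∈ others b k) : ∃ g, IsElem b k u v g := by
  classical
  let f : G → G → G →* G := fun u v => b.lift (Function.update b k (u * b k * v))
  have hf : ∀ {u v j}, j ≠ k → f u v (b j) = b j := by
    intro u v j hj
    have : f u v (b j) = Function.update b k (u * b k * v) j := by simp [f]
    rw [this, Function.update_of_ne hj]
  have hk : ∀ {u v}, f u v (b k) = u * b k * v := by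
    intro u v
    have : f u v (b k) = Function.update b k (u * b k * v) k := by simp [f]
    rw [this, Function.update_self]
  have ho : ∀ {u v x}, x ∈ others b k → f u v x = x := by
    intro u v x hx
    induction hx using Subgroup.closure_induction with
    | mem x hx => obtain ⟨j, hj, rfl⟩ := hx; exact hf hj
    | one => simp
    | mul x y _ _ hx hy => rw [_root_.map_mul, hx, hy]
    | inv x _ hx => rw [_root_.map_inv, hx]
  have hcomp : ∀ {u v}, u ∈ others b k → v ∈ others b k →
      (f u⁻¹ v⁻¹).comp (f u v) = MonoidHom.id G := by
    intro u v hu hv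
    apply b.ext_hom
    intro j
    by_cases hj : j = k
    · subst hj
      simp only [MonoidHom.comp_apply, hk, _root_.map_mul, ho hu, ho hv, MonoidHom.id_apply]
      group
    · simp only [MonoidHom.comp_apply, hf hj, MonoidHom.id_apply]
  refine ⟨MonoidHom.toMulEquiv (f u v) (f u⁻¹ v⁻¹) (hcomp hu hv) ?_, hu, hv, hk, fun x hx => ho hx⟩
  have := hcomp (inv_mem hu) (inv_mem hv)
  rwa [inv_inv, inv_inv] at this

lemma exists_basis_inv (b : FreeGroupBasis κ G) (k : κ) :
    ∃ b' : FreeGroupBasis κ G, b' k = (b k)⁻¹ ∧ ∀ j ≠ k, b' j = b j := by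
  classical
  let f : G →* G := b.lift (Function.update b k (b k)⁻¹)
  have hf : ∀ j, f (b j) = Function.update b k (b k)⁻¹ j := by intro j; simp [f]
  have hcomp : f.comp f = MonoidHom.id G := by
    apply b.ext_hom
    intro j
    by_cases hj : j = k
    · subst hj; simp [hf]
    · simp [hf, hj]
  refine ⟨b.map (MonoidHom.toMulEquiv f f hcomp hcomp), ?_, fun j hj => ?_⟩
  · exact (hf k).trans (Function.update_self ..)
  · exact (hf j).trans (Function.update_of_ne hj ..)

end Elementary

section Transvection

variable {G : Type*} [Group G]

/-- An automorphism multiplying one element of some basis by another one on the left. -/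
def IsTransvection (g : MulAut G) : Prop :=
  ∃ (κ : Type) (b : FreeGroupBasis κ G) (k l : κ), k ≠ l ∧ IsElem b k (b l) 1 g

variable {κ : Type} {b : FreeGroupBasis κ G} {k l : κ} {g : MulAut G}

lemma isTransvection_left_inv (hkl : k ≠ l) (h : IsElem b k (b l)⁻¹ 1 g) : IsTransvection g := by
  obtain ⟨b', h1, h2⟩ := exists_basis_inv b l
  have hle : ∀ {c c' : FreeGroupBasis κ G}, c' l = (c l)⁻¹ → (∀ j ≠ l, c' j = c j) →
      others c' k ≤ others c k := by
    intro c c' h1 h2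
    rw [others, Subgroup.closure_le]
    rintro - ⟨j, hj, rfl⟩
    by_cases hjl : j = l
    · subst hjl
      rw [h1]; exact inv_mem (mem_others c hj)
    · rw [h2 j hjl]; exact mem_others c hj
  refine ⟨κ, b', k, l, hkl, mem_others b' hkl.symm, one_mem _, ?_, fun x hx => h.other x ?_⟩
  · rw [h2 k hkl, h.self, h1]
  · exact hle h1 h2 hx

lemma isTransvection_right (hkl : k ≠ l) (h : IsElem b k 1 (b l) g) : IsTransvection g := by
  obtain ⟨b', h1, h2⟩ := exists_basis_inv b k
  have hle : others b' k = others b k := by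
    rw [others, others]
    congr 1
    exact Set.image_congr fun j hj => h2 j hj
  refine isTransvection_left_inv (b := b') hkl
    ⟨inv_mem (mem_others b' hkl.symm), one_mem _, ?_, fun x hx => h.other x (hle ▸ hx)⟩
  rw [h1, _root_.map_inv, h.self, h2 l hkl.symm]
  group

lemma isTransvection_right_inv (hkl : k ≠ l) (h : IsElem b k 1 (b l)⁻¹ g) : IsTransvection g := by
  obtain ⟨b', h1, h2⟩ := exists_basis_inv b k
  have hle : others b' k = others b k := by
    rw [others, others]
    congr 1
    exact Set.image_congr fun j hj => h2 j hj
  refine ⟨κ, b', k, l, hkl, mem_others b' hkl.symm, one_mem _, ?_, fun x hx => h.other x (hle ▸ hx)⟩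
  rw [h1, _root_.map_inv, h.self, h2 l hkl.symm]
  group

section Commutators

variable {N : Subgroup (MulAut G)} [N.Normal] {α : MulAut G}

theorem exists_transvection_of_orbit (hα : α ∈ N) {k₀ k₁ k₂ : κ} (h₀₁ : k₀ ≠ k₁) (h₀₂ : k₀ ≠ k₂)
    (h₁₂ : k₁ ≠ k₂) (e₀ : α (b k₀) = b k₁) (e₁ : α (b k₁) = b k₂)
    (hfix : ∀ g : MulAut G, (∀ x ∈ others b k₁, g x = x) → ∀ j ≠ k₀, g (α (b j)) = α (b j)) :
    ∃ g ∈ N, IsTransvection g := by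
  obtain ⟨s, hs⟩ := exists_isElem b (one_mem (others b k₀)) (mem_others b h₀₁.symm)
  obtain ⟨t, ht⟩ := exists_isElem b (one_mem (others b k₁)) (mem_others b h₁₂.symm)
  have hst : α * s = t * α := by
    apply mulAut_ext b
    intro j
    by_cases hj : j = k₀
    · subst hj
      simp [-MulAut.coe_inv, -MulAut.inv_apply, hs.self, ht.self, e₀, e₁]
    · simp [-MulAut.coe_inv, -MulAut.inv_apply, hs.apply hj, hfix t ht.other j hj]
  have ht' : t = α * s * α⁻¹ := by rw [hst]; group
  refine ⟨s⁻¹ * t * s * t⁻¹, ?_, isTransvection_right h₀₂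
    (.of_apply (one_mem _) (mem_others b h₀₂.symm) ?_ ?_)⟩
  · have : s⁻¹ * t * s * t⁻¹ = (s⁻¹ * α * s⁻¹⁻¹) * α⁻¹ * (s * α * s⁻¹) * α⁻¹ := by
      rw [ht']; group
    rw [this]
    have hN : N.Normal := inferInstance
    exact N.mul_mem (N.mul_mem (N.mul_mem (hN.conj_mem _ hα _) (N.inv_mem hα))
      (hN.conj_mem _ hα _)) (N.inv_mem hα)
  · simp [-MulAut.coe_inv, -MulAut.inv_apply, ht.inv.apply h₀₁, hs.self, hs.inv.self, ht.self,
      ht.apply h₀₁, hs.inv.apply h₀₁.symm,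
      hs.inv.apply h₀₂.symm]
  · intro j hj
    by_cases hj1 : j = k₁
    · subst hj1
      simp [-MulAut.coe_inv, -MulAut.inv_apply, ht.inv.self, hs.apply hj, hs.apply h₀₂.symm,
        ht.self, ht.apply h₁₂.symm,
        hs.inv.apply hj]
    · simp [-MulAut.coe_inv, -MulAut.inv_apply, ht.inv.apply hj1, hs.apply hj, ht.apply hj1,
        hs.inv.apply hj]

theorem exists_transvection_of_fixed (hα : α ∈ N) {k₁ k₂ k : κ} (h₁₂ : k₁ ≠ k₂) (h₁ : k ≠ k₁)
    (h₂ : k ≠ k₂) (e₁ : α (b k₁) = b k₂ * (b k₁)⁻¹) (hk : α (b k) ∈ others b k₂)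
    (hfix : ∀ g : MulAut G, (∀ x ∈ others b k₂, g x = x) → ∀ j ≠ k₁, g (α (b j)) = α (b j)) :
    ∃ g ∈ N, IsTransvection g := by
  obtain ⟨s, hs⟩ := exists_isElem b (mem_others b h₁) (one_mem (others b k₁))
  obtain ⟨t, ht⟩ := exists_isElem b hk (one_mem (others b k₂))
  obtain ⟨h, hh⟩ := exists_isElem b (one_mem (others b k₂)) (mem_others b h₁₂)
  have hst : α * s = t * α := by
    apply mulAut_ext b
    intro j
    by_cases hj : j = k₁
    · subst hj
      simp [-MulAut.coe_inv, -MulAut.inv_apply, hs.self, ht.self, e₁, ht.apply h₁₂, mul_assoc]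
    · simp [-MulAut.coe_inv, -MulAut.inv_apply, hs.apply hj, hfix t ht.other j hj]
  have hth : h * t = t * h := by
    apply mulAut_ext b
    intro j
    by_cases hj : j = k₂
    · subst hj
      simp [-MulAut.coe_inv, -MulAut.inv_apply, hh.self, ht.self, ht.apply h₁₂, hh.other _ hk,
        mul_assoc]
    · simp [-MulAut.coe_inv, -MulAut.inv_apply, hh.apply hj, ht.apply hj]
  have ht' : t = α * s * α⁻¹ := by rw [hst]; group
  refine ⟨h * s⁻¹ * h⁻¹ * s, ?_, isTransvection_right h₂.symm
    (.of_apply (one_mem _) (mem_others b h₂) ?_ ?_)⟩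
  · have hN : N.Normal := inferInstance
    have hk : s⁻¹ * t ∈ N := by
      have : s⁻¹ * t = (s⁻¹ * α * s⁻¹⁻¹) * α⁻¹ := by rw [ht']; group
      rw [this]
      exact N.mul_mem (hN.conj_mem _ hα _) (N.inv_mem hα)
    have : h * s⁻¹ * h⁻¹ * s = (h * (s⁻¹ * t) * h⁻¹) * (s⁻¹ * t)⁻¹ := by
      have : t * h⁻¹ = h⁻¹ * t := by rw [eq_inv_mul_iff_mul_eq, ← mul_assoc, hth]; group
      rw [show h * (s⁻¹ * t) * h⁻¹ = h * s⁻¹ * (t * h⁻¹) by group, this]; group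
    rw [this]
    exact N.mul_mem (hN.conj_mem _ hk _) (N.inv_mem hk)
  · simp [-MulAut.coe_inv, -MulAut.inv_apply, hs.apply h₁₂.symm, hh.inv.self,
      hs.inv.apply h₁₂.symm, hs.inv.self, hh.self,
      hh.apply h₁₂, hh.apply h₂, mul_assoc]
  · intro j hj
    by_cases hj1 : j = k₁
    · subst hj1
      simp [-MulAut.coe_inv, -MulAut.inv_apply, hs.self, hh.inv.apply hj, hh.inv.apply h₂,
        hs.inv.self, hs.inv.apply h₁, hh.apply hj]
    · simp [-MulAut.coe_inv, -MulAut.inv_apply, hh.inv.apply hj, hs.apply hj1, hh.apply hj,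
        hs.inv.apply hj1]

theorem exists_transvection_of_four (hα : α ∈ N) {k₁ k₂ k₃ k₄ : κ} (h₁₂ : k₁ ≠ k₂) (h₁₃ : k₁ ≠ k₃)
    (h₁₄ : k₁ ≠ k₄) (h₂₃ : k₂ ≠ k₃) (h₂₄ : k₂ ≠ k₄) (h₃₄ : k₃ ≠ k₄)
    (e₁ : α (b k₁) = b k₂ * (b k₁)⁻¹) (e₂ : α (b k₂) = b k₃ * (b k₁)⁻¹)
    (e₃ : α (b k₃) = b k₄ * (b k₁)⁻¹)
    (hfix : ∀ g : MulAut G, (∀ x ∈ others b k₂, g x = x) → ∀ j ≠ k₁, g (α (b j)) = α (b j)) :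
    ∃ g ∈ N, IsTransvection g := by
  obtain ⟨s, hs⟩ := exists_isElem b (mul_mem (mem_others b h₁₂.symm)
    (inv_mem (mem_others b h₁₃.symm))) (one_mem (others b k₁))
  obtain ⟨t, ht⟩ := exists_isElem b (mul_mem (mem_others b h₂₃.symm)
    (inv_mem (mem_others b h₂₄.symm))) (one_mem (others b k₂))
  obtain ⟨h, hh⟩ := exists_isElem b (one_mem (others b k₄)) (mem_others b h₃₄)
  have hst : α * s = t * α := by
    apply mulAut_ext b
    intro j
    by_cases hj : j = k₁
    · subst hj
      simp [-MulAut.coe_inv, -MulAut.inv_apply, hs.self, ht.self, e₁, e₂, e₃, ht.apply h₁₂,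
        mul_assoc]
    · simp [-MulAut.coe_inv, -MulAut.inv_apply, hs.apply hj, hfix t ht.other j hj]
  have hsh : h * s = s * h := by
    apply mulAut_ext b
    intro j
    by_cases hj : j = k₁
    · subst hj
      simp [-MulAut.coe_inv, -MulAut.inv_apply, hs.self, hh.apply h₁₄, hh.apply h₂₄, hh.apply h₃₄]
    · by_cases hj' : j = k₄
      · subst hj'
        simp [-MulAut.coe_inv, -MulAut.inv_apply, hs.apply hj, hh.self, hs.apply h₁₃.symm]
      · simp [-MulAut.coe_inv, -MulAut.inv_apply, hs.apply hj, hh.apply hj']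
  have ht' : t = α * s * α⁻¹ := by rw [hst]; group
  refine ⟨t⁻¹ * h * t * h⁻¹, ?_, isTransvection_left_inv h₂₃
    (.of_apply (inv_mem (mem_others b h₂₃.symm)) (one_mem _) ?_ ?_)⟩
  · have hN : N.Normal := inferInstance
    have hk : s⁻¹ * t ∈ N := by
      have : s⁻¹ * t = (s⁻¹ * α * s⁻¹⁻¹) * α⁻¹ := by rw [ht']; group
      rw [this]
      exact N.mul_mem (hN.conj_mem _ hα _) (N.inv_mem hα)
    have : t⁻¹ * h * t * h⁻¹ = (s⁻¹ * t)⁻¹ * (h * (s⁻¹ * t) * h⁻¹) := by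
      have : h * s⁻¹ = s⁻¹ * h := by rw [eq_inv_mul_iff_mul_eq, ← mul_assoc, ← hsh]; group
      rw [show h * (s⁻¹ * t) * h⁻¹ = (h * s⁻¹) * t * h⁻¹ by group, this]; group
    rw [this]
    exact N.mul_mem (N.inv_mem hk) (hN.conj_mem _ hk _)
  · simp [-MulAut.coe_inv, -MulAut.inv_apply, hh.inv.apply h₂₄, ht.self, hh.apply h₃₄, hh.self,
      hh.apply h₂₄, ht.inv.self,
      ht.inv.apply h₂₄.symm, mul_assoc]
  · intro j hj
    by_cases hj' : j = k₄
    · subst hj'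
      simp [-MulAut.coe_inv, -MulAut.inv_apply, hh.inv.self, ht.apply hj, ht.apply h₂₃.symm,
        hh.self, hh.apply h₃₄, ht.inv.apply hj]
    · simp [-MulAut.coe_inv, -MulAut.inv_apply, hh.inv.apply hj', ht.apply hj, hh.apply hj',
        ht.inv.apply hj]

theorem exists_transvection_of_factors {S : Set κ} (hα : α ∈ N) {u v z : κ} (hu : u ∈ S)
    (hv : v ∈ S) (hz : z ∉ S) (huv : u ≠ v) (e : α (b u) = b v)
    (hA : ∀ x ∈ Subgroup.closure (b '' S), α x ∈ Subgroup.closure (b '' S))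
    (hA' : ∀ x ∈ Subgroup.closure (b '' S), α⁻¹ x ∈ Subgroup.closure (b '' S))
    (hB' : ∀ x ∈ Subgroup.closure (b '' Sᶜ), α⁻¹ x ∈ Subgroup.closure (b '' Sᶜ)) :
    ∃ g ∈ N, IsTransvection g := by
  have mem : ∀ {j}, j ∈ S → b j ∈ Subgroup.closure (b '' S) := fun hj =>
    Subgroup.subset_closure ⟨_, hj, rfl⟩
  obtain ⟨g, hg⟩ := exists_isElem b (mem_others b huv) (one_mem (others b v))
  have hAz : Subgroup.closure (b '' S) ≤ others b z :=
    Subgroup.closure_mono (Set.image_mono fun j hj h => hz (h ▸ hj))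
  have hBv : Subgroup.closure (b '' Sᶜ) ≤ others b v :=
    Subgroup.closure_mono (Set.image_mono fun j hj h => hj (h ▸ hv))
  obtain ⟨l, hl⟩ := exists_isElem b (mul_mem (hAz (mem hu)) (hAz (mem hv))) (one_mem (others b z))
  have pres : ∀ {f : MulAut G}, (∀ j ∈ S, f (b j) ∈ Subgroup.closure (b '' S)) →
      ∀ x ∈ Subgroup.closure (b '' S), f x ∈ Subgroup.closure (b '' S) := by
    intro f hf x hx
    have : Subgroup.closure (b '' S) ≤ (Subgroup.closure (b '' S)).comap f.toMonoidHom := by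
      rw [Subgroup.closure_le]
      rintro - ⟨j, hj, rfl⟩
      exact hf j hj
    exact this hx
  have hgA : ∀ x ∈ Subgroup.closure (b '' S), g x ∈ Subgroup.closure (b '' S) := by
    refine pres fun j hj => ?_
    by_cases h : j = v
    · rw [h, hg.self]; exact mul_mem (mul_mem (mem hu) (mem hv)) (one_mem _)
    · rw [hg.apply h]; exact mem hj
  have hgA' : ∀ x ∈ Subgroup.closure (b '' S), g⁻¹ x ∈ Subgroup.closure (b '' S) := by
    refine pres fun j hj => ?_
    by_cases h : j = v
    · rw [h, hg.inv.self]
      exact mul_mem (mul_mem (inv_mem (mem hu)) (mem hv)) (inv_mem (one_mem _))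
    · rw [hg.inv.apply h]; exact mem hj
  set h : MulAut G := α * g * α⁻¹ * g⁻¹ with hh
  have hN : N.Normal := inferInstance
  have hhN : h ∈ N := by
    rw [hh, show α * g * α⁻¹ * g⁻¹ = α * (g * α⁻¹ * g⁻¹) by group]
    exact N.mul_mem hα (hN.conj_mem _ (N.inv_mem hα) _)
  have hhB : ∀ x ∈ Subgroup.closure (b '' Sᶜ), h x = x := by
    intro x hx
    rw [hh, MulAut.mul_apply, MulAut.mul_apply, MulAut.mul_apply, hg.inv.other x (hBv hx),
      hg.other _ (hBv (hB' x hx)), MulAut.apply_inv_self]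
  have hhA : ∀ x ∈ Subgroup.closure (b '' S), h⁻¹ x ∈ Subgroup.closure (b '' S) := by
    intro x hx
    rw [hh, show (α * g * α⁻¹ * g⁻¹)⁻¹ = g * (α * (g⁻¹ * α⁻¹)) by group]
    exact hgA _ (hA _ (hgA' _ (hA' _ hx)))
  have hhe : h (b u * b v) = b v := by
    rw [hh, MulAut.mul_apply, MulAut.mul_apply, MulAut.mul_apply,
      inv_apply_eq_of (hg.self.trans (mul_one _)), inv_apply_eq_of e, hg.apply huv, e]
  have memB : ∀ {j}, j ∉ S → b j ∈ Subgroup.closure (b '' Sᶜ) := fun hj =>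
    Subgroup.subset_closure ⟨_, hj, rfl⟩
  have huz : u ≠ z := fun h => hz (h ▸ hu)
  refine ⟨l⁻¹ * h * l * h⁻¹, ?_, isTransvection_left_inv huz.symm
    (.of_apply (inv_mem (mem_others b huz)) (one_mem _) ?_ fun j hj => ?_)⟩
  · rw [show l⁻¹ * h * l * h⁻¹ = (l⁻¹ * h * l⁻¹⁻¹) * h⁻¹ by group]
    exact N.mul_mem (hN.conj_mem _ hhN _) (N.inv_mem hhN)
  · rw [MulAut.mul_apply, MulAut.mul_apply, MulAut.mul_apply, inv_apply_eq_of (hhB _ (memB hz)),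
      hl.self, mul_one, _root_.map_mul h, hhe, hhB _ (memB hz), _root_.map_mul, hl.inv.self,
      hl.inv.other _ (hAz (mem hv))]
    group
  · by_cases hjS : j ∈ S
    · rw [MulAut.mul_apply, MulAut.mul_apply, MulAut.mul_apply,
        hl.other _ (hAz (hhA _ (mem hjS))), MulAut.apply_inv_self, hl.inv.apply hj]
    · rw [MulAut.mul_apply, MulAut.mul_apply, MulAut.mul_apply,
        inv_apply_eq_of (hhB _ (memB hjS)), hl.apply hj, hhB _ (memB hjS), hl.inv.apply hj]

theorem exists_transvection_of_stable_letter (hα : α ∈ N) {u v t : κ} (hut : u ≠ t) (hvt : v ≠ t)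
    (huv : u ≠ v) (e : α (b u) = b v) {a : G} (ha : a ∈ others b t) (ht : α (b t) = a * b t)
    (hP : ∀ x ∈ others b t, α x ∈ others b t) : ∃ g ∈ N, IsTransvection g := by
  obtain ⟨r, hr⟩ := exists_isElem b (one_mem (others b t)) (mem_others b hut)
  obtain ⟨s, hs⟩ := exists_isElem b (one_mem (others b t)) (mem_others b hvt)
  have hrs : α * r = s * α := by
    apply mulAut_ext b
    intro j
    by_cases hj : j = t
    · subst hj
      simp [hr.self, hs.self, ht, e, hs.other _ ha, mul_assoc]
    · simp [hr.apply hj, hs.other _ (hP _ (mem_others b hj))]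
  obtain ⟨f, hf⟩ := exists_isElem b (one_mem (others b v)) (inv_mem (mem_others b huv))
  have hb' : ∀ j, (b.map f) j = f (b j) := fun j => FreeGroupBasis.map_apply ..
  have hle : others (b.map f) t ≤ others b t := by
    rw [others, Subgroup.closure_le]
    rintro - ⟨j, hj, rfl⟩
    rw [hb']
    by_cases hjv : j = v
    · subst hjv
      rw [hf.self, one_mul]
      exact mul_mem (mem_others b hj) (inv_mem (mem_others b hut))
    · rw [hf.apply hjv]; exact mem_others b hj
  refine ⟨s * r⁻¹, ?_, isTransvection_right (b := b.map f) hvt.symm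
    ⟨one_mem _, mem_others _ hvt, ?_, fun x hx => ?_⟩⟩
  · have hN : N.Normal := inferInstance
    rw [show s * r⁻¹ = α * (r * α⁻¹ * r⁻¹) by
      rw [show s = α * r * α⁻¹ by rw [hrs]; group]; group]
    exact N.mul_mem hα (hN.conj_mem _ (N.inv_mem hα) _)
  · rw [hb', hb', hf.apply hvt.symm, hf.self, MulAut.mul_apply, hr.inv.self, _root_.map_mul,
      _root_.map_mul, hs.self, hs.other _ (inv_mem (one_mem _)),
      hs.other _ (inv_mem (mem_others b hut))]
    group
  · rw [MulAut.mul_apply, hr.inv.other _ (hle hx), hs.other _ (hle hx)]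

end Commutators

end Transvection

end

section

section KernelBasis

variable {E M : Type*} [Group E] [Group M]

theorem exists_basis_of_pingPong_le {ι : Type*} {F : Subgroup E} {H : ι → Subgroup E}
    {X : ι → Set E} (le : ∀ i, H i ≤ F) (one : ∀ i, 1 ∉ X i)
    (mem : ∀ i, ∀ h ∈ H i, h ≠ 1 → h ∈ X i)
    (mul : ∀ i j, i ≠ j → ∀ h ∈ H i, h ≠ 1 → ∀ x ∈ X j, h * x ∈ X i)
    (gen : ∀ K : Subgroup E, (∀ i, H i ≤ K) → F ≤ K) {κ : ι → Type*}
    (b : ∀ i, FreeGroupBasis (κ i) (H i)) :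
    ∃ B : FreeGroupBasis (Σ i, κ i) F, ∀ i k, (B ⟨i, k⟩ : E) = b i k := by
  obtain ⟨B, hB⟩ := exists_basis_of_pingPong (G := F) (H := fun i => (H i).subgroupOf F)
    (X := fun i => Subtype.val ⁻¹' X i) (fun i => one i)
    (fun i h hh h1 => mem i h hh (by simpa using h1))
    (fun i j hij h hh h1 x hx => mul i j hij h hh (by simpa using h1) x hx)
    (fun K hK => by
      have := gen (K.map F.subtype) fun i x hx => ⟨⟨x, le i hx⟩, hK i hx, rfl⟩
      rw [eq_top_iff]
      intro x _
      obtain ⟨y, hy, e⟩ := this x.2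
      rwa [← Subtype.ext e])
    (fun i => (b i).map (Subgroup.subgroupOfEquivOfLe (le i)).symm)
  refine ⟨B, fun i k => ?_⟩
  rw [hB, FreeGroupBasis.map_apply]
  rfl

/-- An element of infinite order is a basis of the cyclic group it generates. -/
noncomputable def zpowersBasis {s : E} (hs : ¬ IsOfFinOrder s) :
    FreeGroupBasis Unit (Subgroup.zpowers s) :=
  .ofRepr (MulEquiv.ofBijective
    (FreeGroup.lift fun _ : Unit => (⟨s, Subgroup.mem_zpowers s⟩ : Subgroup.zpowers s)) (by
      have hpow : ∀ w : FreeGroup Unit, ∃ z : ℤ, w = FreeGroup.of () ^ z := fun w =>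
        ⟨FreeGroup.freeGroupUnitEquivInt w, (FreeGroup.freeGroupUnitEquivInt.left_inv w).symm⟩
      constructor
      · rw [injective_iff_map_eq_one]
        intro w hw
        obtain ⟨z, rfl⟩ := hpow w
        rw [map_zpow, FreeGroup.lift_apply_of] at hw
        have hz : s ^ z = 1 := by simpa using congrArg Subtype.val hw
        by_contra hne
        apply hs
        rw [isOfFinOrder_iff_zpow_eq_one]
        exact ⟨z, fun h => hne (by rw [h, zpow_zero]), hz⟩
      · rintro ⟨-, z, rfl⟩
        exact ⟨FreeGroup.of () ^ z, by ext; simp⟩)).symm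

lemma zpowersBasis_apply {s : E} (hs : ¬ IsOfFinOrder s) : (zpowersBasis hs () : E) = s := by
  change ((FreeGroup.lift fun _ : Unit => (⟨s, Subgroup.mem_zpowers s⟩ : Subgroup.zpowers s))
    (FreeGroup.of ()) : E) = s
  rw [FreeGroup.lift_apply_of]

namespace PingPong

variable {P Q : Subgroup E} {XP XQ : Set E}

lemma notMem_right (h : PingPong P Q XP XQ) {x : E} (hx : x ∈ P) : x ∉ XQ := by
  intro hxQ
  by_cases h1 : x = 1
  · exact h.one_Q (h1 ▸ hxQ)
  · exact Set.disjoint_left.1 h.disj (h.mem_P x hx h1) hxQ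

variable {θ : E →* M} {c : M → E}

theorem exists_basis_star (h : PingPong P Q XP XQ) (hc : ∀ m, c m ∈ P)
    (hθc : ∀ m, θ (c m) = m) (hc1 : c 1 = 1) (hQ : Q ≤ θ.ker) {κ μ : Type}
    (bA : FreeGroupBasis κ ↥(P ⊓ θ.ker))
    (bQ : FreeGroupBasis μ Q) :
    ∃ B : FreeGroupBasis (κ ⊕ M × μ) θ.ker, (∀ k, (B (.inl k) : E) = bA k) ∧
      ∀ m j, (B (.inr (m, j)) : E) = c m * bQ j * (c m)⁻¹ := by
  have hk : ∀ {q}, q ∈ Q → θ q = 1 := fun hq => MonoidHom.mem_ker.1 (hQ hq)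
  obtain ⟨B, hB⟩ := exists_basis_of_pingPong_le (F := θ.ker)
    (H := fun i : Option M => i.elim (P ⊓ θ.ker) fun m => Q.map (MulAut.conj (c m)).toMonoidHom)
    (X := fun i => i.elim
      {x | ∃ a ∈ P ⊓ θ.ker, a ≠ 1 ∧ (x = a ∨ ∃ m, ∃ y ∈ XQ, x = a * c m * y)}
      fun m => {x | ∃ y ∈ XQ, x = c m * y})
    (κ := fun i => i.elim κ fun _ => μ)
    (by
      rintro (_ | m)
      · exact inf_le_right
      · rintro - ⟨q, hq, rfl⟩
        simp [hk hq])
    (by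
      rintro (_ | m)
      · rintro ⟨a, ha, ha1, (h1 | ⟨m, y, hy, h1⟩)⟩
        · exact ha1 h1.symm
        · rw [eq_comm, mul_eq_one_iff_eq_inv'] at h1
          exact h.notMem_right (h1 ▸ P.inv_mem (P.mul_mem ha.1 (hc m))) hy
      · rintro ⟨y, hy, h1⟩
        rw [eq_comm, mul_eq_one_iff_eq_inv'] at h1
        exact h.notMem_right (h1 ▸ P.inv_mem (hc m)) hy)
    (by
      rintro (_ | m)
      · intro a ha ha1
        exact ⟨a, ha, ha1, Or.inl rfl⟩
      · rintro - ⟨q, hq, rfl⟩ hne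
        have hq1 : q ≠ 1 := by rintro rfl; simp at hne
        refine ⟨q * (c m)⁻¹, ?_, by simp [mul_assoc]⟩
        by_cases h1 : c m = 1
        · simpa [h1] using h.mem_Q q hq hq1
        · exact h.mul_Q q hq hq1 _ (h.mem_P _ (P.inv_mem (hc m)) (by simpa using h1)))
    (by
      rintro (_ | m) (_ | m') hij
      · exact absurd rfl hij
      · rintro a ha ha1 - ⟨y, hy, rfl⟩
        exact ⟨a, ha, ha1, Or.inr ⟨m', y, hy, by group⟩⟩
      · rintro - ⟨q, hq, rfl⟩ hne x ⟨a, ha, ha1, hx⟩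
        have hq1 : q ≠ 1 := by rintro rfl; simp at hne
        have hca : (c m)⁻¹ * a ≠ 1 := by
          intro h1
          rw [inv_mul_eq_one] at h1
          have : m = 1 := by rw [← hθc m, h1]; exact ha.2
          rw [this, hc1] at h1
          exact ha1 h1.symm
        refine ⟨q * ((c m)⁻¹ * x), ?_, by simp [mul_assoc]⟩
        refine h.mul_Q q hq hq1 _ ?_
        rcases hx with rfl | ⟨m', y, hy, rfl⟩
        · exact h.mem_P _ (P.mul_mem (P.inv_mem (hc m)) ha.1) hca
        · rw [show (c m)⁻¹ * (a * c m' * y) = ((c m)⁻¹ * a * c m') * y by group]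
          refine h.mul_P _ (P.mul_mem (P.mul_mem (P.inv_mem (hc m)) ha.1) (hc m')) ?_ y hy
          intro h1
          have hm : m = m' := by
            have := congrArg θ h1
            rw [_root_.map_mul, _root_.map_mul, _root_.map_inv, hθc, hθc, MonoidHom.mem_ker.1 ha.2,
              mul_one, _root_.map_one, inv_mul_eq_one] at this
            exact this
          subst hm
          apply ha1
          rwa [mul_eq_one_iff_eq_inv, mul_eq_left] at h1
      · rintro - ⟨q, hq, rfl⟩ hne x ⟨y, hy, rfl⟩
        have hq1 : q ≠ 1 := by rintro rfl; simp at hne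
        refine ⟨q * ((c m)⁻¹ * c m' * y), ?_, by simp [mul_assoc]⟩
        refine h.mul_Q q hq hq1 _ (h.mul_P _ (P.mul_mem (P.inv_mem (hc m)) (hc m')) ?_ y hy)
        intro h1
        apply hij
        rw [inv_mul_eq_one] at h1
        rw [← hθc m, h1, hθc])
    (by
      intro K hK
      have hS : ∀ x : E, ∃ m, ∃ k ∈ K ⊓ θ.ker, x = k * c m := by
        intro x
        have hx : x ∈ Subgroup.closure ((P : Set E) ∪ Q) := by
          rw [Subgroup.closure_union, Subgroup.closure_eq, Subgroup.closure_eq, h.gen]; trivial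
        have step : ∀ y, (∃ m, ∃ k ∈ K ⊓ θ.ker, y = k * c m) → ∀ z ∈ (P : Set E) ∪ Q,
            ∃ m, ∃ k ∈ K ⊓ θ.ker, y * z = k * c m := by
          rintro - ⟨m, k, hk', rfl⟩ z (hz | hz)
          · refine ⟨m * θ z, k * (c m * z * (c (m * θ z))⁻¹), mul_mem hk' ?_, by group⟩
            have : c m * z * (c (m * θ z))⁻¹ ∈ P ⊓ θ.ker :=
              ⟨P.mul_mem (P.mul_mem (hc m) hz) (P.inv_mem (hc _)), by
                simp [hθc]⟩
            exact ⟨hK none this, this.2⟩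
          · refine ⟨m, k * (c m * z * (c m)⁻¹), mul_mem hk' ⟨hK (some m) ⟨z, hz, rfl⟩, ?_⟩,
              by group⟩
            simp [hk hz]
        induction hx using Subgroup.closure_induction_right with
        | one => exact ⟨1, 1, one_mem _, by rw [hc1, mul_one]⟩
        | mul_right x _ y hy ih => exact step x ih y hy
        | mul_inv_cancel x _ y hy ih =>
          refine step x ih _ ?_
          rcases hy with hy | hy
          exacts [Or.inl (P.inv_mem hy), Or.inr (Q.inv_mem hy)]
      intro x hx
      obtain ⟨m, k, hk', rfl⟩ := hS x
      have : m = 1 := by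
        have := MonoidHom.mem_ker.1 hx
        rwa [_root_.map_mul, MonoidHom.mem_ker.1 hk'.2, one_mul, hθc] at this
      rw [this, hc1, mul_one]
      exact hk'.1)
    (fun i => match i with
      | none => bA
      | some m => bQ.map (Q.equivMapOfInjective _ (MulAut.conj (c m)).injective))
  let e : (Σ i : Option M, i.elim κ fun _ => μ) ≃ κ ⊕ M × μ :=
    { toFun := fun x => match x with
        | ⟨none, k⟩ => .inl k
        | ⟨some m, j⟩ => .inr (m, j)
      invFun := fun x => match x with
        | .inl k => ⟨none, k⟩
        | .inr (m, j) => ⟨some m, j⟩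
      left_inv := by rintro ⟨_ | m, k⟩ <;> rfl
      right_inv := by rintro (k | ⟨m, j⟩) <;> rfl }
  refine ⟨B.reindex e, fun k => ?_, fun m j => ?_⟩
  · rw [FreeGroupBasis.reindex_apply]
    exact hB none k
  · rw [FreeGroupBasis.reindex_apply]
    exact hB (some m) j

lemma zpow_mem_of_swap (h : PingPong P Q XP XQ) {c d : E} (hc : c ∈ P) (hd : d ∈ Q) (hc1 : c ≠ 1)
    (hd1 : d ≠ 1) (n : ℕ) :
    ∀ x, x ∈ XP ∨ x = 1 ∨ (∃ y ∈ XQ, d⁻¹ * x = y) →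
      ∃ y ∈ XQ, (c * d⁻¹) ^ (n + 1) * x = c * y := by
  induction n with
  | zero =>
    rintro x (hx | rfl | ⟨y, hy, e⟩)
    · exact ⟨d⁻¹ * x, h.mul_Q _ (Q.inv_mem hd) (by simpa using hd1) x hx, by group⟩
    · exact ⟨d⁻¹, h.mem_Q _ (Q.inv_mem hd) (by simpa using hd1), by group⟩
    · exact ⟨y, hy, by rw [← e]; group⟩
  | succ n ih =>
    intro x hx
    obtain ⟨y, hy, e⟩ := ih x hx
    refine ⟨d⁻¹ * (c * y), h.mul_Q _ (Q.inv_mem hd) (by simpa using hd1) _ (h.mul_P c hc hc1 y hy),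
      ?_⟩
    rw [pow_succ' _ (n + 1), mul_assoc, e]; group

theorem exists_basis_theta (h : PingPong P Q XP XQ) (hc : ∀ m, c m ∈ P)
    (hθc : ∀ m, θ (c m) = m) (hc1 : c 1 = 1)
    {d : M → E} (hd : ∀ m, d m ∈ Q) (hθd : ∀ m, θ (d m) = m)
    (hd1 : d 1 = 1) {κ μ : Type} (bA : FreeGroupBasis κ ↥(P ⊓ θ.ker))
    (bB : FreeGroupBasis μ ↥(Q ⊓ θ.ker)) (tf : ∀ x ∈ θ.ker, IsOfFinOrder x → x = 1) :
    ∃ B : FreeGroupBasis (κ ⊕ μ ⊕ {m : M // m ≠ 1}) θ.ker, (∀ k, (B (.inl k) : E) = bA k) ∧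
      (∀ j, (B (.inr (.inl j)) : E) = bB j) ∧
      ∀ m, (B (.inr (.inr m)) : E) = c m * (d m)⁻¹ := by
  have hcne : ∀ {m}, m ≠ 1 → c m ≠ 1 := fun {m} hm h1 => hm (by rw [← hθc m, h1, _root_.map_one])
  have hdne : ∀ {m}, m ≠ 1 → d m ≠ 1 := fun {m} hm h1 => hm (by rw [← hθd m, h1, _root_.map_one])
  have hsk : ∀ m, c m * (d m)⁻¹ ∈ θ.ker := fun m => by simp [hθc, hθd]
  have hs1 : ∀ {m}, m ≠ 1 → c m * (d m)⁻¹ ≠ 1 := by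
    intro m hm h1
    have e : c m = d m := mul_inv_eq_one.1 h1
    exact h.notMem_right (hc m) (e ▸ h.mem_Q _ (hd m) (hdne hm))
  -- nontrivial letters of a syllable
  have syl : ∀ {R : Subgroup E} {r : M → E}, (∀ m, r m ∈ R) → (∀ m, θ (r m) = m) → r 1 = 1 →
      ∀ {a}, a ∈ R ⊓ θ.ker → a ≠ 1 → ∀ m m', (r m)⁻¹ * a * r m' ≠ 1 := by
    intro R r _ hr hr1 a ha ha1 m m' h1
    have hm : m = m' := by
      have := congrArg θ h1
      rw [_root_.map_mul, _root_.map_mul, _root_.map_inv, hr, hr, MonoidHom.mem_ker.1 ha.2,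
        mul_one, _root_.map_one, inv_mul_eq_one] at this
      exact this
    subst hm
    apply ha1
    rwa [mul_eq_one_iff_eq_inv, mul_eq_left] at h1
  have inA : ∀ {x}, (∃ a ∈ P ⊓ θ.ker, a ≠ 1 ∧ (x = a ∨ ∃ m, ∃ y ∈ XQ, x = a * c m * y)) →
      ∀ m, (c m)⁻¹ * x ∈ XP := by
    rintro x ⟨a, ha, ha1, (rfl | ⟨m', y, hy, rfl⟩)⟩ m
    · have := syl hc hθc hc1 ha ha1 m 1
      rw [hc1, mul_one] at this
      exact h.mem_P _ (P.mul_mem (P.inv_mem (hc m)) ha.1) this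
    · rw [show (c m)⁻¹ * (a * c m' * y) = ((c m)⁻¹ * a * c m') * y by group]
      exact h.mul_P _ (P.mul_mem (P.mul_mem (P.inv_mem (hc m)) ha.1) (hc m'))
        (syl hc hθc hc1 ha ha1 m m') y hy
  have inB : ∀ {x}, (∃ a ∈ Q ⊓ θ.ker, a ≠ 1 ∧ (x = a ∨ ∃ m, ∃ y ∈ XP, x = a * d m * y)) →
      ∀ m, (d m)⁻¹ * x ∈ XQ := by
    rintro x ⟨a, ha, ha1, (rfl | ⟨m', y, hy, rfl⟩)⟩ m
    · have := syl hd hθd hd1 ha ha1 m 1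
      rw [hd1, mul_one] at this
      exact h.mem_Q _ (Q.mul_mem (Q.inv_mem (hd m)) ha.1) this
    · rw [show (d m)⁻¹ * (a * d m' * y) = ((d m)⁻¹ * a * d m') * y by group]
      exact h.mul_Q _ (Q.mul_mem (Q.mul_mem (Q.inv_mem (hd m)) ha.1) (hd m'))
        (syl hd hθd hd1 ha ha1 m m') y hy
  have inA1 := fun {x} hx => (by simpa [hc1] using @inA x hx 1 : x ∈ XP)
  have inB1 := fun {x} hx => (by simpa [hd1] using @inB x hx 1 : x ∈ XQ)
  have cne : ∀ {m m'}, m ≠ m' → (c m)⁻¹ * c m' ≠ 1 := fun {m _} hm h1 =>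
    hm (by rw [inv_mul_eq_one] at h1; rw [← hθc m, h1, hθc])
  have dne : ∀ {m m'}, m ≠ m' → (d m)⁻¹ * d m' ≠ 1 := fun {m _} hm h1 =>
    hm (by rw [inv_mul_eq_one] at h1; rw [← hθd m, h1, hθd])
  -- powers of the letters `c m * (d m)⁻¹`
  have pw : ∀ {m : M} (_ : m ≠ 1) {x}, (x = 1 ∨ (x ∈ XP ∧ (c m)⁻¹ * x ∈ XP) ∨
      (x ∈ XQ ∧ (d m)⁻¹ * x ∈ XQ)) → ∀ g ∈ Subgroup.zpowers (c m * (d m)⁻¹), g ≠ 1 →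
      (∃ y ∈ XQ, g * x = c m * y) ∨ ∃ y ∈ XP, g * x = d m * y := by
    rintro m hm x hx - ⟨z, rfl⟩ hz
    have hz0 : z ≠ 0 := by rintro rfl; simp at hz
    dsimp only
    rcases lt_or_gt_of_ne hz0 with hlt | hgt
    · right
      obtain ⟨n, rfl⟩ : ∃ n : ℕ, z = -(n + 1 : ℕ) := ⟨(-z - 1).toNat, by omega⟩
      rw [_root_.zpow_neg, zpow_natCast, ← inv_pow, _root_.mul_inv_rev, inv_inv]
      refine h.symm.zpow_mem_of_swap (hd m) (hc m) (hdne hm) (hcne hm) n x ?_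
      rcases hx with hx | hx | hx
      exacts [Or.inr (Or.inl hx), Or.inr (Or.inr ⟨_, hx.2, rfl⟩), Or.inl hx.1]
    · left
      obtain ⟨n, rfl⟩ : ∃ n : ℕ, z = (n + 1 : ℕ) := ⟨(z - 1).toNat, by omega⟩
      rw [zpow_natCast]
      refine h.zpow_mem_of_swap (hc m) (hd m) (hcne hm) (hdne hm) n x ?_
      rcases hx with hx | hx | hx
      exacts [Or.inr (Or.inl hx), Or.inl hx.1, Or.inr (Or.inr ⟨_, hx.2, rfl⟩)]
  obtain ⟨B, hB⟩ := exists_basis_of_pingPong_le (F := θ.ker)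
    (H := fun i : Option (Option {m : M // m ≠ 1}) => i.elim (P ⊓ θ.ker) fun i =>
      i.elim (Q ⊓ θ.ker) fun m => Subgroup.zpowers (c m * (d m)⁻¹))
    (X := fun i => i.elim
      {x | ∃ a ∈ P ⊓ θ.ker, a ≠ 1 ∧ (x = a ∨ ∃ m, ∃ y ∈ XQ, x = a * c m * y)} fun i => i.elim
      {x | ∃ a ∈ Q ⊓ θ.ker, a ≠ 1 ∧ (x = a ∨ ∃ m, ∃ y ∈ XP, x = a * d m * y)}
      fun m => {x | (∃ y ∈ XQ, x = c m * y) ∨ ∃ y ∈ XP, x = d m * y})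
    (κ := fun i => i.elim κ fun i => i.elim μ fun _ => Unit)
    (by
      rintro (_ | _ | m)
      · exact inf_le_right
      · exact inf_le_right
      · exact (Subgroup.zpowers_le).2 (hsk m))
    (by
      rintro (_ | _ | m)
      · exact fun h1 => h.one_P (inA1 h1)
      · exact fun h1 => h.one_Q (inB1 h1)
      · rintro (⟨y, hy, h1⟩ | ⟨y, hy, h1⟩)
        · rw [eq_comm, mul_eq_one_iff_eq_inv'] at h1
          exact h.notMem_right (h1 ▸ P.inv_mem (hc m)) hy
        · rw [eq_comm, mul_eq_one_iff_eq_inv'] at h1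
          exact h.symm.notMem_right (h1 ▸ Q.inv_mem (hd m)) hy)
    (by
      rintro (_ | _ | m)
      · exact fun a ha ha1 => ⟨a, ha, ha1, Or.inl rfl⟩
      · exact fun a ha ha1 => ⟨a, ha, ha1, Or.inl rfl⟩
      · intro g hg hg1
        simpa using pw m.2 (Or.inl rfl) g hg hg1)
    (by
      rintro (_ | _ | m) (_ | _ | m') hij
      · exact absurd rfl hij
      · intro a ha ha1 x hx
        exact ⟨a, ha, ha1, Or.inr ⟨1, x, inB1 hx, by rw [hc1, mul_one]⟩⟩
      · rintro a ha ha1 x (⟨y, hy, rfl⟩ | ⟨y, hy, rfl⟩)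
        · exact ⟨a, ha, ha1, Or.inr ⟨m', y, hy, by group⟩⟩
        · exact ⟨a, ha, ha1, Or.inr ⟨1, d m' * y, h.mul_Q _ (hd m') (hdne m'.2) y hy,
            by rw [hc1, mul_one]⟩⟩
      · intro a ha ha1 x hx
        exact ⟨a, ha, ha1, Or.inr ⟨1, x, inA1 hx, by rw [hd1, mul_one]⟩⟩
      · exact absurd rfl hij
      · rintro a ha ha1 x (⟨y, hy, rfl⟩ | ⟨y, hy, rfl⟩)
        · exact ⟨a, ha, ha1, Or.inr ⟨1, c m' * y, h.mul_P _ (hc m') (hcne m'.2) y hy,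
            by rw [hd1, mul_one]⟩⟩
        · exact ⟨a, ha, ha1, Or.inr ⟨m', y, hy, by group⟩⟩
      · intro g hg hg1 x hx
        exact pw m.2 (Or.inr (Or.inl ⟨inA1 hx, inA hx m⟩)) g hg hg1
      · intro g hg hg1 x hx
        exact pw m.2 (Or.inr (Or.inr ⟨inB1 hx, inB hx m⟩)) g hg hg1
      · have hm : (m : M) ≠ m' := fun e => hij (by rw [Subtype.ext e])
        rintro g hg hg1 x (⟨y, hy, rfl⟩ | ⟨y, hy, rfl⟩)
        · refine pw m.2 (Or.inr (Or.inl ⟨h.mul_P _ (hc m') (hcne m'.2) y hy, ?_⟩)) g hg hg1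
          rw [← mul_assoc]
          exact h.mul_P _ (P.mul_mem (P.inv_mem (hc m)) (hc m')) (cne hm) y hy
        · refine pw m.2 (Or.inr (Or.inr ⟨h.mul_Q _ (hd m') (hdne m'.2) y hy, ?_⟩)) g hg hg1
          rw [← mul_assoc]
          exact h.mul_Q _ (Q.mul_mem (Q.inv_mem (hd m)) (hd m')) (dne hm) y hy)
    (by
      intro K hK
      have hsK : ∀ m, c m * (d m)⁻¹ ∈ K ⊓ θ.ker := by
        intro m
        refine ⟨?_, hsk m⟩
        by_cases hm : m = 1
        · rw [hm, hc1, hd1, one_mul, inv_one]; exact K.one_mem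
        · exact hK (some (some ⟨m, hm⟩)) (Subgroup.mem_zpowers _)
      have hS : ∀ x : E, ∃ m, ∃ k ∈ K ⊓ θ.ker, x = k * c m := by
        intro x
        have hx : x ∈ Subgroup.closure ((P : Set E) ∪ Q) := by
          rw [Subgroup.closure_union, Subgroup.closure_eq, Subgroup.closure_eq, h.gen]; trivial
        have step : ∀ y, (∃ m, ∃ k ∈ K ⊓ θ.ker, y = k * c m) → ∀ z ∈ (P : Set E) ∪ Q,
            ∃ m, ∃ k ∈ K ⊓ θ.ker, y * z = k * c m := by
          rintro - ⟨m, k, hk', rfl⟩ z (hz | hz)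
          · refine ⟨m * θ z, k * (c m * z * (c (m * θ z))⁻¹), mul_mem hk' ?_, by group⟩
            have : c m * z * (c (m * θ z))⁻¹ ∈ P ⊓ θ.ker :=
              ⟨P.mul_mem (P.mul_mem (hc m) hz) (P.inv_mem (hc _)), by simp [hθc]⟩
            exact ⟨hK none this, this.2⟩
          · have : d m * z * (d (m * θ z))⁻¹ ∈ Q ⊓ θ.ker :=
              ⟨Q.mul_mem (Q.mul_mem (hd m) hz) (Q.inv_mem (hd _)), by simp [hθd]⟩
            refine ⟨m * θ z, k * (c m * (d m)⁻¹ * (d m * z * (d (m * θ z))⁻¹) *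
              (c (m * θ z) * (d (m * θ z))⁻¹)⁻¹), mul_mem hk' (mul_mem (mul_mem (hsK m)
                ⟨hK (some none) this, this.2⟩) (inv_mem (hsK _))), by group⟩
        induction hx using Subgroup.closure_induction_right with
        | one => exact ⟨1, 1, one_mem _, by rw [hc1, mul_one]⟩
        | mul_right x _ y hy ih => exact step x ih y hy
        | mul_inv_cancel x _ y hy ih =>
          refine step x ih _ ?_
          rcases hy with hy | hy
          exacts [Or.inl (P.inv_mem hy), Or.inr (Q.inv_mem hy)]
      intro x hx
      obtain ⟨m, k, hk', rfl⟩ := hS x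
      have : m = 1 := by
        have := MonoidHom.mem_ker.1 hx
        rwa [_root_.map_mul, MonoidHom.mem_ker.1 hk'.2, one_mul, hθc] at this
      rw [this, hc1, mul_one]
      exact hk'.1)
    (fun i => match i with
      | none => bA
      | some none => bB
      | some (some m) => zpowersBasis (fun hf => hs1 m.2 (tf _ (hsk m) hf)))
  let e : (Σ i : Option (Option {m : M // m ≠ 1}), i.elim κ fun i => i.elim μ fun _ => Unit) ≃
      κ ⊕ μ ⊕ {m : M // m ≠ 1} :=
    { toFun := fun x => match x with
        | ⟨none, k⟩ => .inl k
        | ⟨some none, j⟩ => .inr (.inl j)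
        | ⟨some (some m), _⟩ => .inr (.inr m)
      invFun := fun x => match x with
        | .inl k => ⟨none, k⟩
        | .inr (.inl j) => ⟨some none, j⟩
        | .inr (.inr m) => ⟨some (some m), ()⟩
      left_inv := by rintro ⟨_ | _ | m, k⟩ <;> rfl
      right_inv := by rintro (k | j | m) <;> rfl }
  refine ⟨B.reindex e, fun k => ?_, fun j => ?_, fun m => ?_⟩
  · rw [FreeGroupBasis.reindex_apply]
    exact hB none k
  · rw [FreeGroupBasis.reindex_apply]
    exact hB (some none) j
  · rw [FreeGroupBasis.reindex_apply]
    exact (hB (some (some m)) ()).trans (zpowersBasis_apply _)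

end PingPong

end KernelBasis

end

section

section CyclicExtension

lemma exists_basis_of_le {E : Type} [Group E] {F : Subgroup E} [IsFreeGroup F] {H : Subgroup E}
    (hH : H ≤ F) : ∃ κ : Type, Nonempty (FreeGroupBasis κ H) := by
  have : IsFreeGroup H := IsFreeGroup.ofMulEquiv (Subgroup.subgroupOfEquivOfLe hH)
  exact ⟨_, ⟨IsFreeGroup.basis H⟩⟩

lemma mem_map_subtype_iff {E : Type*} [Group E] {F : Subgroup E} {O : Subgroup F} {x : F} :
    (x : E) ∈ O.map F.subtype ↔ x ∈ O := by
  simp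

variable {E : Type} [Group E] {p : ℕ} [hp : Fact p.Prime] {θ : E →* Multiplicative (ZMod p)}

lemma ofAdd_natCast_ne {i j : ℕ} (hi : i < p) (hj : j < p) (hij : i ≠ j) :
    Multiplicative.ofAdd (i : ZMod p) ≠ Multiplicative.ofAdd (j : ZMod p) := by
  intro h
  apply hij
  have h' : (i : ZMod p) = j := h
  rw [ZMod.natCast_eq_natCast_iff] at h'
  exact Nat.ModEq.eq_of_lt_of_lt h' hi hj

lemma exists_section {α : E} (hα : θ α = Multiplicative.ofAdd 1) :
    ∃ c : Multiplicative (ZMod p) → E, (∀ R : Subgroup E, α ∈ R → ∀ m, c m ∈ R) ∧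
      (∀ m, θ (c m) = m) ∧ ∀ j : ℕ, j < p → c (Multiplicative.ofAdd (j : ZMod p)) = α ^ j := by
  refine ⟨fun m => α ^ m.toAdd.val, fun R hR m => R.pow_mem hR _, fun m => ?_, fun j hj => ?_⟩
  · rw [map_pow, hα]
    apply Multiplicative.toAdd.injective
    simp
  · simp [ZMod.val_natCast_of_lt hj]

variable {P Q : Subgroup E} {XP XQ : Set E} [IsFreeGroup θ.ker] {α : E}

theorem PingPong.exists_orbit_basis (h : PingPong P Q XP XQ) (hp3 : 3 ≤ p) (hQ : Q ≤ θ.ker)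
    (hQ1 : Q ≠ ⊥) (hαP : α ∈ P) (hα : θ α = Multiplicative.ofAdd 1) :
    ∃ (κ : Type) (b : FreeGroupBasis κ θ.ker) (k₀ k₁ k₂ : κ), k₀ ≠ k₁ ∧ k₀ ≠ k₂ ∧ k₁ ≠ k₂ ∧
      MulAut.conjNormal α (b k₀) = b k₁ ∧ MulAut.conjNormal α (b k₁) = b k₂ ∧
      ∀ j ≠ k₀, MulAut.conjNormal α (b j) ∈ others b k₁ := by
  obtain ⟨c, hcR, hθc, hcpow⟩ := exists_section hα
  have hc := hcR P hαP
  obtain ⟨κ, ⟨bA⟩⟩ := exists_basis_of_le (F := θ.ker) (H := P ⊓ θ.ker) inf_le_right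
  obtain ⟨μ, ⟨bQ⟩⟩ := exists_basis_of_le (F := θ.ker) hQ
  have hc0 : c 1 = 1 := by simpa using hcpow 0 (by omega)
  obtain ⟨B, hBA, hBQ⟩ := h.exists_basis_star hc hθc hc0 hQ bA bQ
  obtain ⟨j₀⟩ : Nonempty μ := by
    by_contra hem
    rw [not_nonempty_iff] at hem
    apply hQ1
    rw [← closure_basis_subgroup bQ]
    simp
  have ne : ∀ {i j : ℕ}, i < p → j < p → i ≠ j →
      (Sum.inr (Multiplicative.ofAdd (i : ZMod p), j₀) : κ ⊕ Multiplicative (ZMod p) × μ) ≠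
        .inr (Multiplicative.ofAdd (j : ZMod p), j₀) := by
    intro i j hi hj hij e
    exact ofAdd_natCast_ne hi hj hij (congrArg Prod.fst (Sum.inr_injective e))
  have shift : ∀ {i : ℕ}, i + 1 < p →
      MulAut.conjNormal α (B (.inr (Multiplicative.ofAdd (i : ZMod p), j₀))) =
        B (.inr (Multiplicative.ofAdd ((i + 1 : ℕ) : ZMod p), j₀)) := by
    intro i hi
    apply Subtype.ext
    rw [MulAut.conjNormal_apply, hBQ, hBQ, hcpow i (by omega), hcpow (i + 1) hi, pow_succ']
    group
  refine ⟨_, B, _, _, _, ne (i := 0) (j := 1) ?_ ?_ ?_, ne (i := 0) (j := 2) ?_ ?_ ?_,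
    ne (i := 1) (j := 2) ?_ ?_ ?_, shift (i := 0) ?_, shift (i := 1) ?_, ?_⟩
  iterate 11 omega
  set O := others B (.inr (Multiplicative.ofAdd ((1 : ℕ) : ZMod p), j₀)) with hO
  have hA : P ⊓ θ.ker ≤ O.map θ.ker.subtype := by
    rw [← closure_basis_subgroup bA, Subgroup.closure_le]
    rintro - ⟨k, rfl⟩
    simp only [← hBA]
    exact mem_map_subtype_iff.2 (mem_others B (by simp))
  intro j hj
  rw [← mem_map_subtype_iff, MulAut.conjNormal_apply]
  rcases j with k | ⟨m, j⟩
  · apply hA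
    rw [hBA]
    have hk := (bA k).2
    exact ⟨P.mul_mem (P.mul_mem hαP hk.1) (P.inv_mem hαP),
      (MonoidHom.normal_ker θ).conj_mem _ hk.2 _⟩
  · have ha : α * c m * (c (Multiplicative.ofAdd 1 * m))⁻¹ ∈ O.map θ.ker.subtype := by
      apply hA
      refine ⟨P.mul_mem (P.mul_mem hαP (hc _)) (P.inv_mem (hc _)), ?_⟩
      simp [hθc, hα]
    have hb : c (Multiplicative.ofAdd 1 * m) * bQ j * (c (Multiplicative.ofAdd 1 * m))⁻¹ ∈
        O.map θ.ker.subtype := by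
      rw [← hBQ]
      refine mem_map_subtype_iff.2 (mem_others B fun e => hj ?_)
      have e' := Sum.inr_injective e
      rw [Prod.mk.injEq] at e'
      have : m = 1 := by simpa using e'.1
      rw [this, e'.2]
      simp
    have := mul_mem (mul_mem ha hb) (inv_mem ha)
    rw [hBQ]
    convert this using 1
    group

theorem PingPong.exists_theta_basis (h : PingPong P Q XP XQ) (hp3 : 3 ≤ p)
    (hαP : α ∈ P) (hα : θ α = Multiplicative.ofAdd 1) (hQ : ¬ Q ≤ θ.ker) {κ : Type}
    (bA : FreeGroupBasis κ ↥(P ⊓ θ.ker)) {μ : Type} (bB : FreeGroupBasis μ ↥(Q ⊓ θ.ker)) :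
    ∃ (b : FreeGroupBasis (κ ⊕ μ ⊕ {m : Multiplicative (ZMod p) // m ≠ 1}) θ.ker)
      (l : ℕ → {m : Multiplicative (ZMod p) // m ≠ 1}),
      (∀ i j, 1 ≤ i → i < p → 1 ≤ j → j < p → i ≠ j → l i ≠ l j) ∧
      (∀ i, 1 ≤ i → i + 1 < p → MulAut.conjNormal α (b (.inr (.inr (l i)))) =
        b (.inr (.inr (l (i + 1)))) * (b (.inr (.inr (l 1))))⁻¹) ∧
      ∀ j ≠ .inr (.inr (l 1)), MulAut.conjNormal α (b j) ∈ others b (.inr (.inr (l 2))) := by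
  obtain ⟨c, hcR, hθc, hcpow⟩ := exists_section hα
  have hc := hcR P hαP
  obtain ⟨q, hqQ, hq⟩ := Set.not_subset.1 hQ
  obtain ⟨z, hz⟩ := exists_pow_map_eq hq (Multiplicative.ofAdd 1)
  set τ := q ^ z with hτ
  have hτQ : τ ∈ Q := Q.pow_mem hqQ z
  obtain ⟨d, hdR, hθd, hdpow⟩ := exists_section hz
  have hd := hdR Q hτQ
  have hc0 : c 1 = 1 := by simpa using hcpow 0 (by omega)
  have hd0 : d 1 = 1 := by simpa using hdpow 0 (by omega)
  obtain ⟨B, hBA, hBB, hBs⟩ := h.exists_basis_theta hc hθc hc0 hd hθd hd0 bA bB (by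
    intro x hx hf
    have : IsOfFinOrder (⟨x, hx⟩ : θ.ker) := Submonoid.isOfFinOrder_coe.1 hf
    have := (MonoidHom.isOfFinOrder (IsFreeGroup.basis θ.ker).repr.toMonoidHom this).eq_one'
    have h1 : (⟨x, hx⟩ : θ.ker) = 1 := by simpa using this
    exact congrArg Subtype.val h1)
  let l : ℕ → {m : Multiplicative (ZMod p) // m ≠ 1} := fun i =>
    if hi : 1 ≤ i ∧ i < p then ⟨Multiplicative.ofAdd (i : ZMod p), by
      simpa using ofAdd_natCast_ne hi.2 (by omega) (show i ≠ 0 by omega)⟩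
    else ⟨Multiplicative.ofAdd ((1 : ℕ) : ZMod p), by
      simp⟩
  have hl : ∀ i, 1 ≤ i → i < p → (l i : Multiplicative (ZMod p)) =
      Multiplicative.ofAdd (i : ZMod p) := by
    intro i h1 h2
    simp only [l, dif_pos (And.intro h1 h2)]
  have hBl : ∀ i, 1 ≤ i → i < p → (B (.inr (.inr (l i))) : E) = α ^ i * (τ ^ i)⁻¹ := by
    intro i h1 h2
    rw [hBs, hl i h1 h2, hcpow i h2, hdpow i h2]
  have hl12 : l 1 ≠ l 2 := by
    intro e
    have := congrArg Subtype.val e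
    rw [hl 1 le_rfl (by omega), hl 2 (by omega) (by omega)] at this
    exact ofAdd_natCast_ne (by omega) (by omega) (by omega) this
  refine ⟨B, l, fun i j hi hi' hj hj' hij e => ?_, fun i hi hi' => ?_, ?_⟩
  · have := congrArg Subtype.val e
    rw [hl i hi hi', hl j hj hj'] at this
    exact ofAdd_natCast_ne hi' hj' hij this
  · apply Subtype.ext
    rw [MulAut.conjNormal_apply, Subgroup.coe_mul, Subgroup.coe_inv, hBl i hi (by omega),
      hBl (i + 1) (by omega) hi', hBl 1 le_rfl (by omega), pow_succ' α, pow_succ' τ]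
    group
  set O := others B (.inr (.inr (l 2))) with hO
  have hA : P ⊓ θ.ker ≤ O.map θ.ker.subtype := by
    rw [← closure_basis_subgroup bA, Subgroup.closure_le]
    rintro - ⟨k, rfl⟩
    simp only [← hBA]
    exact mem_map_subtype_iff.2 (mem_others B (by simp))
  have hB : Q ⊓ θ.ker ≤ O.map θ.ker.subtype := by
    rw [← closure_basis_subgroup bB, Subgroup.closure_le]
    rintro - ⟨k, rfl⟩
    simp only [← hBB]
    exact mem_map_subtype_iff.2 (mem_others B (by simp))
  have hs : ∀ m : Multiplicative (ZMod p), m ≠ l 2 → c m * (d m)⁻¹ ∈ O.map θ.ker.subtype := by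
    intro m hm
    by_cases h1 : m = 1
    · rw [h1, hc0, hd0, inv_one, one_mul]; exact one_mem _
    · rw [← hBs ⟨m, h1⟩]
      refine mem_map_subtype_iff.2 (mem_others B fun e => hm ?_)
      exact congrArg Subtype.val (Sum.inr_injective (Sum.inr_injective e))
  have hg : α * τ⁻¹ ∈ O.map θ.ker.subtype := by
    have := hs (l 1) (fun e => hl12 (Subtype.ext e))
    rw [hl 1 le_rfl (by omega), hcpow 1 (by omega), hdpow 1 (by omega), pow_one, pow_one] at this
    exact this
  intro j hj
  rw [← mem_map_subtype_iff, MulAut.conjNormal_apply]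
  rcases j with k | k | m
  · apply hA
    rw [hBA]
    have hk := (bA k).2
    exact ⟨P.mul_mem (P.mul_mem hαP hk.1) (P.inv_mem hαP),
      (MonoidHom.normal_ker θ).conj_mem _ hk.2 _⟩
  · have hk := (bB k).2
    have : τ * bB k * τ⁻¹ ∈ O.map θ.ker.subtype :=
      hB ⟨Q.mul_mem (Q.mul_mem hτQ hk.1) (Q.inv_mem hτQ),
        (MonoidHom.normal_ker θ).conj_mem _ hk.2 _⟩
    have := mul_mem (mul_mem hg this) (inv_mem hg)
    rw [hBB]
    convert this using 1
    group
  · obtain ⟨m, hm1⟩ := m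
    have ha : α * c m * (c (Multiplicative.ofAdd 1 * m))⁻¹ ∈ O.map θ.ker.subtype := by
      apply hA
      refine ⟨P.mul_mem (P.mul_mem hαP (hc _)) (P.inv_mem (hc _)), ?_⟩
      simp [hθc, hα]
    have hb : τ * d m * (d (Multiplicative.ofAdd 1 * m))⁻¹ ∈ O.map θ.ker.subtype := by
      apply hB
      refine ⟨Q.mul_mem (Q.mul_mem hτQ (hd _)) (Q.inv_mem (hd _)), ?_⟩
      simp [hθd, hz]
    have hm := hs (Multiplicative.ofAdd 1 * m) (by
      intro e
      apply hj
      rw [hl 2 (by omega) (by omega)] at e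
      have : m = l 1 := by
        rw [hl 1 le_rfl (by omega)]
        apply Multiplicative.toAdd.injective
        have e' := congrArg Multiplicative.toAdd e
        simp only [toAdd_mul, toAdd_ofAdd, Nat.cast_ofNat, Nat.cast_one] at e' ⊢
        linear_combination e'
      rw [Sum.inr.injEq, Sum.inr.injEq]
      exact Subtype.ext this)
    have := mul_mem (mul_mem (mul_mem ha hm) (inv_mem hb)) (inv_mem hg)
    rw [hBs]
    convert this using 1
    group

end CyclicExtension

end

section

section Moves

variable {G : Type} [Group G]

/-- Some basis has an element which is mapped to another element of this basis. -/
def Moves (γ : MulAut G) : Prop :=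
  ∃ (κ : Type) (b : FreeGroupBasis κ G) (k l : κ), k ≠ l ∧ γ (b k) = b l

lemma Moves.transport {G' : Type} [Group G'] (e : G ≃* G') {γ : MulAut G} {γ' : MulAut G'}
    (h : Moves γ) (he : ∀ x, γ' (e x) = e (γ x)) : Moves γ' := by
  obtain ⟨κ, b, k, l, hkl, hm⟩ := h
  refine ⟨κ, b.map e, k, l, hkl, ?_⟩
  rw [FreeGroupBasis.map_apply, FreeGroupBasis.map_apply, he, hm]

lemma inv_mem_of_pow {γ : MulAut G} {p : ℕ} (hp : p ≠ 0) (hγ : γ ^ p = 1) {P : Subgroup G}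
    (hP : ∀ x ∈ P, γ x ∈ P) : ∀ x ∈ P, γ⁻¹ x ∈ P := by
  have : γ⁻¹ = γ ^ (p - 1) := by
    rw [inv_eq_iff_mul_eq_one, ← pow_succ', Nat.sub_add_cancel (Nat.one_le_iff_ne_zero.2 hp), hγ]
  rw [this]
  have : ∀ n : ℕ, ∀ x ∈ P, (γ ^ n) x ∈ P := by
    intro n
    induction n with
    | zero => simp
    | succ n ih =>
      intro x hx
      rw [pow_succ, MulAut.mul_apply]
      exact ih _ (hP x hx)
  exact this _

/-- The restriction of an automorphism to an invariant subgroup. -/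
def restrictAut (γ : MulAut G) (P : Subgroup G) (h : ∀ x ∈ P, γ x ∈ P)
    (h' : ∀ x ∈ P, γ⁻¹ x ∈ P) : MulAut P where
  toFun x := ⟨γ x, h x x.2⟩
  invFun x := ⟨γ⁻¹ x, h' x x.2⟩
  left_inv x := Subtype.ext (MulAut.inv_apply_self _ γ x)
  right_inv x := Subtype.ext (MulAut.apply_inv_self _ γ x)
  map_mul' x y := Subtype.ext (_root_.map_mul γ (x : G) y)

lemma restrictAut_pow {γ : MulAut G} {P : Subgroup G} {h : ∀ x ∈ P, γ x ∈ P}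
    {h' : ∀ x ∈ P, γ⁻¹ x ∈ P} {p : ℕ} (hγ : γ ^ p = 1) : restrictAut γ P h h' ^ p = 1 := by
  have : ∀ n : ℕ, ∀ x : P, (((restrictAut γ P h h') ^ n) x : G) = (γ ^ n) x := by
    intro n
    induction n with
    | zero => intro x; rfl
    | succ n ih =>
      intro x
      rw [pow_succ, pow_succ, MulAut.mul_apply, MulAut.mul_apply, ih]
      rfl
  ext x
  rw [this, hγ]
  rfl

lemma exists_basis_subgroup [IsFreeGroup G] (P : Subgroup G) :
    ∃ κ : Type, Nonempty (FreeGroupBasis κ P) := by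
  have : IsFreeGroup P := inferInstance
  exact ⟨_, ⟨IsFreeGroup.basis P⟩⟩

variable {P Q : Subgroup G} {XP XQ : Set G}

lemma nonempty_of_basis_ne_bot {μ : Type} (b : FreeGroupBasis μ Q) (hQ : Q ≠ ⊥) : Nonempty μ := by
  by_contra hem
  rw [not_nonempty_iff] at hem
  apply hQ
  rw [← closure_basis_subgroup b]
  simp

theorem Moves.of_restrict [IsFreeGroup G] (h : PingPong P Q XP XQ) {γ : MulAut G}
    {hP : ∀ x ∈ P, γ x ∈ P} {hP' : ∀ x ∈ P, γ⁻¹ x ∈ P} (hm : Moves (restrictAut γ P hP hP')) :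
    Moves γ := by
  obtain ⟨κ, b, k, l, hkl, hm⟩ := hm
  obtain ⟨μ, ⟨c⟩⟩ := exists_basis_subgroup Q
  obtain ⟨B, hb, -⟩ := h.exists_basis b c
  refine ⟨_, B, .inl k, .inl l, by simpa using hkl, ?_⟩
  rw [hb, hb, ← hm]
  rfl

lemma PingPong.exists_basis_lt [IsFreeGroup G] (h : PingPong P Q XP XQ) (hQ : Q ≠ ⊥) {r : ℕ}
    (b : FreeGroupBasis (Fin r) G) : ∃ s < r, Nonempty (FreeGroupBasis (Fin s) P) := by
  obtain ⟨κ, ⟨c⟩⟩ := exists_basis_subgroup P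
  obtain ⟨μ, ⟨d⟩⟩ := exists_basis_subgroup Q
  obtain ⟨B, -, -⟩ := h.exists_basis c d
  have e : κ ⊕ μ ≃ Fin r := Equiv.ofFreeGroupEquiv (B.repr.symm.trans b.repr)
  have hfin : Finite (κ ⊕ μ) := Finite.of_equiv _ e.symm
  have : Finite κ := Finite.of_injective _ (Sum.inl_injective (α := κ) (β := μ))
  have : Finite μ := Finite.of_injective _ (Sum.inr_injective (α := κ) (β := μ))
  have hne : Nonempty μ := nonempty_of_basis_ne_bot d hQ
  have hcard := Nat.card_congr e
  rw [Nat.card_sum, Nat.card_fin] at hcard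
  refine ⟨Nat.card κ, ?_, ⟨c.reindex (Finite.equivFin κ)⟩⟩
  have : 0 < Nat.card μ := Nat.card_pos
  omega

lemma not_commute_basis {κ : Type} (b : FreeGroupBasis κ G) {k l : κ} (hkl : k ≠ l) :
    b k * b l ≠ b l * b k := by
  classical
  intro h
  let f : G →* Equiv.Perm (Fin 3) :=
    b.lift fun j => if j = k then Equiv.swap 0 1 else Equiv.swap 1 2
  have hk : f (b k) = Equiv.swap 0 1 := by simp [f]
  have hl : f (b l) = Equiv.swap 1 2 := by simp [f, hkl.symm]
  have := congrArg f h
  rw [_root_.map_mul, _root_.map_mul, hk, hl] at this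
  exact absurd this (by decide)

lemma eq_one_of_isOfFinOrder [IsFreeGroup G] {x : G} (hx : IsOfFinOrder x) : x = 1 := by
  simpa using (MonoidHom.isOfFinOrder (IsFreeGroup.basis G).repr.toMonoidHom hx).eq_one'

lemma eq_one_of_pow_eq_one [IsFreeGroup G] {x : G} {p : ℕ} (hp : p ≠ 0) (hx : x ^ p = 1) : x = 1 :=
  eq_one_of_isOfFinOrder (isOfFinOrder_iff_pow_eq_one.2 ⟨p, Nat.pos_of_ne_zero hp, hx⟩)

lemma eq_one_of_rank_le_one {r : ℕ} (hr : r ≤ 1) (b : FreeGroupBasis (Fin r) G) {γ : MulAut G}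
    {p : ℕ} (hodd : Odd p) (hγ : γ ^ p = 1) : γ = 1 := by
  have hfree : IsFreeGroup G := b.isFreeGroup
  apply mulAut_ext b
  intro k
  have hk : ∀ j, j = k := by intro j; apply Fin.ext; omega
  have hz : Subgroup.zpowers (b k) = ⊤ := by
    rw [← closure_range_basis b, Subgroup.zpowers_eq_closure]
    congr 1
    ext x
    simp only [Set.mem_singleton_iff, Set.mem_range]
    constructor
    · rintro rfl; exact ⟨k, rfl⟩
    · rintro ⟨j, rfl⟩; rw [hk j]
  obtain ⟨z, hz⟩ : γ (b k) ∈ Subgroup.zpowers (b k) := hz ▸ Subgroup.mem_top _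
  dsimp only at hz
  have hpow : ∀ n : ℕ, (γ ^ n) (b k) = b k ^ (z ^ n) := by
    intro n
    induction n with
    | zero => simp
    | succ n ih => rw [pow_succ, MulAut.mul_apply, ← hz, map_zpow, ih, ← _root_.zpow_mul, pow_succ]
  have h1 := hpow p
  rw [hγ, MulAut.one_apply] at h1
  have hb : b k ≠ 1 := by
    intro h
    have := congrArg b.repr h
    rw [_root_.map_one, FreeGroupBasis.repr_apply_coe] at this
    exact FreeGroup.of_ne_one k this
  have hz1 : z ^ p = 1 := by
    by_contra hne
    apply hb
    apply eq_one_of_isOfFinOrder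
    rw [isOfFinOrder_iff_zpow_eq_one]
    refine ⟨z ^ p - 1, sub_ne_zero.2 hne, ?_⟩
    rw [_root_.zpow_sub_one, ← h1, mul_inv_cancel]
  have : z = 1 := by
    have h2 : z ^ p = 1 ^ p := by rw [hz1, one_pow]
    exact hodd.pow_injective h2
  rw [← hz, this, zpow_one, MulAut.one_apply]

end Moves

section Extension

variable {E : Type} [Group E] {p : ℕ} [hp : Fact p.Prime] {θ : E →* Multiplicative (ZMod p)}

lemma Moves.of_conj {a g : E} (h : Moves (MulAut.conjNormal (g * a * g⁻¹) : MulAut θ.ker)) :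
    Moves (MulAut.conjNormal a : MulAut θ.ker) := by
  refine h.transport (MulAut.conjNormal g⁻¹ : MulAut θ.ker) fun x => ?_
  rw [← MulAut.mul_apply, ← MulAut.mul_apply, ← _root_.map_mul, ← _root_.map_mul]
  congr 2
  group

variable [IsFreeGroup θ.ker]

/-- `x * α` moves a basis, unless it acts trivially on an invariant free factor containing `x`. -/
lemma moves_or_trivial {r : ℕ} (b : FreeGroupBasis (Fin r) θ.ker)
    (ih : ∀ s < r, ∀ {G : Type} [Group G], FreeGroupBasis (Fin s) G → ∀ γ : MulAut G,
      γ ^ p = 1 → γ ≠ 1 → Moves γ)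
    {α : E} (hα : α ^ p = 1) {P Q : Subgroup θ.ker} {XP XQ : Set θ.ker} (h : PingPong P Q XP XQ)
    (hQ : Q ≠ ⊥) (hP : ∀ g ∈ P, MulAut.conjNormal α g ∈ P) {x : θ.ker} (hx : x ∈ P)
    (hxα : (x * α) ^ p = 1) :
    Moves (MulAut.conjNormal (x * α) : MulAut θ.ker) ∨
      x = 1 ∧ ∀ g ∈ P, MulAut.conjNormal α g = g := by
  have hP' : ∀ g ∈ P, MulAut.conjNormal ((x : E) * α) g ∈ P := by
    intro g hg
    have : MulAut.conjNormal ((x : E) * α) g = x * MulAut.conjNormal α g * x⁻¹ := by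
      apply Subtype.ext
      simp [MulAut.conjNormal_apply, mul_assoc]
    rw [this]
    exact P.mul_mem (P.mul_mem hx (hP g hg)) (P.inv_mem hx)
  have hpow : (MulAut.conjNormal ((x : E) * α) : MulAut θ.ker) ^ p = 1 := by
    rw [← map_pow, hxα, _root_.map_one]
  have hP'' := inv_mem_of_pow hp.out.ne_zero hpow hP'
  by_cases htriv : restrictAut _ P hP' hP'' = 1
  · right
    have hfix : ∀ g ∈ P, (x : E) * α * g * ((x : E) * α)⁻¹ = g := by
      intro g hg
      have := congrArg (fun f : MulAut P => ((f ⟨g, hg⟩ : θ.ker) : E)) htriv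
      exact this
    have hcomm : Commute (x : E) α := by
      have := hfix x hx
      rw [mul_inv_eq_iff_eq_mul] at this
      have h2 : (x : E) * (α * x) = x * (x * α) := by rw [← mul_assoc]; exact this
      exact (mul_left_cancel h2).symm
    rw [hcomm.mul_pow, hα, mul_one] at hxα
    have hx1 : x = 1 := eq_one_of_pow_eq_one hp.out.ne_zero (Subtype.ext hxα)
    refine ⟨hx1, fun g hg => Subtype.ext ?_⟩
    have := hfix g hg
    rw [hx1] at this
    simpa [MulAut.conjNormal_apply] using this
  · left
    obtain ⟨s, hs, ⟨c⟩⟩ := h.exists_basis_lt hQ b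
    exact Moves.of_restrict h (ih s hs c _ (restrictAut_pow hpow) htriv)

lemma eq_one_of_factors {G : Type} [Group G] {γ : MulAut G} {P Q : Subgroup G}
    {XP XQ : Set G} (h : PingPong P Q XP XQ) (hP : ∀ g ∈ P, γ g = g) (hQ : ∀ g ∈ Q, γ g = g) :
    γ = 1 := by
  ext g
  have hg : g ∈ Subgroup.closure ((P : Set G) ∪ Q) := by
    rw [Subgroup.closure_union, Subgroup.closure_eq, Subgroup.closure_eq, h.gen]; trivial
  exact fixes_closure (g := γ) (by rintro x (hx | hx); exacts [hP x hx, hQ x hx]) g hg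

lemma eq_one_of_stable_letter {G : Type} [Group G] [IsFreeGroup G] {γ : MulAut G}
    (hγ : γ ^ p = 1) {P Q : Subgroup G} {XP XQ : Set G} (h : PingPong P Q XP XQ)
    (hP : ∀ g ∈ P, γ g = g) {t : G} (hQ : Q = Subgroup.zpowers t) (ht : γ t * t⁻¹ ∈ P) :
    γ = 1 := by
  set c := γ t * t⁻¹ with hc
  have hpow : ∀ n : ℕ, (γ ^ n) t = c ^ n * t := by
    intro n
    induction n with
    | zero => simp
    | succ n ih =>
      rw [pow_succ', MulAut.mul_apply, ih, _root_.map_mul, map_pow, hP c ht, pow_succ, hc]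
      group
  have h1 := hpow p
  rw [hγ, MulAut.one_apply, right_eq_mul] at h1
  have hc1 := eq_one_of_pow_eq_one hp.out.ne_zero h1
  have htt : γ t = t := mul_inv_eq_one.1 (hc.symm.trans hc1)
  refine eq_one_of_factors h hP fun g hg => ?_
  rw [hQ] at hg
  obtain ⟨z, rfl⟩ := hg
  dsimp only
  rw [map_zpow, htt]

theorem moves_of_lt {r : ℕ} (hodd : Odd p) (hθ : Function.Surjective θ)
    (b : FreeGroupBasis (Fin r) θ.ker)
    (ih : ∀ s < r, ∀ {G : Type} [Group G], FreeGroupBasis (Fin s) G → ∀ γ : MulAut G,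
      γ ^ p = 1 → γ ≠ 1 → Moves γ)
    {a : E} (hθa : θ a = Multiplicative.ofAdd 1) (hap : a ^ p = 1)
    (ha : (MulAut.conjNormal a : MulAut θ.ker) ≠ 1) :
    Moves (MulAut.conjNormal a : MulAut θ.ker) := by
  have hp3 : 3 ≤ p := by
    have := hp.out.two_le
    rcases hodd with ⟨m, rfl⟩
    omega
  have hr : 2 ≤ r := by
    by_contra hr
    exact ha (eq_one_of_rank_le_one (by omega) b hodd (by rw [← map_pow, hap, _root_.map_one]))
  have hcomm : ∃ x y : θ.ker, x * y ≠ y * x :=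
    ⟨_, _, not_commute_basis b (k := ⟨0, by omega⟩) (l := ⟨1, by omega⟩) (by simp)⟩
  have hθg : ∀ g : E, θ (g * a * g⁻¹) = Multiplicative.ofAdd 1 := by
    intro g
    rw [_root_.map_mul, _root_.map_mul, _root_.map_inv, hθa, mul_comm (θ g), mul_inv_cancel_right]
  have hne : ∀ g : E, (MulAut.conjNormal (g * a * g⁻¹) : MulAut θ.ker) ≠ 1 := by
    intro g h1
    apply ha
    rw [_root_.map_mul, _root_.map_mul, _root_.map_inv, mul_inv_eq_one] at h1
    exact mul_eq_left.1 h1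
  rcases splitting_dichotomy hodd hθ b hcomm with
    ⟨α, hθα, hα, P, Q, XP, XQ, h, hP, hI⟩ | ⟨P, Q, XP, XQ, h, hPk, hQ1, hII⟩
  · rcases hI with ⟨hP1, hQ1, hQ, hall⟩ | ⟨⟨t, hQt, ht1, htP⟩, hall⟩
    · obtain ⟨g, x, hx, e⟩ := hall a hθa hap
      refine Moves.of_conj (g := g) ?_
      have hpe : ((x : E) * α) ^ p = 1 := by rw [← e, conj_pow, hap]; group
      have hg := hne g
      rw [e] at hg ⊢
      have key : ∀ {P Q : Subgroup θ.ker} {XP XQ : Set θ.ker}, PingPong P Q XP XQ → P ≠ ⊥ →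
          Q ≠ ⊥ → (∀ g ∈ P, MulAut.conjNormal α g ∈ P) → (∀ g ∈ Q, MulAut.conjNormal α g ∈ Q) →
          x ∈ P → Moves (MulAut.conjNormal (x * α) : MulAut θ.ker) := by
        intro P Q XP XQ h hP1 hQ1 hP hQ hx
        by_contra hm
        obtain ⟨hx1, htr⟩ := (moves_or_trivial b ih hα h hQ1 hP hx hpe).resolve_left hm
        obtain ⟨-, htr'⟩ := (moves_or_trivial b ih hα h.symm hP1 hQ (hx1 ▸ one_mem Q)
          hpe).resolve_left hm
        apply hg
        rw [hx1, Subgroup.coe_one, one_mul]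
        exact eq_one_of_factors h htr htr'
      rcases hx with hx | hx
      · exact key h hP1 hQ1 hP hQ hx
      · exact key h.symm hQ1 hP1 hQ hP hx
    · obtain ⟨g, x, hx, e⟩ := hall a hθa hap
      refine Moves.of_conj (g := g) ?_
      have hpe : ((x : E) * α) ^ p = 1 := by rw [← e, conj_pow, hap]; group
      have hg := hne g
      rw [e] at hg ⊢
      refine (moves_or_trivial b ih hα h ?_ hP hx hpe).resolve_right ?_
      · rwa [hQt, Ne, Subgroup.zpowers_eq_bot]
      rintro ⟨hx1, htr⟩
      apply hg
      rw [hx1, Subgroup.coe_one, one_mul]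
      exact eq_one_of_stable_letter (p := p) (by rw [← map_pow, hα, _root_.map_one]) h htr hQt htP
  · rcases hII with ⟨hQk, hall⟩ | ⟨hQk, hall⟩
    · obtain ⟨g, hg⟩ := hall a hap
      obtain ⟨κ, c, k₀, k₁, k₂, h01, -, -, e, -, -⟩ :=
        h.exists_orbit_basis hp3 hQk hQ1 hg (hθg g)
      exact Moves.of_conj (g := g) ⟨κ, c, k₀, k₁, h01, e⟩
    · obtain ⟨g, hg⟩ := hall a hap
      have key : ∀ {P Q : Subgroup E} {XP XQ : Set E}, PingPong P Q XP XQ → ¬ Q ≤ θ.ker →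
          g * a * g⁻¹ ∈ P → Moves (MulAut.conjNormal a : MulAut θ.ker) := by
        intro P Q XP XQ h hQk hg
        obtain ⟨κ, ⟨bA⟩⟩ := exists_basis_of_le (F := θ.ker) (H := P ⊓ θ.ker) inf_le_right
        obtain ⟨μ, ⟨bB⟩⟩ := exists_basis_of_le (F := θ.ker) (H := Q ⊓ θ.ker) inf_le_right
        obtain ⟨c, l, hl, hs, -⟩ := h.exists_theta_basis hp3 hg (hθg g) hQk bA bB
        refine Moves.of_conj (g := g) ?_
        have h12 : (Sum.inr (Sum.inr (l 1)) : κ ⊕ μ ⊕ _) ≠ .inr (.inr (l 2)) := by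
          simpa using hl 1 2 le_rfl (by omega) (by omega) (by omega) (by omega)
        obtain ⟨f, hf⟩ := exists_isElem c (one_mem (others c (.inr (.inr (l 2)))))
          (inv_mem (mem_others c h12))
        refine ⟨_, c.map f, .inr (.inr (l 1)), .inr (.inr (l 2)), h12, ?_⟩
        rw [FreeGroupBasis.map_apply, FreeGroupBasis.map_apply]
        change MulAut.conjNormal (g * a * g⁻¹) (f _) = f _
        rw [hf.apply h12, hf.self, one_mul, hs 1 le_rfl (by omega)]
      rcases hg with hg | hg
      · exact key h hQk hg
      · exact key h.symm hPk hg

theorem moves_of_pow_eq_one (hodd : Odd p) (r : ℕ) : ∀ {G : Type} [Group G],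
    FreeGroupBasis (Fin r) G → ∀ γ : MulAut G, γ ^ p = 1 → γ ≠ 1 → Moves γ := by
  induction r using Nat.strong_induction_on with
  | _ r ih =>
  intro G _ b γ hγ hne
  obtain ⟨φ, hφ⟩ : ∃ φ : Multiplicative (ZMod p) →* MulAut G, φ (Multiplicative.ofAdd 1) = γ := by
    let f : ZMod p →+ Additive (MulAut G) :=
      ZMod.lift p ⟨zmultiplesHom _ (Additive.ofMul γ), by
        rw [zmultiplesHom_apply, natCast_zsmul, ← ofMul_pow, hγ, ofMul_one]⟩
    refine ⟨AddMonoidHom.toMultiplicativeLeft f, ?_⟩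
    change Additive.toMul (f 1) = γ
    have : f ((1 : ℤ) : ZMod p) = (1 : ℤ) • Additive.ofMul γ := by
      rw [ZMod.lift_coe]; rfl
    rw [Int.cast_one, one_zsmul] at this
    rw [this]; rfl
  let θ : G ⋊[φ] Multiplicative (ZMod p) →* Multiplicative (ZMod p) := SemidirectProduct.rightHom
  let i : G →* θ.ker := SemidirectProduct.inl.codRestrict θ.ker fun g => by
    simp [θ, MonoidHom.mem_ker]
  have hi : Function.Bijective i := by
    constructor
    · intro x y hxy
      exact SemidirectProduct.inl_injective (congrArg Subtype.val hxy)
    · rintro ⟨x, hx⟩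
      rw [← SemidirectProduct.range_inl_eq_ker_rightHom] at hx
      obtain ⟨g, rfl⟩ := hx
      exact ⟨g, rfl⟩
  let e : G ≃* θ.ker := MulEquiv.ofBijective i hi
  have hfree : IsFreeGroup θ.ker := (b.map e).isFreeGroup
  set a : G ⋊[φ] Multiplicative (ZMod p) := SemidirectProduct.inr (Multiplicative.ofAdd 1) with ha
  have hconj : ∀ g, MulAut.conjNormal a (e g) = e (γ g) := by
    intro g
    apply Subtype.ext
    rw [MulAut.conjNormal_apply]
    have := SemidirectProduct.inl_aut (φ := φ) (Multiplicative.ofAdd 1) g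
    rw [hφ] at this
    rw [ha, ← _root_.map_inv]
    exact this.symm
  have hm : Moves (MulAut.conjNormal a : MulAut θ.ker) := by
    refine moves_of_lt hodd SemidirectProduct.rightHom_surjective (b.map e) ih rfl ?_ fun h1 => ?_
    · rw [ha, ← map_pow, ← ofAdd_nsmul, nsmul_one, CharP.cast_eq_zero, ofAdd_zero, _root_.map_one]
    · apply hne
      ext g
      apply e.injective
      rw [← hconj, h1]
      rfl
  refine hm.transport e.symm fun x => ?_
  obtain ⟨g, rfl⟩ := e.surjective x
  rw [hconj]
  simp

end Extension

end

section

section Extension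

variable {G : Type} [Group G] [IsFreeGroup G] {p : ℕ} [hp : Fact p.Prime]
  {P Q : Subgroup G} {XP XQ : Set G} {N : Subgroup (MulAut G)} [N.Normal]

theorem PingPong.exists_transvection_of_factors (hodd : Odd p) (h : PingPong P Q XP XQ)
    {r : ℕ} (b : FreeGroupBasis (Fin r) G) {γ : MulAut G} (hγN : γ ∈ N) (hγ : γ ^ p = 1)
    (hP : ∀ g ∈ P, γ g ∈ P) (hQ : ∀ g ∈ Q, γ g ∈ Q) (hQ1 : Q ≠ ⊥)
    (hne : ¬ ∀ g ∈ P, γ g = g) : ∃ g ∈ N, IsTransvection g := by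
  have hP' := inv_mem_of_pow hp.out.ne_zero hγ hP
  have hQ' := inv_mem_of_pow hp.out.ne_zero hγ hQ
  obtain ⟨s, -, ⟨c₀⟩⟩ := h.exists_basis_lt hQ1 b
  obtain ⟨κ, c, u, v, huv, e⟩ := moves_of_pow_eq_one hodd s c₀ (restrictAut γ P hP hP')
    (restrictAut_pow hγ) fun h1 => hne fun g hg =>
      congrArg (fun f : MulAut P => ((f ⟨g, hg⟩ : P) : G)) h1
  obtain ⟨μ, ⟨d⟩⟩ := exists_basis_subgroup Q
  obtain ⟨z⟩ := nonempty_of_basis_ne_bot d hQ1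
  obtain ⟨B, hBc, hBd⟩ := h.exists_basis c d
  have hcP : Subgroup.closure (B '' Set.range Sum.inl) = P := by
    rw [← closure_basis_subgroup c, ← Set.range_comp]
    congr 2
    exact funext hBc
  have hdQ : Subgroup.closure (B '' (Set.range Sum.inl)ᶜ) = Q := by
    rw [← closure_basis_subgroup d, Set.compl_range_inl, ← Set.range_comp]
    congr 2
    exact funext hBd
  refine NormalClosurePaper.exists_transvection_of_factors (b := B) (S := Set.range Sum.inl)
    (z := Sum.inr z) hγN ⟨u, rfl⟩ ⟨v, rfl⟩ (by simp) (by simpa using huv) ?_ ?_ ?_ ?_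
  · rw [hBc, hBc, ← e]
    rfl
  · rwa [hcP]
  · rwa [hcP]
  · rwa [hdQ]

theorem PingPong.exists_transvection_of_stable_letter (hodd : Odd p) (h : PingPong P Q XP XQ)
    {r : ℕ} (b : FreeGroupBasis (Fin r) G) {γ : MulAut G} (hγN : γ ∈ N) (hγ : γ ^ p = 1)
    (hP : ∀ g ∈ P, γ g ∈ P) {t : G} (hQt : Q = Subgroup.zpowers t) (ht1 : t ≠ 1)
    (htP : γ t * t⁻¹ ∈ P) (hne : ¬ ∀ g ∈ P, γ g = g) : ∃ g ∈ N, IsTransvection g := by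
  have hP' := inv_mem_of_pow hp.out.ne_zero hγ hP
  subst hQt
  obtain ⟨s, -, ⟨c₀⟩⟩ := h.exists_basis_lt (by simpa using ht1) b
  obtain ⟨κ, c, u, v, huv, e⟩ := moves_of_pow_eq_one hodd s c₀ (restrictAut γ P hP hP')
    (restrictAut_pow hγ) fun h1 => hne fun g hg =>
      congrArg (fun f : MulAut P => ((f ⟨g, hg⟩ : P) : G)) h1
  have htf : ¬ IsOfFinOrder t := fun hf => ht1 (eq_one_of_isOfFinOrder hf)
  obtain ⟨B, hBc, hBd⟩ := h.exists_basis c (zpowersBasis htf)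
  have hBt : B (.inr ()) = t := (hBd ()).trans (zpowersBasis_apply htf)
  have hcP : others B (.inr ()) = P := by
    have : ({Sum.inr ()}ᶜ : Set (κ ⊕ Unit)) = Set.range Sum.inl := by
      ext (x | x) <;> simp
    rw [others, ← closure_basis_subgroup c, this, ← Set.range_comp]
    congr 2
    exact funext hBc
  refine NormalClosurePaper.exists_transvection_of_stable_letter (b := B) (t := .inr ())
    (u := .inl u) (v := .inl v) (a := γ t * t⁻¹) hγN (by simp) (by simp) (by simpa using huv)
    ?_ ?_ ?_ ?_
  · rw [hBc, hBc, ← e]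
    rfl
  · rwa [hcP]
  · rw [hBt, inv_mul_cancel_right]
  · rwa [hcP]

end Extension

variable {E : Type} [Group E] {p : ℕ} [hp : Fact p.Prime] {θ : E →* Multiplicative (ZMod p)}

/-- Two ping-pong subgroups both mapping onto `ℤ/p`. -/
theorem PingPong.exists_transvection_of_theta {n : ℕ} (hn : 3 ≤ n) (hp3 : 3 ≤ p)
    (b : FreeGroupBasis (Fin n) θ.ker) {P Q : Subgroup E} {XP XQ : Set E}
    (h : PingPong P Q XP XQ) (hP : ¬ P ≤ θ.ker) (hQ : ¬ Q ≤ θ.ker)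
    {N : Subgroup (MulAut θ.ker)} [N.Normal]
    (hN : ∀ a, θ a = Multiplicative.ofAdd 1 → (MulAut.conjNormal a : MulAut θ.ker) ∈ N) :
    ∃ g ∈ N, IsTransvection g := by
  have hfree : IsFreeGroup θ.ker := b.isFreeGroup
  have pick : ∀ {P : Subgroup E}, ¬ P ≤ θ.ker → ∃ α ∈ P, θ α = Multiplicative.ofAdd 1 := by
    intro P hP
    obtain ⟨q, hqP, hq⟩ := Set.not_subset.1 hP
    obtain ⟨z, hz⟩ := exists_pow_map_eq hq (Multiplicative.ofAdd 1)
    exact ⟨q ^ z, P.pow_mem hqP z, hz⟩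
  obtain ⟨κ, ⟨bA⟩⟩ := exists_basis_of_le (F := θ.ker) (H := P ⊓ θ.ker) inf_le_right
  obtain ⟨μ, ⟨bB⟩⟩ := exists_basis_of_le (F := θ.ker) (H := Q ⊓ θ.ker) inf_le_right
  have key : ∀ {P Q : Subgroup E} {XP XQ : Set E} {κ μ : Type}, PingPong P Q XP XQ →
      ¬ P ≤ θ.ker → ¬ Q ≤ θ.ker → FreeGroupBasis κ ↥(P ⊓ θ.ker) →
      FreeGroupBasis μ ↥(Q ⊓ θ.ker) → Nonempty κ → ∃ g ∈ N, IsTransvection g := by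
    intro P Q XP XQ κ μ h hP hQ bA bB ⟨k⟩
    obtain ⟨α, hαP, hα⟩ := pick hP
    obtain ⟨c, l, hl, hs, hm⟩ := h.exists_theta_basis hp3 hαP hα hQ bA bB
    exact exists_transvection_of_fixed (b := c) (k := .inl k) (hN α hα)
      (by simpa using hl 1 2 le_rfl (by omega) (by omega) (by omega) (by omega)) (by simp)
      (by simp) (hs 1 le_rfl (by omega)) (hm _ (by simp)) fun g hg j hj => hg _ (hm j hj)
  by_cases hκ : Nonempty κ
  · exact key h hP hQ bA bB hκ
  by_cases hμ : Nonempty μ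
  · exact key h.symm hQ hP bB bA hμ
  rw [not_nonempty_iff] at hκ hμ
  obtain ⟨α, hαP, hα⟩ := pick hP
  obtain ⟨c, l, hl, hs, hm⟩ := h.exists_theta_basis hp3 hαP hα hQ bA bB
  have hp5 : 5 ≤ p := by
    have hcard := Nat.card_congr (Equiv.ofFreeGroupEquiv (c.repr.symm.trans b.repr))
    have hp0 : NeZero p := ⟨hp.out.ne_zero⟩
    have h1 : Nat.card {m : Multiplicative (ZMod p) // m ≠ 1} = p - 1 := by
      rw [Nat.card_eq_fintype_card, Fintype.card_subtype_compl, Fintype.card_multiplicative,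
        ZMod.card]
      simp
    rw [Nat.card_sum, Nat.card_sum, h1, Nat.card_fin, Nat.card_of_isEmpty, Nat.card_of_isEmpty]
      at hcard
    have : p ≠ 4 := by
      intro h4
      have := hp.out
      rw [h4] at this
      exact absurd this (by decide)
    omega
  have hd : ∀ i j, 1 ≤ i → i < 5 → 1 ≤ j → j < 5 → i ≠ j →
      (Sum.inr (Sum.inr (l i)) : κ ⊕ μ ⊕ _) ≠ .inr (.inr (l j)) := by
    intro i j hi hi' hj hj' hij
    simpa using hl i j hi (by omega) hj (by omega) hij
  exact exists_transvection_of_four (b := c) (hN α hα) (hd 1 2 (by omega) (by omega) (by omega) (by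
    omega) (by omega))
    (hd 1 3 (by omega) (by omega) (by omega) (by omega) (by omega))
    (hd 1 4 (by omega) (by omega) (by omega) (by omega) (by omega))
    (hd 2 3 (by omega) (by omega) (by omega) (by omega) (by omega))
    (hd 2 4 (by omega) (by omega) (by omega) (by omega) (by omega))
    (hd 3 4 (by omega) (by omega) (by omega) (by omega) (by omega))
    (hs 1 le_rfl (by omega)) (hs 2 (by omega) (by omega)) (hs 3 (by omega) (by omega))
    fun g hg j hj => hg _ (hm j hj)

/-- A normal subgroup of the automorphism group of a free group of rank at least three which
contains the action of a free-by-(odd prime order) extension contains a transvection. -/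
theorem exists_transvection_of_extension {n : ℕ} (hn : 3 ≤ n) (hodd : Odd p)
    (hθ : Function.Surjective θ) (b : FreeGroupBasis (Fin n) θ.ker)
    (hfaith : ∀ a, θ a = Multiplicative.ofAdd 1 → (MulAut.conjNormal a : MulAut θ.ker) ≠ 1)
    {N : Subgroup (MulAut θ.ker)} [N.Normal]
    (hN : ∀ a, θ a = Multiplicative.ofAdd 1 → (MulAut.conjNormal a : MulAut θ.ker) ∈ N) :
    ∃ g ∈ N, IsTransvection g := by
  have hp3 : 3 ≤ p := by
    have := hp.out.two_le
    rcases hodd with ⟨m, rfl⟩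
    omega
  have hfree : IsFreeGroup θ.ker := b.isFreeGroup
  have hcomm : ∃ x y : θ.ker, x * y ≠ y * x :=
    ⟨_, _, not_commute_basis b (k := ⟨0, by omega⟩) (l := ⟨1, by omega⟩) (by simp)⟩
  rcases splitting_dichotomy hodd hθ b hcomm with
    ⟨α, hθα, hα, P, Q, XP, XQ, h, hP, hI⟩ | ⟨P, Q, XP, XQ, h, hPk, hQ1, hII⟩
  · have hγ : (MulAut.conjNormal α : MulAut θ.ker) ^ p = 1 := by
      rw [← map_pow, hα, _root_.map_one]
    rcases hI with ⟨hP1, hQ1, hQ, -⟩ | ⟨⟨t, hQt, ht1, htP⟩, -⟩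
    · by_cases hPt : ∀ g ∈ P, (MulAut.conjNormal α : MulAut θ.ker) g = g
      · refine h.symm.exists_transvection_of_factors hodd b (hN α hθα) hγ hQ hP hP1 fun hQt => ?_
        exact hfaith α hθα (eq_one_of_factors h hPt hQt)
      · exact h.exists_transvection_of_factors hodd b (hN α hθα) hγ hP hQ hQ1 hPt
    · refine h.exists_transvection_of_stable_letter hodd b (hN α hθα) hγ hP hQt ht1 htP
        fun hPt => ?_
      exact hfaith α hθα (eq_one_of_stable_letter (p := p) hγ h hPt hQt htP)
  · rcases hII with ⟨hQk, -⟩ | ⟨hQk, -⟩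
    · obtain ⟨q, hqP, hq⟩ := Set.not_subset.1 hPk
      obtain ⟨z, hz⟩ := exists_pow_map_eq hq (Multiplicative.ofAdd 1)
      obtain ⟨κ, c, k₀, k₁, k₂, h01, h02, h12, e₀, e₁, hm⟩ :=
        h.exists_orbit_basis hp3 hQk hQ1 (P.pow_mem hqP z) hz
      exact exists_transvection_of_orbit (b := c) (hN _ hz) h01 h02 h12 e₀ e₁
        fun g hg j hj => hg _ (hm j hj)
    · exact h.exists_transvection_of_theta hn hp3 b hPk hQk hN

end

section

section CommonPrefix

variable {β : Type*} [DecidableEq β]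

/-- The length of the longest common prefix of two lists. -/
def lcpLength : List β → List β → ℕ
  | a :: l, b :: m => if a = b then lcpLength l m + 1 else 0
  | [], _ => 0
  | _ :: _, [] => 0

lemma le_lcpLength_iff {k : ℕ} {l m : List β} : k ≤ lcpLength l m ↔
    k ≤ l.length ∧ k ≤ m.length ∧ l.take k = m.take k := by
  induction l generalizing k m with
  | nil => cases k <;> simp [lcpLength]
  | cons a l ih =>
    cases m with
    | nil => cases k <;> simp [lcpLength]
    | cons b m =>
      cases k with
      | zero => simp
      | succ k =>
        by_cases hab : a = b
        · simp [lcpLength, hab, ih]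
        · simp [lcpLength, hab]

lemma lcpLength_eq_of_lt {l m w : List β} (h : lcpLength m w < lcpLength m l) :
    lcpLength l w = lcpLength m w := by
  obtain ⟨h1, h2, h3⟩ := le_lcpLength_iff.1 h.le
  obtain ⟨g1, g2, g3⟩ := le_lcpLength_iff.1 h
  have hle := le_lcpLength_iff.1 (le_refl (lcpLength m w))
  apply le_antisymm
  · by_contra hlt
    obtain ⟨f1, f2, f3⟩ := le_lcpLength_iff.1 (not_le.1 hlt)
    exact absurd (le_lcpLength_iff.2 ⟨g1, f2, g3.trans f3⟩) (by omega)
  · exact le_lcpLength_iff.2 ⟨h2, hle.2.1, h3.symm.trans hle.2.2⟩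

end CommonPrefix

section Cancellation

variable {ι : Type*} [DecidableEq ι]

open FreeGroup

lemma length_reduce_invRev_append {l m : List (ι × Bool)} (hl : IsReduced l) (hm : IsReduced m) :
    (reduce (invRev l ++ m)).length + 2 * lcpLength l m = l.length + m.length := by
  induction l generalizing m with
  | nil => simp [lcpLength, hm.reduce_eq]
  | cons a l ih =>
    cases m with
    | nil =>
      rw [List.append_nil, reduce_invRev, hl.reduce_eq, invRev_length]
      simp [lcpLength]
    | cons b m =>
      by_cases hab : a = b
      · subst hab
        have : reduce (invRev (a :: l) ++ a :: m) = reduce (invRev l ++ m) := by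
          apply reduce.eq_of_red
          apply Red.Step.to_red
          have := Red.Step.not (L₁ := invRev l) (L₂ := m) (x := a.1) (b := !a.2)
          simpa [invRev] using this
        have := ih (hl.infix (List.suffix_cons a l).isInfix) (hm.infix (List.suffix_cons a
            m).isInfix)
        simp only [lcpLength, if_true, List.length_cons, *]
        omega
      · have hinv : IsReduced (invRev (a :: l)) := by
          rw [isReduced_iff_reduce_eq, reduce_invRev, hl.reduce_eq]
        have hred : IsReduced (invRev (a :: l) ++ b :: m) := by
          rw [invRev_cons] at hinv ⊢
          refine hinv.append_overlap ?_ (by simp [invRev])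
          have : a.1 = b.1 → a.2 = !b.2 := by
            intro h1
            have : a.2 ≠ b.2 := fun h2 => hab (Prod.ext h1 h2)
            revert this
            cases a.2 <;> cases b.2 <;> simp
          simpa [invRev] using ⟨this, hm⟩
        rw [hred.reduce_eq]
        simp [lcpLength, hab, invRev_length]

/-- The amount of cancellation in the product of two elements of a free group. -/
def cancelLength (x y : FreeGroup ι) : ℕ := lcpLength x⁻¹.toWord y.toWord

lemma norm_mul_add (x y : FreeGroup ι) :
    (x * y).norm + 2 * cancelLength x y = x.norm + y.norm := by
  have := length_reduce_invRev_append (isReduced_toWord (x := x⁻¹)) (isReduced_toWord (x := y))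
  rw [toWord_inv, invRev_invRev, ← toWord_inv, ← toWord_mul] at this
  rw [← norm_inv_eq (x := x)]
  exact this

lemma norm_lt_norm_mul_self {x : FreeGroup ι} (hx : x ≠ 1) : x.norm < (x * x).norm := by
  have h1 := reduceCyclically.reduce_flatten_replicate (isReduced_toWord (x := x)) 1
  have h2 := reduceCyclically.reduce_flatten_replicate (isReduced_toWord (x := x)) 2
  have e2 : (List.replicate 2 x.toWord).flatten = x.toWord ++ x.toWord := by
    simp [List.replicate_succ]
  rw [e2, ← toWord_mul] at h2
  have e1 : (List.replicate 1 x.toWord).flatten = x.toWord := by simp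
  rw [e1, reduce_toWord] at h1
  rw [if_neg one_ne_zero] at h1
  rw [if_neg two_ne_zero] at h2
  have l1 := congrArg List.length h1
  have l2 := congrArg List.length h2
  simp only [List.length_append, invRev_length, List.length_flatten, List.map_replicate,
    List.sum_replicate, smul_eq_mul] at l1 l2
  have h0 : (reduceCyclically x.toWord).length ≠ 0 := by
    intro h0
    rw [List.length_eq_zero_iff] at h0
    apply hx
    rw [← mk_toWord (x := x), h1, h0]
    simp [← mul_mk, ← inv_mk]
  rw [FreeGroup.norm, FreeGroup.norm]
  omega

end Cancellation

section ReducedProducts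

variable {ι : Type*} [DecidableEq ι]

open FreeGroup

/-- `ReducedProduct S g v k`: `g` is a product of `k + 1` elements of `S`, the last of which is
`v`, such that consecutive factors are not inverse to each other. -/
inductive ReducedProduct (S : Set (FreeGroup ι)) : FreeGroup ι → FreeGroup ι → ℕ → Prop
  | single {v : FreeGroup ι} (hv : v ∈ S) : ReducedProduct S v v 0
  | snoc {g v w : FreeGroup ι} {k : ℕ} (h : ReducedProduct S g v k) (hw : w ∈ S)
      (hvw : v * w ≠ 1) : ReducedProduct S (g * w) w (k + 1)

/-- Neither factor next to a given one cancels up to its middle. -/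
def NielsenReduced (S : Set (FreeGroup ι)) : Prop :=
  ∀ u ∈ S, ∀ v ∈ S, ∀ w ∈ S, u * v ≠ 1 → v * w ≠ 1 →
    cancelLength u v + cancelLength v w < v.norm

variable {S : Set (FreeGroup ι)}

lemma ReducedProduct.cancel {g v : FreeGroup ι} {k : ℕ} (h : ReducedProduct S g v k)
    (hS : NielsenReduced S) (h1 : ∀ v ∈ S, v * v ≠ 1) : v ∈ S ∧ ∀ w ∈ S, v * w ≠ 1 →
    cancelLength g w = cancelLength v w ∧ k + 1 + cancelLength v w ≤ g.norm := by
  induction h with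
  | single hv =>
    refine ⟨hv, fun w hw hvw => ⟨rfl, ?_⟩⟩
    have := hS _ hv _ hv _ hw (h1 _ hv) hvw
    omega
  | @snoc g v u k h hu hvu ih =>
    obtain ⟨hv, ih⟩ := ih
    refine ⟨hu, fun w hw huw => ?_⟩
    obtain ⟨e, hle⟩ := ih u hu hvu
    have hN := hS _ hv _ hu _ hw hvu huw
    have hgu := norm_mul_add g u
    constructor
    · apply lcpLength_eq_of_lt
      have := norm_mul_add u (g * u)⁻¹
      rw [_root_.mul_inv_rev, mul_inv_cancel_left, norm_inv_eq, ← _root_.mul_inv_rev,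
        norm_inv_eq] at this
      change cancelLength u w < cancelLength u (g * u)⁻¹
      omega
    · omega

lemma eq_one_or_reducedProduct (hinv : ∀ v ∈ S, v⁻¹ ∈ S) {g : FreeGroup ι}
    (hg : g ∈ Subgroup.closure S) : g = 1 ∨ ∃ v k, ReducedProduct S g v k := by
  have key : ∀ g, (g = 1 ∨ ∃ v k, ReducedProduct S g v k) → ∀ s ∈ S,
      g * s = 1 ∨ ∃ v k, ReducedProduct S (g * s) v k := by
    rintro g (rfl | ⟨v, k, h⟩) s hs
    · right
      rw [one_mul]
      exact ⟨s, 0, .single hs⟩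
    · by_cases hvs : v * s = 1
      · cases h with
        | single hv => exact .inl hvs
        | @snoc g u _ k h hv hu =>
          right
          rw [mul_assoc, hvs, mul_one]
          exact ⟨_, _, h⟩
      · exact .inr ⟨_, _, .snoc h hs hvs⟩
  induction hg using Subgroup.closure_induction_right with
  | one => exact .inl rfl
  | mul_right x hx y hy ih => exact key x ih y hy
  | mul_inv_cancel x hx y hy ih => exact key x ih _ (hinv y hy)

theorem NielsenReduced.mem_of_norm_eq_one (hS : NielsenReduced S) (h1 : ∀ v ∈ S, v * v ≠ 1)
    (hinv : ∀ v ∈ S, v⁻¹ ∈ S) {x : FreeGroup ι} (hx : x.norm = 1)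
    (hxS : x ∈ Subgroup.closure S) : x ∈ S := by
  rcases eq_one_or_reducedProduct hinv hxS with rfl | ⟨v, k, h⟩
  · simp at hx
  · obtain ⟨hv, hc⟩ := h.cancel hS h1
    have := (hc v hv (h1 v hv)).2
    cases h with
    | single hv => exact hv
    | snoc => omega

end ReducedProducts

end

section

section Weight

open FreeGroup

/-- The entries of a tuple and their inverses. -/
def symmRange {ι κ : Type*} (u : κ → FreeGroup ι) : Set (FreeGroup ι) :=
  {v | ∃ i, v = u i ∨ v = (u i)⁻¹}

lemma inv_mem_symmRange {ι κ : Type*} {u : κ → FreeGroup ι} {v : FreeGroup ι}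
    (hv : v ∈ symmRange u) : v⁻¹ ∈ symmRange u := by
  obtain ⟨i, rfl | rfl⟩ := hv
  · exact ⟨i, .inr rfl⟩
  · exact ⟨i, .inl (inv_inv _)⟩

variable {ι : Type*} [Fintype ι]

/-- The number whose digits are given by the letters of a word. -/
noncomputable def wordNum (l : List (ι × Bool)) : ℕ :=
  Nat.ofDigits (Fintype.card (ι × Bool))
    (l.map fun a => (Fintype.equivFin (ι × Bool) a : ℕ)).reverse

lemma wordNum_append (p s : List (ι × Bool)) :
    wordNum (p ++ s) = wordNum s + Fintype.card (ι × Bool) ^ s.length * wordNum p := by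
  simp [wordNum, Nat.ofDigits_append]

lemma wordNum_injective {p q : List (ι × Bool)} (hl : p.length = q.length)
    (h : wordNum p = wordNum q) : p = q := by
  rcases isEmpty_or_nonempty ι with hι | hι
  · cases p with
    | nil => simpa [eq_comm] using hl
    | cons a => exact hι.elim a.1
  have hlt : ∀ (l : List (ι × Bool)),
      ∀ d ∈ (l.map fun a => (Fintype.equivFin (ι × Bool) a : ℕ)).reverse,
        d < Fintype.card (ι × Bool) := by
    intro l d hd
    rw [List.mem_reverse, List.mem_map] at hd
    obtain ⟨a, -, rfl⟩ := hd
    exact Fin.isLt _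
  have hB : 1 < Fintype.card (ι × Bool) := by
    have := Fintype.card_pos (α := ι)
    rw [Fintype.card_prod, Fintype.card_bool]
    omega
  have := Nat.ofDigits_inj_of_len_eq hB (by simpa using hl) (hlt p) (hlt q) h
  rw [List.reverse_inj] at this
  exact List.map_injective_iff.2 (fun a b hab =>
    (Fintype.equivFin (ι × Bool)).injective (Fin.ext hab)) this

variable [DecidableEq ι]

/-- The sum of the numbers of the initial halves of the words of an element and of its inverse. -/
noncomputable def halfWeight (x : FreeGroup ι) : ℕ :=
  wordNum (x.toWord.take (x.norm / 2)) + wordNum (x⁻¹.toWord.take (x.norm / 2))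

lemma halfWeight_inv (x : FreeGroup ι) : halfWeight x⁻¹ = halfWeight x := by
  rw [halfWeight, halfWeight, norm_inv_eq, inv_inv, add_comm]

lemma halfWeight_mul_lt {x y : FreeGroup ι} {p q r : List (ι × Bool)}
    (hx : x.toWord = p ++ invRev q) (hy : y.toWord = q ++ r) (hpq : p.length = q.length)
    (hq : 2 * q.length ≤ y.norm) (hxy : (x * y).norm = y.norm) (hlt : wordNum p < wordNum q) :
    halfWeight (x * y) < halfWeight y := by
  have hyn : y.norm = q.length + r.length := by rw [FreeGroup.norm, hy, List.length_append]
  have hmk : x * y = mk (p ++ r) := by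
    rw [← mk_toWord (x := x), ← mk_toWord (x := y), hx, hy, ← mul_mk, ← mul_mk, ← mul_mk, ← inv_mk]
    group
  have hword : (x * y).toWord = p ++ r := by
    rw [hmk, toWord_mk]
    refine reduce.red.sublist.eq_of_length ?_
    rw [← toWord_mk, ← hmk]
    change (x * y).norm = _
    rw [hxy, hyn, List.length_append, hpq]
  set h := y.norm / 2 with hh
  have e1 : (p ++ r).take h = p ++ r.take (h - q.length) := by
    rw [List.take_append, hpq, List.take_of_length_le (by omega)]
  have e2 : (q ++ r).take h = q ++ r.take (h - q.length) := by
    rw [List.take_append, List.take_of_length_le (by omega)]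
  have e3 : ∀ s : List (ι × Bool), (invRev (s ++ r)).take h = (invRev r).take h := by
    intro s
    rw [invRev_append, List.take_append_of_le_length (by rw [invRev_length]; omega)]
  rw [halfWeight, halfWeight, hxy, toWord_inv, toWord_inv, hword, hy, e3, e3, e1, e2,
    wordNum_append, wordNum_append]
  have hB : 0 < Fintype.card (ι × Bool) := by
    rw [Fintype.card_pos_iff]
    cases q with
    | nil =>
      rw [List.length_nil, List.length_eq_zero_iff] at hpq
      rw [hpq] at hlt
      exact absurd hlt (lt_irrefl _)
    | cons a => exact ⟨a⟩
  gcongr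

/-- A tuple which cannot be improved by multiplying one of its entries by another one. -/
def TupleMinimal {κ : Type*} (u : κ → FreeGroup ι) : Prop :=
  ∀ i j, i ≠ j → ∀ v w, (v = u i ∨ v = (u i)⁻¹) → (w = u j ∨ w = (u j)⁻¹) →
    w.norm ≤ (v * w).norm ∧ ((v * w).norm = w.norm → halfWeight w ≤ halfWeight (v * w))

theorem TupleMinimal.nielsenReduced {κ : Type*} {u : κ → FreeGroup ι} (hu : TupleMinimal u)
    (h1 : ∀ i, u i ≠ 1) : NielsenReduced (symmRange u) := by
  have hne : ∀ v ∈ symmRange u, v ≠ 1 := by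
    rintro v ⟨i, rfl | rfl⟩
    · exact h1 i
    · simpa using h1 i
  have invs : ∀ {v : FreeGroup ι} {i : κ}, (v = u i ∨ v = (u i)⁻¹) →
      (v⁻¹ = u i ∨ v⁻¹ = (u i)⁻¹) := by
    rintro v i (rfl | rfl)
    · exact .inr rfl
    · exact .inl (inv_inv _)
  have two : ∀ {v w : FreeGroup ι} {i j : κ}, (v = u i ∨ v = (u i)⁻¹) → (w = u j ∨ w = (u j)⁻¹) →
      v * w ≠ 1 → (2 * cancelLength v w ≤ v.norm ∧ 2 * cancelLength v w ≤ w.norm) ∧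
        (i = j → 2 * cancelLength v w < v.norm ∧ 2 * cancelLength v w < w.norm) := by
    intro v w i j hv hw hvw
    have hn := norm_mul_add v w
    by_cases hij : i = j
    · have hvw' : v = w := by
        subst hij
        rcases hv with rfl | rfl <;> rcases hw with rfl | rfl
        · rfl
        · simp at hvw
        · simp at hvw
        · rfl
      subst hvw'
      have := norm_lt_norm_mul_self (hne v ⟨i, hv⟩)
      omega
    · have a := (hu i j hij v w hv hw).1
      have b := (hu j i (Ne.symm hij) w⁻¹ v⁻¹ (invs hw) (invs hv)).1
      rw [← _root_.mul_inv_rev, norm_inv_eq, norm_inv_eq] at b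
      exact ⟨by omega, fun h => absurd h hij⟩
  rintro v₁ ⟨i, hi⟩ v₂ ⟨j, hj⟩ v₃ ⟨k, hk⟩ h12 h23
  obtain ⟨⟨a1, a2⟩, a3⟩ := two hi hj h12
  obtain ⟨⟨b1, b2⟩, b3⟩ := two hj hk h23
  by_contra hcon
  have hij : i ≠ j := fun h => by have := a3 h; omega
  have hjk : j ≠ k := fun h => by have := b3 h; omega
  set m := cancelLength v₁ v₂ with hm
  have hm2 : cancelLength v₂ v₃ = m := by omega
  have hnorm : v₂.norm = 2 * m := by omega
  obtain ⟨-, -, c3⟩ := le_lcpLength_iff.1 (show m ≤ lcpLength v₁⁻¹.toWord v₂.toWord from le_rfl)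
  obtain ⟨-, -, d3⟩ := le_lcpLength_iff.1 (show m ≤ lcpLength v₂⁻¹.toWord v₃.toWord from hm2.ge)
  set p := v₂.toWord.take m with hp
  set q := v₃.toWord.take m with hq
  have hlen2 : v₂.toWord.length = 2 * m := hnorm
  have hlen3 : v₃.toWord.length = v₃.norm := rfl
  have hlen1 : v₁⁻¹.toWord.length = v₁.norm := norm_inv_eq
  have hpl : p.length = m := by rw [hp, List.length_take]; omega
  have hql : q.length = m := by rw [hq, List.length_take]; omega
  have hw2 : v₂.toWord = p ++ invRev q := by
    have hd : v₂.toWord.drop m = invRev q := by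
      rw [← d3, toWord_inv, ← invRev_invRev (L₁ := v₂.toWord.drop m)]
      congr 1
      conv_rhs => rw [← List.take_append_drop m v₂.toWord, invRev_append]
      rw [List.take_left']
      rw [invRev_length, List.length_drop]
      omega
    rw [← hd, hp, List.take_append_drop]
  have hw2' : v₂⁻¹.toWord = q ++ invRev p := by
    rw [toWord_inv, hw2, invRev_append, invRev_invRev]
  have hw3 : v₃.toWord = q ++ v₃.toWord.drop m := (List.take_append_drop _ _).symm
  have hw1 : v₁⁻¹.toWord = p ++ v₁⁻¹.toWord.drop m := by
    rw [← c3]; exact (List.take_append_drop _ _).symm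
  have n12 := norm_mul_add v₁ v₂
  have n23 := norm_mul_add v₂ v₃
  rcases lt_trichotomy (wordNum p) (wordNum q) with hlt | heq | hlt
  · have hnn : (v₂ * v₃).norm = v₃.norm := by omega
    have := halfWeight_mul_lt hw2 hw3 (by omega) (by omega) hnn hlt
    have := (hu j k hjk v₂ v₃ hj hk).2 hnn
    omega
  · have hpq := wordNum_injective (by omega) heq
    apply hne v₂ ⟨j, hj⟩
    rw [← mk_toWord (x := v₂), hw2, hpq, ← mul_mk, ← inv_mk, mul_inv_cancel]
  · have hnn : (v₂⁻¹ * v₁⁻¹).norm = v₁⁻¹.norm := by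
      rw [← _root_.mul_inv_rev, norm_inv_eq, norm_inv_eq]; omega
    have := halfWeight_mul_lt hw2' hw1 (by omega) (by rw [norm_inv_eq]; omega) hnn hlt
    have := (hu j i hij.symm v₂⁻¹ v₁⁻¹ (invs hj) (invs hi)).2 hnn
    omega

end Weight

end

section

section BasisChange

variable {κ G : Type*} [Group G]

lemma exists_aut_of_bases (b b' : FreeGroupBasis κ G) : ∃ a : MulAut G, ∀ j, a (b j) = b' j :=
  ⟨b.repr.trans b'.repr.symm, fun j => by
    rw [MulEquiv.trans_apply, FreeGroupBasis.repr_apply_coe]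
    rfl⟩

lemma exists_equiv_apply_eq {κ κ' : Type*} (e : κ ≃ κ') {k l : κ} {k' l' : κ'} (hkl : k ≠ l)
    (hkl' : k' ≠ l') : ∃ e : κ ≃ κ', e k = k' ∧ e l = l' := by
  classical
  set e₁ := e.trans (Equiv.swap (e k) k') with he₁
  have h1 : e₁ k = k' := by simp [he₁]
  have h2 : e₁ l ≠ k' := fun h => hkl (e₁.injective (h1.trans h.symm))
  refine ⟨e₁.trans (Equiv.swap (e₁ l) l'), ?_, by simp⟩
  rw [Equiv.trans_apply, h1, Equiv.swap_apply_of_ne_of_ne h2.symm hkl']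

end BasisChange

lemma IsTransvection.conj {G : Type} [Group G] {g h : MulAut G} (hg : IsTransvection g)
    (hh : IsTransvection h) : ∃ a : MulAut G, h = a * g * a⁻¹ := by
  obtain ⟨κ, b, k, l, hkl, hb⟩ := hg
  obtain ⟨κ', b', k', l', hkl', hb'⟩ := hh
  obtain ⟨e, rfl, rfl⟩ := exists_equiv_apply_eq
    (Equiv.ofFreeGroupEquiv (b.repr.symm.trans b'.repr)) hkl hkl'
  obtain ⟨a, ha⟩ := exists_aut_of_bases b (b'.reindex e.symm)
  have ha' : ∀ j, a (b j) = b' (e j) := fun j => by simpa using ha j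
  refine ⟨a, ?_⟩
  rw [eq_mul_inv_iff_mul_eq]
  apply mulAut_ext b
  intro j
  rw [MulAut.mul_apply, MulAut.mul_apply, ha']
  by_cases hj : j = k
  · subst hj
    rw [hb.self, hb'.self]
    simp [ha']
  · rw [hb.apply hj, ha', hb'.apply (e.injective.ne hj)]

lemma IsTransvection.mem_of_mem {G : Type} [Group G] {N : Subgroup (MulAut G)} [hN : N.Normal]
    {g h : MulAut G} (hg : IsTransvection g) (hgN : g ∈ N) (hh : IsTransvection h) : h ∈ N := by
  obtain ⟨a, rfl⟩ := hg.conj hh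
  exact hN.conj_mem g hgN a

section SignFlip

variable {ι : Type}

open FreeGroup

/-- The automorphism inverting one generator. -/
def IsSignFlip (k : ι) (s : MulAut (FreeGroup ι)) : Prop :=
  s (of k) = (of k)⁻¹ ∧ ∀ j ≠ k, s (of j) = of j

lemma exists_isSignFlip (k : ι) : ∃ s, IsSignFlip k s := by
  obtain ⟨b', h1, h2⟩ := exists_basis_inv (FreeGroupBasis.ofFreeGroup ι) k
  obtain ⟨s, hs⟩ := exists_aut_of_bases (FreeGroupBasis.ofFreeGroup ι) b'
  exact ⟨s, (hs k).trans h1, fun j hj => (hs j).trans (h2 j hj)⟩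

lemma IsSignFlip.mul_self {k : ι} {s : MulAut (FreeGroup ι)} (hs : IsSignFlip k s) :
    s * s = 1 := by
  apply mulAut_ext (FreeGroupBasis.ofFreeGroup ι)
  intro j
  rw [FreeGroupBasis.ofFreeGroup_apply, MulAut.mul_apply, MulAut.one_apply]
  by_cases hj : j = k
  · subst hj
    rw [hs.1, _root_.map_inv, hs.1, inv_inv]
  · rw [hs.2 j hj, hs.2 j hj]

lemma exists_signedSwap {N : Subgroup (MulAut (FreeGroup ι))}
    (hN : ∀ g, IsTransvection g → g ∈ N) {i j : ι} (hij : i ≠ j) :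
    ∃ w ∈ N, w (of i) = of j ∧ w (of j) = (of i)⁻¹ ∧ ∀ k, k ≠ i → k ≠ j → w (of k) = of k := by
  set b := FreeGroupBasis.ofFreeGroup ι with hb
  have hbof : ∀ i, FreeGroup.of i = b i := fun i => rfl
  obtain ⟨A, hA⟩ := exists_isElem b (one_mem (others b i)) (mem_others b hij.symm)
  obtain ⟨B, hB⟩ := exists_isElem b (one_mem (others b j)) (inv_mem (mem_others b hij))
  obtain ⟨C, hC⟩ := exists_isElem b (mem_others b hij.symm) (one_mem (others b i))
  refine ⟨A * B * C, mul_mem (mul_mem (hN _ (isTransvection_right hij hA))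
    (hN _ (isTransvection_right_inv hij.symm hB))) (hN _ ⟨_, b, i, j, hij, hC⟩), ?_, ?_, ?_⟩
  · simp [hbof, hC.self, hB.self, hB.apply hij, hA.apply hij.symm]
  · simp [hbof, hC.apply hij.symm, hB.self, hA.self, hA.apply hij.symm]
  · intro k hki hkj
    simp [hbof, hC.apply hki, hB.apply hkj, hA.apply hki]

end SignFlip

section Minimize

variable {ι : Type} [Fintype ι] [DecidableEq ι]

open FreeGroup

/-- Nielsen reduction. -/
theorem exists_tupleMinimal {N : Subgroup (MulAut (FreeGroup ι))}
    (hN : ∀ g, IsTransvection g → g ∈ N) (φ : MulAut (FreeGroup ι)) :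
    ∃ τ ∈ N, TupleMinimal fun i => (φ * τ) (of i) := by
  let μ : N → ℕ ×ₗ ℕ := fun τ => toLex (∑ i, ((φ * τ) (of i)).norm, ∑ i,
      halfWeight ((φ * τ) (of i)))
  obtain ⟨τ, -, hτ⟩ := WellFounded.has_min (InvImage.wf μ wellFounded_lt) Set.univ ⟨1, trivial⟩
  refine ⟨τ, τ.2, ?_⟩
  have key : ∀ (j : ι) (σ : MulAut (FreeGroup ι)), σ ∈ N → (∀ k ≠ j, σ (of k) = of k) →
      ((φ * τ) (of j)).norm ≤ ((φ * τ) (σ (of j))).norm ∧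
      (((φ * τ) (σ (of j))).norm = ((φ * τ) (of j)).norm →
        halfWeight ((φ * τ) (of j)) ≤ halfWeight ((φ * τ) (σ (of j)))) := by
    intro j σ hσ hfix
    have happ : ∀ x, (φ * (τ * σ)) x = (φ * τ) (σ x) := fun _ => rfl
    have hsum : ∀ f : FreeGroup ι → ℕ, ∑ i, f ((φ * (τ * σ)) (of i)) + f ((φ * τ) (of j)) =
        ∑ i, f ((φ * τ) (of i)) + f ((φ * τ) (σ (of j))) := by
      intro f
      rw [← Finset.add_sum_erase _ _ (Finset.mem_univ j),
        ← Finset.add_sum_erase _ (fun i => f ((φ * τ) (of i))) (Finset.mem_univ j)]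
      have : ∑ i ∈ Finset.univ.erase j, f ((φ * (τ * σ)) (of i)) =
          ∑ i ∈ Finset.univ.erase j, f ((φ * τ) (of i)) := by
        refine Finset.sum_congr rfl fun i hi => ?_
        rw [happ, hfix i (Finset.ne_of_mem_erase hi)]
      rw [this, happ]
      omega
    have hmin := hτ (τ * ⟨σ, hσ⟩) trivial
    have s1 := hsum FreeGroup.norm
    have s2 := hsum halfWeight
    simp only [InvImage, μ, Prod.Lex.toLex_lt_toLex, Subgroup.coe_mul] at hmin
    omega
  intro i j hij v w hv hw
  set b := FreeGroupBasis.ofFreeGroup ι with hb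
  have hbof : ∀ i, b i = of i := fun i => rfl
  have mi : b i ∈ others b j := mem_others b hij
  have fin : ∀ x y σ, IsElem b j x y σ → IsTransvection σ →
      ((w = (φ * τ) (of j) ∧ v * w = (φ * τ) (x * of j * y)) ∨
        (w = ((φ * τ) (of j))⁻¹ ∧ v * w = ((φ * τ) (x * of j * y))⁻¹)) →
      w.norm ≤ (v * w).norm ∧ ((v * w).norm = w.norm → halfWeight w ≤ halfWeight (v * w)) := by
    intro x y σ hσ ht h
    have := key j σ (hN σ ht) fun k hk => hσ.apply hk
    rw [← hbof j, hσ.self, hbof] at this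
    rcases h with ⟨h1, h2⟩ | ⟨h1, h2⟩
    · rwa [h2, h1]
    · rwa [h2, h1, norm_inv_eq, norm_inv_eq, halfWeight_inv, halfWeight_inv]
  rcases hv with rfl | rfl <;> rcases hw with rfl | rfl
  · obtain ⟨σ, hσ⟩ := exists_isElem b mi (one_mem _)
    exact fin _ _ σ hσ ⟨_, b, j, i, hij.symm, hσ⟩ (.inl ⟨rfl, by simp [hbof]⟩)
  · obtain ⟨σ, hσ⟩ := exists_isElem b (one_mem _) (inv_mem mi)
    exact fin _ _ σ hσ (isTransvection_right_inv hij.symm hσ) (.inr ⟨rfl, by simp [hbof]⟩)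
  · obtain ⟨σ, hσ⟩ := exists_isElem b (inv_mem mi) (one_mem _)
    exact fin _ _ σ hσ (isTransvection_left_inv hij.symm hσ) (.inl ⟨rfl, by simp [hbof]⟩)
  · obtain ⟨σ, hσ⟩ := exists_isElem b (one_mem _) mi
    exact fin _ _ σ hσ (isTransvection_right hij.symm hσ) (.inr ⟨rfl, by simp [hbof]⟩)

/-- An automorphism permuting the free generators up to inversion. -/
def IsSignedPerm (ψ : MulAut (FreeGroup ι)) (σ : Equiv.Perm ι) : Prop :=
  ∀ i, ψ (of i) = of (σ i) ∨ ψ (of i) = (of (σ i))⁻¹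

theorem exists_isSignedPerm {N : Subgroup (MulAut (FreeGroup ι))}
    (hN : ∀ g, IsTransvection g → g ∈ N) (φ : MulAut (FreeGroup ι)) :
    ∃ τ ∈ N, ∃ σ, IsSignedPerm (φ * τ) σ := by
  obtain ⟨τ, hτ, hmin⟩ := exists_tupleMinimal hN φ
  refine ⟨τ, hτ, ?_⟩
  set u : ι → FreeGroup ι := fun i => (φ * τ) (of i) with hu
  have hu1 : ∀ i, u i ≠ 1 := fun i h => of_ne_one i ((MulEquiv.map_eq_one_iff _).1 h)
  have hgen : Subgroup.closure (symmRange u) = ⊤ := by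
    rw [eq_top_iff, ← closure_range_basis ((FreeGroupBasis.ofFreeGroup ι).map (φ * τ))]
    refine Subgroup.closure_mono ?_
    rintro - ⟨i, rfl⟩
    exact ⟨i, .inl rfl⟩
  have hsq : ∀ v ∈ symmRange u, v * v ≠ 1 := by
    intro v hv h
    have hv1 : v ≠ 1 := by
      obtain ⟨i, rfl | rfl⟩ := hv
      · exact hu1 i
      · simpa using hu1 i
    have := norm_lt_norm_mul_self hv1
    rw [h, FreeGroup.norm_one] at this
    omega
  have hmem : ∀ i : ι, ∃ j, FreeGroup.of i = u j ∨ FreeGroup.of i = (u j)⁻¹ := fun i =>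
    (hmin.nielsenReduced hu1).mem_of_norm_eq_one hsq (fun v => inv_mem_symmRange) (norm_of i)
      (hgen ▸ Subgroup.mem_top _)
  choose s hs using hmem
  have hne : ∀ i j : ι, FreeGroup.of i ≠ (FreeGroup.of j)⁻¹ := by
    intro i j h
    have := congrArg toWord h
    simp [toWord_inv, invRev] at this
  have hinj : Function.Injective s := by
    intro i j hij
    have hi := hs i
    have hj := hs j
    rw [← hij] at hj
    apply of_injective
    rcases hi with hi | hi <;> rcases hj with hj | hj
    · rw [hi, hj]
    · exact absurd (hi.trans (by rw [hj, inv_inv])) (hne i j)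
    · exact absurd (hj.trans (by rw [hi, inv_inv])) (hne j i)
    · rw [hi, hj]
  let σ := Equiv.ofBijective s (Finite.injective_iff_bijective.1 hinj)
  refine ⟨σ.symm, fun i => ?_⟩
  have hi := hs (σ.symm i)
  have hsi : s (σ.symm i) = i := σ.apply_symm_apply i
  rw [hsi] at hi
  rcases hi with hi | hi
  · exact .inl hi.symm
  · right
    rw [hi, inv_inv]

lemma IsSignedPerm.mem {H : Subgroup (MulAut (FreeGroup ι))}
    (hH : ∀ g, IsTransvection g → g ∈ H) {s₀ : MulAut (FreeGroup ι)} {k₀ : ι}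
    (hs₀ : IsSignFlip k₀ s₀) (hs₀H : s₀ ∈ H) (σ : Equiv.Perm ι) :
    ∀ ψ : MulAut (FreeGroup ι), IsSignedPerm ψ σ → ψ ∈ H := by
  have flip : ∀ k, ∃ s ∈ H, IsSignFlip k s := by
    intro k
    by_cases hk : k = k₀
    · exact ⟨s₀, hs₀H, hk ▸ hs₀⟩
    obtain ⟨w, hw, h1, h2, h3⟩ := exists_signedSwap hH (Ne.symm hk)
    refine ⟨w * s₀ * w⁻¹, mul_mem (mul_mem hw hs₀H) (inv_mem hw), ?_, fun j hj => ?_⟩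
    · rw [MulAut.mul_apply, MulAut.mul_apply, inv_apply_eq_of h1, hs₀.1, _root_.map_inv, h1]
    · rw [MulAut.mul_apply, MulAut.mul_apply]
      by_cases hj0 : j = k₀
      · subst hj0
        have : w⁻¹ (of j) = (of k)⁻¹ := inv_apply_eq_of (by rw [_root_.map_inv, h2, inv_inv])
        rw [this, _root_.map_inv, hs₀.2 k hk, _root_.map_inv, h2, inv_inv]
      · rw [inv_apply_eq_of (h3 j hj0 hj), hs₀.2 j hj0, h3 j hj0 hj]
  induction σ using Equiv.Perm.swap_induction_on with
  | one =>
    intro ψ hψ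
    induction hc : (Finset.univ.filter fun i => ψ (of i) ≠ of i).card using
      Nat.strong_induction_on generalizing ψ with
    | _ c ih =>
    by_cases hall : ∀ i, ψ (of i) = of i
    · have : ψ = 1 := mulAut_ext (FreeGroupBasis.ofFreeGroup ι) hall
      exact this ▸ one_mem H
    push Not at hall
    obtain ⟨i, hi⟩ := hall
    obtain ⟨s, hsH, hs⟩ := flip i
    have hψi : ψ (of i) = (of i)⁻¹ := (hψ i).resolve_left hi
    have e1 : (ψ * s) (of i) = of i := by
      rw [MulAut.mul_apply, hs.1, _root_.map_inv, hψi, inv_inv]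
    have e2 : ∀ j ≠ i, (ψ * s) (of j) = ψ (of j) := fun j hj => by
      rw [MulAut.mul_apply, hs.2 j hj]
    have hlt : (Finset.univ.filter fun j => (ψ * s) (of j) ≠ of j).card < c := by
      rw [← hc]
      apply Finset.card_lt_card
      rw [Finset.ssubset_iff_of_subset]
      · exact ⟨i, Finset.mem_filter.2 ⟨Finset.mem_univ _, hi⟩,
          fun h => (Finset.mem_filter.1 h).2 e1⟩
      · intro j hj
        rw [Finset.mem_filter] at hj ⊢
        by_cases hji : j = i
        · subst hji
          exact absurd e1 hj.2
        · rw [e2 j hji] at hj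
          exact hj
    have := ih _ hlt (ψ * s) (fun j => ?_) rfl
    · have h2 := mul_mem this (inv_mem hsH)
      rwa [mul_inv_cancel_right] at h2
    · by_cases hji : j = i
      · subst hji
        exact .inl e1
      · rw [e2 j hji]
        exact hψ j
  | swap_mul f x y hxy ih =>
    intro ψ hψ
    obtain ⟨w, hw, h1, h2, h3⟩ := exists_signedSwap hH hxy
    have hinv : ∀ j, w⁻¹ (of (Equiv.swap x y j)) = of j ∨
        w⁻¹ (of (Equiv.swap x y j)) = (of j)⁻¹ := by
      intro j
      by_cases hjx : j = x
      · subst hjx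
        rw [Equiv.swap_apply_left]
        exact .inl (inv_apply_eq_of h1)
      by_cases hjy : j = y
      · subst hjy
        rw [Equiv.swap_apply_right]
        exact .inr (inv_apply_eq_of (by rw [_root_.map_inv, h2, inv_inv]))
      · rw [Equiv.swap_apply_of_ne_of_ne hjx hjy]
        exact .inl (inv_apply_eq_of (h3 j hjx hjy))
    have := ih (w⁻¹ * ψ) fun i => ?_
    · have h4 := mul_mem hw this
      rwa [mul_inv_cancel_left] at h4
    · rw [MulAut.mul_apply]
      rcases hψ i with h | h <;> rw [h, Equiv.Perm.mul_apply]
      · exact hinv (f i)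
      · rw [_root_.map_inv]
        rcases hinv (f i) with h | h <;> rw [h]
        · exact .inr rfl
        · rw [inv_inv]; exact .inl rfl

/-- The automorphism group of a free group is generated by the transvections and one sign flip. -/
theorem eq_top_of_transvections {H : Subgroup (MulAut (FreeGroup ι))}
    (hH : ∀ g, IsTransvection g → g ∈ H) {s : MulAut (FreeGroup ι)} {k : ι}
    (hs : IsSignFlip k s) (hsH : s ∈ H) : H = ⊤ := by
  rw [eq_top_iff]
  intro φ _
  obtain ⟨τ, hτ, σ, hσ⟩ := exists_isSignedPerm hH φ
  have := mul_mem (IsSignedPerm.mem hH hs hsH σ _ hσ) (inv_mem hτ)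
  rwa [mul_inv_cancel_right] at this

end Minimize

end

lemma freeGroup_eq_one_of_central {ι : Type*} [Nontrivial ι] {x : FreeGroup ι}
    (h : ∀ i, FreeGroup.of i * x = x * FreeGroup.of i) : x = 1 := by
  classical
  rw [← FreeGroup.toWord_eq_nil_iff]
  match hw : x.toWord with
  | [] => rfl
  | (a, ε) :: w =>
    obtain ⟨c, hc⟩ := exists_ne a
    have e1 : (FreeGroup.of c * x).toWord = (c, true) :: (a, ε) :: w := by
      rw [FreeGroup.toWord_mul, FreeGroup.toWord_of, List.singleton_append, FreeGroup.reduce.cons,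
        FreeGroup.reduce_toWord, hw]
      simp [hc]
    have e2 : (x * FreeGroup.of c).toWord = ((a, ε) :: w) ++ [(c, true)] := by
      have hred := (FreeGroup.reduce.red (L := x.toWord ++ [(c, true)])).sublist
      rw [← FreeGroup.toWord_of, ← FreeGroup.toWord_mul] at hred
      rw [← hw, ← FreeGroup.toWord_of]
      refine hred.eq_of_length ?_
      rw [← h c, e1, FreeGroup.toWord_of, hw]
      simp
    rw [h c, e2] at e1
    simp only [List.cons_append, List.cons.injEq, Prod.mk.injEq] at e1
    exact absurd e1.1.1.symm hc

lemma conj_freeGroup_injective {ι : Type*} [Nontrivial ι] :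
    Function.Injective (MulAut.conj : FreeGroup ι →* MulAut (FreeGroup ι)) := by
  rw [injective_iff_map_eq_one]
  intro x hx
  refine freeGroup_eq_one_of_central fun i => ?_
  have := DFunLike.congr_fun hx (FreeGroup.of i)
  rw [MulAut.conj_apply, MulAut.one_apply, mul_inv_eq_iff_eq_mul] at this
  exact this.symm

lemma IsTransvection.congr {G H : Type} [Group G] [Group H] (e : G ≃* H) {g : MulAut G}
    (hg : IsTransvection g) : IsTransvection (MulAut.congr e g) := by
  obtain ⟨κ, b, k, l, hkl, hb⟩ := hg
  refine ⟨κ, b.map e, k, l, hkl, mem_others _ hkl.symm, one_mem _, ?_,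
    fun x hx => fixes_others (fun j hj => ?_) hx⟩
  · change e (g (e.symm (e (b k)))) = e (b l) * e (b k) * 1
    rw [e.symm_apply_apply, hb.self, _root_.map_mul, _root_.map_mul, _root_.map_one]
  · change e (g (e.symm (e (b j)))) = e (b j)
    rw [e.symm_apply_apply, hb.apply hj]

section OddOrder

variable {n : ℕ}

lemma IsSignFlip.detρ_eq {k : Fin n} {s : FrAut n} (hs : IsSignFlip k s) : detρ n s = -1 := by
  apply Units.ext
  change (mat s).det = -1
  have : mat s = Matrix.diagonal fun i => if i = k then -1 else 1 := by
    ext i j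
    simp only [mat, Matrix.of_apply, Matrix.diagonal_apply]
    by_cases hj : j = k
    · subst hj
      rw [hs.1]
      by_cases hij : i = j <;> simp [expSum, hij, eq_comm]
    · rw [hs.2 j hj]
      by_cases hij : i = j
      · subst hij
        simp [expSum, hj]
      · simp [expSum, hij, eq_comm]
  rw [this, Matrix.det_diagonal]
  simp

/-- A normal subgroup containing a transvection contains `SAut(F_n)`. -/
theorem sAut_le_of_isTransvection {N : Subgroup (FrAut n)} [N.Normal] (hn : 0 < n)
    (hN : N ≤ SAut n) {t : FrAut n} (ht : IsTransvection t) (htN : t ∈ N) : SAut n ≤ N := by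
  obtain ⟨s, hs⟩ := exists_isSignFlip (⟨0, hn⟩ : Fin n)
  have htop : N ⊔ Subgroup.zpowers s = ⊤ :=
    eq_top_of_transvections
      (fun g hg => (le_sup_left : N ≤ N ⊔ Subgroup.zpowers s) (ht.mem_of_mem htN hg)) hs
      ((le_sup_right : _ ≤ N ⊔ Subgroup.zpowers s) (Subgroup.mem_zpowers s))
  intro g hg
  obtain ⟨ν, hν, -, ⟨z, rfl⟩, rfl⟩ :=
    Subgroup.mem_sup_of_normal_left.1 (htop ▸ Subgroup.mem_top g)
  have hdet : detρ n (ν * s ^ z) = 1 := hg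
  have hdν : detρ n ν = 1 := hN hν
  rw [_root_.map_mul, hdν, one_mul, _root_.map_zpow, hs.detρ_eq] at hdet
  rcases Int.even_or_odd z with ⟨m, rfl⟩ | hz
  · change ν * s ^ (m + m) ∈ N
    rw [← two_mul, _root_.zpow_mul, zpow_two, hs.mul_self, _root_.one_zpow, mul_one]
    exact hν
  · rw [hz.neg_one_zpow] at hdet
    exact absurd hdet (by decide)

/-- An element of odd prime order in `Out(F_n)` has a transvection in its normal closure. -/
theorem exists_transvection_of_orderOf {p : ℕ} (hn : 3 ≤ n) [Fact p.Prime] (hodd : Odd p)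
    {f : OutF n} (hf : orderOf f = p) :
    ∃ g ∈ (Subgroup.normalClosure {f}).comap (toOut n), IsTransvection g := by
  have : Nontrivial (Fin n) := Fin.nontrivial_iff_two_le.2 (by omega)
  let E : Subgroup (FrAut n) := (Subgroup.zpowers f).comap (toOut n)
  have hE : E ≤ (Subgroup.normalClosure {f}).comap (toOut n) := Subgroup.comap_mono
    (Subgroup.zpowers_le.2 (Subgroup.subset_normalClosure (Set.mem_singleton f)))
  let z : Subgroup.zpowers f ≃* Multiplicative (ZMod p) :=
    mulEquivOfPrimeCardEq (p := p) (by rw [Nat.card_zpowers, hf]) (by simp)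
  let θ : E →* Multiplicative (ZMod p) :=
    z.toMonoidHom.comp ((toOut n).subgroupComap (Subgroup.zpowers f))
  have hθ : Function.Surjective θ := z.surjective.comp
    ((toOut n).subgroupComap_surjective_of_surjective _ (QuotientGroup.mk'_surjective _))
  have hker : ∀ a : E, a ∈ θ.ker ↔ (a : FrAut n) ∈ Inn n := by
    intro a
    rw [MonoidHom.mem_ker]
    change z _ = 1 ↔ _
    rw [MulEquiv.map_eq_one_iff, ← QuotientGroup.eq_one_iff, Subtype.ext_iff]
    rfl
  have hinn : ∀ x : FreeGroup (Fin n), MulAut.conj x ∈ E := by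
    intro x
    have : toOut n (MulAut.conj x) = 1 := (QuotientGroup.eq_one_iff _).2 ⟨x, rfl⟩
    exact Subgroup.mem_comap.2 (this ▸ one_mem _)
  let c : FreeGroup (Fin n) →* θ.ker :=
    (MulAut.conj.codRestrict E hinn).codRestrict θ.ker fun x => (hker _).2 ⟨x, rfl⟩
  have hc : Function.Bijective c := by
    constructor
    · intro x y hxy
      exact conj_freeGroup_injective (congrArg (fun a : θ.ker => ((a : E) : FrAut n)) hxy)
    · rintro ⟨a, ha⟩
      obtain ⟨x, hx⟩ := (hker a).1 ha
      exact ⟨x, Subtype.ext (Subtype.ext hx)⟩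
  let e : FreeGroup (Fin n) ≃* θ.ker := MulEquiv.ofBijective c hc
  have hconj : ∀ a : E, MulAut.congr e.symm (MulAut.conjNormal a : MulAut θ.ker) = (a : FrAut n) :=
      by
    intro a
    apply MulEquiv.ext
    intro x
    change e.symm (MulAut.conjNormal a (e x)) = _
    rw [MulEquiv.symm_apply_eq]
    apply Subtype.ext
    apply Subtype.ext
    rw [MulAut.conjNormal_apply]
    change (a : FrAut n) * MulAut.conj x * (a : FrAut n)⁻¹ = MulAut.conj ((a : FrAut n) x)
    apply MulEquiv.ext
    intro y
    simp [-MulAut.coe_inv, -MulAut.inv_apply, MulAut.mul_apply, MulAut.apply_inv_self]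
  obtain ⟨g, hgN, hg⟩ := exists_transvection_of_extension hn hodd hθ
    ((FreeGroupBasis.ofFreeGroup (Fin n)).map e)
    (N := ((Subgroup.normalClosure {f}).comap (toOut n)).comap (MulAut.congr e.symm).toMonoidHom)
    (fun a ha h => by
      have h1 := hconj a
      rw [h, _root_.map_one] at h1
      rw [show a = 1 from Subtype.ext h1.symm, _root_.map_one] at ha
      exact absurd (Multiplicative.ofAdd.injective ha) zero_ne_one)
    (fun a _ => by
      change MulAut.congr e.symm (MulAut.conjNormal a : MulAut θ.ker) ∈
        (Subgroup.normalClosure {f}).comap (toOut n)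
      rw [hconj]
      exact hE a.2)
  exact ⟨_, hgN, hg.congr e.symm⟩

end OddOrder

/-- **Proposition 1.6.** For `n ≥ 3` and an odd prime `p`, if `f ∈ Out(F_n)` has order `p`,
then `N(f) = SOut(F_n)` if `det ρ̄(f) = 1` and `N(f) = Out(F_n)` if `det ρ̄(f) = -1`. -/
theorem normalClosure_odd_prime_order_out (n p : ℕ) (hn : 3 ≤ n) (hp : p.Prime) (hodd : Odd p)
    (f : OutF n) (hf : orderOf f = p) :
    (detρOut n f = 1 → Subgroup.normalClosure {f} = SOut n) ∧
    (detρOut n f = -1 → Subgroup.normalClosure {f} = ⊤) := by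
  have := Fact.mk hp
  refine ⟨fun hdet => le_antisymm ?_ ?_, fun hdet => ?_⟩
  · have : (SOut n).Normal := MonoidHom.normal_ker _
    exact Subgroup.normalClosure_le_normal (Set.singleton_subset_iff.2 hdet)
  · have hle : (Subgroup.normalClosure {f}).comap (toOut n) ≤ SAut n := by
      have : (SOut n).Normal := MonoidHom.normal_ker _
      intro g hg
      exact Subgroup.normalClosure_le_normal (N := SOut n) (Set.singleton_subset_iff.2 hdet) hg
    obtain ⟨t, htN, ht⟩ := exists_transvection_of_orderOf hn hodd hf
    intro y hy
    obtain ⟨g, rfl⟩ := QuotientGroup.mk'_surjective (Inn n) y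
    exact sAut_le_of_isTransvection (by omega) hle ht htN hy
  · have h := congrArg (fun x => detρOut n x) (hf ▸ pow_orderOf_eq_one f)
    simp only [_root_.map_pow, _root_.map_one, hdet, hodd.neg_one_pow] at h
    exact absurd h (by decide)

end NormalClosurePaper
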